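/- Let φ be subharmonic on ℂ with doubling Laplacian, ω a flat weight for φ, 1 ≤ p ≤ ∞, and let Λ be a ρ-separated sampling sequence for F^p_{φ,ω}. Then there exists ε > 0 such that for every p' ∈ [1,∞] and every flat weight ω̃ for φ, the sequence Λ is sampling for F^{p'}_{(1+ε)φ, ω̃}. -/

import Mathlib

open MeasureTheory Metric Filter Set
open scoped ENNReal NNReal Real Topology Classical

noncomputable section

/-- The Laplacian of a function on `ℂ ≅ ℝ²`, computed via the second Fréchet derivative. -/
def lap (v : ℂ → ℝ) (z : ℂ) : ℝ :=
  iteratedFDeriv ℝ 2 v z ![1, 1] + iteratedFDeriv ℝ 2 v z ![Complex.I, Complex.I]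

/-- `μ` is a doubling measure on `ℂ` with doubling constant `C`. -/
def IsDoubling (μ : Measure ℂ) (C : ℝ≥0) : Prop :=
  ∀ z : ℂ, ∀ r : ℝ, 0 < r → μ (ball z (2 * r)) ≤ C * μ (ball z r)

/-- `φ` is a (continuous) subharmonic function whose distributional Laplacian is the
doubling measure `μ` (not identically zero).  The distributional identity is expressed
by testing against smooth compactly supported functions. -/
structure HasDoublingLaplacian (φ : ℂ → ℝ) (μ : Measure ℂ) : Prop where
  continuous : Continuous φ
  lap_eq : ∀ v : ℂ → ℝ, ContDiff ℝ (⊤ : ℕ∞) v → HasCompactSupport v →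
    ∫ z, φ z * lap v z = ∫ z, v z ∂μ
  doubling : ∃ C : ℝ≥0, 0 < C ∧ IsDoubling μ C
  ne_zero : μ ≠ 0

/-- `ρ` assigns to every `z` the positive radius such that the disk `D(z, ρ z)` has
`μ`-mass `1`. -/
def IsRadius (μ : Measure ℂ) (ρ : ℂ → ℝ) : Prop :=
  ∀ z : ℂ, 0 < ρ z ∧ μ (ball z (ρ z)) = 1

/-- The distance induced by the metric `ρ(z)⁻² dz⊗d\bar z`: infimum of lengths of
`C¹` curves joining the two points. -/
def pathDist (ρ : ℂ → ℝ) (z ζ : ℂ) : ℝ :=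
  sInf { L : ℝ | ∃ γ : ℝ → ℂ, γ 0 = z ∧ γ 1 = ζ ∧ ContDiff ℝ 1 γ ∧
    L = ∫ t in (0:ℝ)..1, ‖deriv γ t‖ / ρ (γ t) }

/-- The `pathDist` from a point to a set. -/
def pathDistSet (ρ : ℂ → ℝ) (z : ℂ) (Λ : Set ℂ) : ℝ :=
  ⨅ l : Λ, pathDist ρ z l.1

/-- A flat weight for `φ`: a positive measurable function whose logarithm has slow
growth with respect to the induced distance. -/
def IsFlatWeight (ρ : ℂ → ℝ) (ω : ℂ → ℝ) : Prop :=
  (∀ z, 0 < ω z) ∧ Measurable ω ∧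
  ∃ C : ℝ, 0 < C ∧ ∀ z ζ : ℂ,
    |Real.log (ω z) - Real.log (ω ζ)| ≤ C * (1 + max (Real.log (pathDist ρ z ζ)) 0)

/-- The norm of the space `F^p_{φ,ω}` (with `p = ∞` giving the weighted sup norm). -/
def Fnorm (p : ℝ≥0∞) (φ ω ρ : ℂ → ℝ) (f : ℂ → ℂ) : ℝ≥0∞ :=
  if p = ∞ then ⨆ z : ℂ, ENNReal.ofReal (ω z * ‖f z‖ * Real.exp (-φ z))
  else (∫⁻ z, ENNReal.ofReal
      (‖f z‖ ^ p.toReal * Real.exp (-(p.toReal * φ z)) * ω z ^ p.toReal / ρ z ^ 2)) ^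
      (1 / p.toReal)

/-- Membership in `F^p_{φ,ω}`: entire with finite norm. -/
def MemF (p : ℝ≥0∞) (φ ω ρ : ℂ → ℝ) (f : ℂ → ℂ) : Prop :=
  Differentiable ℂ f ∧ Fnorm p φ ω ρ f < ∞

/-- The norm of the sequence space `ℓ^p_{φ,ω}(Λ)`. -/
def lnorm (p : ℝ≥0∞) (φ ω : ℂ → ℝ) (Λ : Set ℂ) (v : ℂ → ℂ) : ℝ≥0∞ :=
  if p = ∞ then ⨆ l : Λ, ENNReal.ofReal (ω l.1 * ‖v l.1‖ * Real.exp (-φ l.1))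
  else (∑' l : Λ, ENNReal.ofReal
      (ω l.1 ^ p.toReal * ‖v l.1‖ ^ p.toReal * Real.exp (-(p.toReal * φ l.1)))) ^
      (1 / p.toReal)

/-- `Λ` is a sampling sequence for `F^p_{φ,ω}`. -/
def IsSampling (p : ℝ≥0∞) (φ ω ρ : ℂ → ℝ) (Λ : Set ℂ) : Prop :=
  if p = ∞ then
    ∃ C : ℝ≥0, 0 < C ∧ ∀ f : ℂ → ℂ, MemF ∞ φ ω ρ f →
      Fnorm ∞ φ ω ρ f ≤ C * lnorm ∞ φ ω Λ f
  else
    ∃ C : ℝ≥0, 0 < C ∧ ∀ f : ℂ → ℂ, MemF p φ ω ρ f →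
      (C : ℝ≥0∞)⁻¹ * lnorm p φ ω Λ f ≤ Fnorm p φ ω ρ f ∧
      Fnorm p φ ω ρ f ≤ C * lnorm p φ ω Λ f

/-- `Λ` is an interpolating sequence for `F^p_{φ,ω}`. -/
def IsInterpolating (p : ℝ≥0∞) (φ ω ρ : ℂ → ℝ) (Λ : Set ℂ) : Prop :=
  ∀ v : ℂ → ℂ, lnorm p φ ω Λ v < ∞ →
    ∃ f : ℂ → ℂ, MemF p φ ω ρ f ∧ ∀ l ∈ Λ, f l = v l

/-- `Λ` is `ρ`-separated. -/
def RhoSeparated (ρ : ℂ → ℝ) (Λ : Set ℂ) : Prop :=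
  ∃ δ : ℝ, 0 < δ ∧ ∀ l ∈ Λ, ∀ l' ∈ Λ, l ≠ l' → δ * max (ρ l) (ρ l') ≤ dist l l'

/-- `Λ` is a finite union of `ρ`-separated sequences. -/
def FiniteUnionSeparated (ρ : ℂ → ℝ) (Λ : Set ℂ) : Prop :=
  ∃ n : ℕ, ∃ Λs : Fin n → Set ℂ, Λ = ⋃ i, Λs i ∧ ∀ i, RhoSeparated ρ (Λs i)

/-- Upper uniform density of `Λ` with respect to the doubling measure `μ`. -/
def upperUnifDensity (μ : Measure ℂ) (ρ : ℂ → ℝ) (Λ : Set ℂ) : ℝ≥0∞ :=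
  limsup (fun r : ℝ =>
    ⨆ z : ℂ, Measure.count (Λ ∩ closedBall z (r * ρ z)) / μ (ball z (r * ρ z))) atTop

/-- Lower uniform density of `Λ` with respect to the doubling measure `μ`. -/
def lowerUnifDensity (μ : Measure ℂ) (ρ : ℂ → ℝ) (Λ : Set ℂ) : ℝ≥0∞ :=
  liminf (fun r : ℝ =>
    ⨅ z : ℂ, Measure.count (Λ ∩ closedBall z (r * ρ z)) / μ (ball z (r * ρ z))) atTop

/-- The Cauchy–Riemann operator `∂̄` on `ℂ`-valued functions. -/
def dbar (v : ℂ → ℂ) (z : ℂ) : ℂ :=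
  (fderiv ℝ v z 1 + Complex.I • fderiv ℝ v z Complex.I) / 2

/-- `∂̄ u = f` in the sense of distributions. -/
def IsDistribDbarOf (u f : ℂ → ℂ) : Prop :=
  ∀ v : ℂ → ℂ, ContDiff ℝ (⊤ : ℕ∞) v → HasCompactSupport v →
    ∫ z, f z * v z = - ∫ z, u z * dbar v z

/-- Closed axis-parallel rectangle with centre `a` and half-sides `s, t`. -/
def axisRect (a : ℂ) (s t : ℝ) : Set ℂ :=
  {w : ℂ | |w.re - a.re| ≤ s ∧ |w.im - a.im| ≤ t}



noncomputable section

/-! ### Geometry of doubling measures -/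

structure DGeo (μ : Measure ℂ) (ρ : ℂ → ℝ) : Prop where
  dbl : ∃ C : ℝ≥0, 0 < C ∧ IsDoubling μ C
  rad : IsRadius μ ρ

/-- normalised distance -/
def Dd (ρ : ℂ → ℝ) (z w : ℂ) : ℝ := 1 + dist z w / ρ z

namespace DGeo

variable {μ : Measure ℂ} {ρ : ℂ → ℝ}

lemma rho_pos (h : DGeo μ ρ) (z : ℂ) : 0 < ρ z := (h.rad z).1

lemma finite_ball (h : DGeo μ ρ) (z : ℂ) (r : ℝ) : μ (ball z r) < ∞ := by
  obtain ⟨C, hC, hd⟩ := h.dbl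
  have key : ∀ n : ℕ, μ (ball z (2 ^ n * ρ z)) < ∞ := by
    intro n
    induction n with
    | zero => simp [(h.rad z).2]
    | succ n ih =>
      have := hd z (2 ^ n * ρ z) (by have := h.rho_pos z; positivity)
      rw [pow_succ, mul_comm (2 ^ n : ℝ) 2, mul_assoc]
      exact this.trans_lt (ENNReal.mul_lt_top (by simp) ih)
  obtain ⟨n, hn⟩ := pow_unbounded_of_one_lt (r / ρ z) (one_lt_two)
  refine (measure_mono (ball_subset_ball ?_)).trans_lt (key n)
  rw [div_lt_iff₀ (h.rho_pos z)] at hn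
  exact hn.le

lemma real_rho (h : DGeo μ ρ) (z : ℂ) : μ.real (ball z (ρ z)) = 1 := by
  simp [Measure.real, (h.rad z).2]

lemma real_mono (h : DGeo μ ρ) {z : ℂ} {r : ℝ} {s : Set ℂ} (hs : s ⊆ ball z r) :
    μ.real s ≤ μ.real (ball z r) :=
  measureReal_mono hs (h.finite_ball z r).ne

lemma dbl_real (h : DGeo μ ρ) : ∃ n : ℕ, ∀ z : ℂ, ∀ r : ℝ, 0 < r →
    μ.real (ball z (2 * r)) ≤ 2 ^ n * μ.real (ball z r) := by
  obtain ⟨C, hC, hd⟩ := h.dbl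
  obtain ⟨n, hn⟩ := pow_unbounded_of_one_lt (C : ℝ) (one_lt_two)
  refine ⟨n, fun z r hr => ?_⟩
  have h1 := ENNReal.toReal_mono (ENNReal.mul_ne_top (by simp) (h.finite_ball z r).ne) (hd z r hr)
  rw [ENNReal.toReal_mul] at h1
  simp only [ENNReal.coe_toReal] at h1
  refine h1.trans ?_
  exact mul_le_mul_of_nonneg_right hn.le ENNReal.toReal_nonneg

lemma growth (h : DGeo μ ρ) : ∃ n : ℕ, ∀ z : ℂ, ∀ r s : ℝ, 0 < r → 1 ≤ s →
    μ.real (ball z (s * r)) ≤ (2 * s) ^ n * μ.real (ball z r) := by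
  obtain ⟨n, hn⟩ := h.dbl_real
  refine ⟨n, fun z r s hr hs => ?_⟩
  have key : ∀ m : ℕ, μ.real (ball z (2 ^ m * r)) ≤ (2 ^ m) ^ n * μ.real (ball z r) := by
    intro m
    induction m with
    | zero => simp
    | succ m ih =>
      have := hn z (2 ^ m * r) (by positivity)
      rw [pow_succ, mul_comm (2 ^ m : ℝ) 2, mul_assoc]
      refine this.trans ?_
      rw [mul_pow, mul_assoc]
      gcongr
  obtain ⟨m, hm1, hm2⟩ := exists_nat_pow_near hs (one_lt_two)
  have h1 := key (m + 1)
  have h2 : μ.real (ball z (s * r)) ≤ μ.real (ball z (2 ^ (m + 1) * r)) := by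
    apply h.real_mono
    apply ball_subset_ball
    gcongr
  refine h2.trans (h1.trans ?_)
  gcongr
  rw [pow_succ]; linarith

lemma pos_ball (h : DGeo μ ρ) (z : ℂ) {r : ℝ} (hr : 0 < r) : 0 < μ.real (ball z r) := by
  obtain ⟨n, hn⟩ := h.growth
  have h1 := hn z r (max 1 (ρ z / r)) hr (le_max_left _ _)
  have h2 : μ.real (ball z (ρ z)) ≤ μ.real (ball z (max 1 (ρ z / r) * r)) := by
    apply h.real_mono
    apply ball_subset_ball
    calc ρ z = ρ z / r * r := by field_simp
      _ ≤ _ := by gcongr; exact le_max_right _ _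
  rw [h.real_rho] at h2
  by_contra hcon
  have : μ.real (ball z r) = 0 := le_antisymm (not_lt.mp hcon) measureReal_nonneg
  rw [this] at h1
  linarith

lemma rho_lip (h : DGeo μ ρ) (z w : ℂ) : ρ z ≤ ρ w + dist z w := by
  by_contra hcon
  push Not at hcon
  -- a small ball inside the gap
  set d := ρ w + dist z w with hd
  have hd0 : 0 < d := by have := h.rho_pos w; have := dist_nonneg (x := z) (y := w); linarith
  set m := (ρ z + d) / 2 with hm
  set e := (ρ z - d) / 2 with he
  have he0 : 0 < e := by rw [he]; linarith
  have hmz : dist (z + (m : ℂ)) z = m := by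
    rw [dist_eq_norm]; simp only [add_sub_cancel_left, Complex.norm_real, Real.norm_eq_abs]
    rw [abs_of_pos]; rw [hm]; linarith
  have hsub1 : ball (z + (m : ℂ)) e ⊆ ball z (ρ z) := by
    apply ball_subset_ball'
    rw [hmz, he, hm]; linarith
  have hsub2 : ball w (ρ w) ⊆ ball z (ρ z) := by
    apply ball_subset_ball'
    rw [dist_comm]; exact hcon.le
  have hdisj : Disjoint (ball w (ρ w)) (ball (z + (m : ℂ)) e) := by
    apply ball_disjoint_ball
    have := dist_triangle_right (z + (m : ℂ)) z w
    have h3 : dist (z + (m : ℂ)) z ≤ dist (z + (m : ℂ)) w + dist w z := dist_triangle _ _ _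
    rw [hmz] at h3
    rw [dist_comm w (z + (m : ℂ))]
    rw [dist_comm w z] at h3
    rw [he]; linarith
  have h4 : μ.real (ball w (ρ w) ∪ ball (z + (m : ℂ)) e) =
      μ.real (ball w (ρ w)) + μ.real (ball (z + (m : ℂ)) e) :=
    measureReal_union hdisj measurableSet_ball (h.finite_ball _ _).ne (h.finite_ball _ _).ne
  have h5 := h.real_mono (z := z) (r := ρ z) (union_subset hsub2 hsub1)
  rw [h4, h.real_rho, h.real_rho] at h5
  have := h.pos_ball (z + (m : ℂ)) he0
  linarith

lemma rho_cont (h : DGeo μ ρ) : Continuous ρ := by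
  have : LipschitzWith 1 ρ := by
    apply LipschitzWith.of_dist_le_mul
    intro x y
    rw [Real.dist_eq, abs_le]
    have h1 := h.rho_lip x y
    have h2 := h.rho_lip y x
    rw [dist_comm y x] at h2
    constructor <;> simp <;> linarith
  exact this.continuous

lemma rev (h : DGeo μ ρ) : ∃ b : ℝ, 1 < b ∧ ∀ z : ℂ, ∀ r : ℝ, 0 < r →
    b * μ.real (ball z r) ≤ μ.real (ball z (4 * r)) := by
  obtain ⟨n, hn⟩ := h.growth
  refine ⟨1 + ((2 * 4 : ℝ) ^ n)⁻¹, by simp; , fun z r hr => ?_⟩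
  set z' := z + ((2 * r : ℝ) : ℂ) with hz'
  have hzz : dist z' z = 2 * r := by
    rw [hz', dist_eq_norm, add_sub_cancel_left, Complex.norm_real, Real.norm_eq_abs, abs_of_pos]
    linarith
  have h1 := hn z' r 4 hr (by norm_num)
  have h2 : μ.real (ball z r) ≤ μ.real (ball z' (4 * r)) := by
    apply h.real_mono
    apply ball_subset_ball'
    rw [dist_comm, hzz]; linarith
  have hdisj : Disjoint (ball z r) (ball z' r) := by
    apply ball_disjoint_ball
    rw [dist_comm, hzz]; linarith
  have h4 : μ.real (ball z r ∪ ball z' r) = μ.real (ball z r) + μ.real (ball z' r) :=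
    measureReal_union hdisj measurableSet_ball (h.finite_ball _ _).ne (h.finite_ball _ _).ne
  have h5 : μ.real (ball z r ∪ ball z' r) ≤ μ.real (ball z (4 * r)) := by
    apply h.real_mono
    apply union_subset
    · apply ball_subset_ball; linarith
    · apply ball_subset_ball'; rw [hzz]; linarith
  rw [h4] at h5
  have h6 : ((2 * 4 : ℝ) ^ n)⁻¹ * μ.real (ball z r) ≤ μ.real (ball z' r) := by
    rw [inv_mul_le_iff₀ (by positivity)]
    linarith
  linarith

lemma rev_growth (h : DGeo μ ρ) : ∃ q : ℕ, 0 < q ∧ ∀ z : ℂ, ∀ r s : ℝ, 0 < r → 1 ≤ s →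
    s * μ.real (ball z r) ^ q ≤ 4 * μ.real (ball z (s * r)) ^ q := by
  obtain ⟨b, hb, hbb⟩ := h.rev
  obtain ⟨q, hq⟩ := pow_unbounded_of_one_lt (4 : ℝ) hb
  have hq0 : 0 < q := by
    rcases Nat.eq_zero_or_pos q with rfl | hq'
    · norm_num at hq
    · exact hq'
  refine ⟨q, hq0, fun z r s hr hs => ?_⟩
  have key : ∀ m : ℕ, b ^ m * μ.real (ball z r) ≤ μ.real (ball z (4 ^ m * r)) := by
    intro m
    induction m with
    | zero => simp
    | succ m ih =>
      have := hbb z (4 ^ m * r) (by positivity)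
      rw [pow_succ (4 : ℝ), mul_comm (4 ^ m : ℝ) 4, mul_assoc]
      refine le_trans ?_ this
      rw [pow_succ, mul_comm (b ^ m), mul_assoc]
      gcongr
  obtain ⟨m, hm1, hm2⟩ := exists_nat_pow_near hs (by norm_num : (1 : ℝ) < 4)
  have h1 : b ^ m * μ.real (ball z r) ≤ μ.real (ball z (s * r)) := by
    refine (key m).trans ?_
    apply h.real_mono
    apply ball_subset_ball
    gcongr
  have h2 : (4 : ℝ) ^ m ≤ (b ^ m) ^ q := by
    rw [← pow_mul, mul_comm, pow_mul]
    gcongr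
  calc s * μ.real (ball z r) ^ q ≤ (4 * 4 ^ m) * μ.real (ball z r) ^ q := by
        gcongr; rw [pow_succ] at hm2; linarith
    _ ≤ (4 * (b ^ m) ^ q) * μ.real (ball z r) ^ q := by gcongr
    _ = 4 * (b ^ m * μ.real (ball z r)) ^ q := by rw [mul_pow]; ring
    _ ≤ _ := by gcongr

/-! normalised distance -/

lemma Dd_ge (h : DGeo μ ρ) (z w : ℂ) : 1 ≤ Dd ρ z w := by
  have := h.rho_pos z
  have : 0 ≤ dist z w / ρ z := by positivity
  unfold Dd; linarith

lemma Dd_pos (h : DGeo μ ρ) (z w : ℂ) : 0 < Dd ρ z w := lt_of_lt_of_le one_pos (h.Dd_ge z w)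

lemma rho_mul_Dd (h : DGeo μ ρ) (z w : ℂ) : ρ z * Dd ρ z w = ρ z + dist z w := by
  have := h.rho_pos z
  unfold Dd; field_simp

lemma rho_le (h : DGeo μ ρ) (z w : ℂ) : ρ w ≤ ρ z * Dd ρ z w := by
  rw [h.rho_mul_Dd, dist_comm]; exact h.rho_lip w z

lemma Dd_tri (h : DGeo μ ρ) (z x w : ℂ) : Dd ρ z w ≤ Dd ρ z x * Dd ρ x w := by
  have hz := h.rho_pos z
  have hx := h.rho_pos x
  have h1 := h.rho_le z x
  have h2 : Dd ρ z w * ρ z ≤ Dd ρ z x * Dd ρ x w * ρ z := by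
    have e1 : Dd ρ z w * ρ z = ρ z + dist z w := by rw [mul_comm, h.rho_mul_Dd]
    rw [e1]
    have e2 : Dd ρ x w = 1 + dist x w / ρ x := rfl
    have h3 : dist x w ≤ (ρ z * Dd ρ z x) * (dist x w / ρ x) := by
      calc dist x w = ρ x * (dist x w / ρ x) := by field_simp
        _ ≤ _ := by gcongr
    have := dist_triangle z x w
    have e3 := h.rho_mul_Dd z x
    rw [e2]
    nlinarith
  exact le_of_mul_le_mul_right h2 hz

lemma Dd_cont (h : DGeo μ ρ) (z : ℂ) : Continuous (fun w => Dd ρ z w) := by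
  unfold Dd; fun_prop

lemma Dd_cont' (h : DGeo μ ρ) (w : ℂ) : Continuous (fun z => Dd ρ z w) := by
  unfold Dd
  have := h.rho_cont
  have h2 : ∀ z, ρ z ≠ 0 := fun z => (h.rho_pos z).ne'
  fun_prop (disch := assumption)

lemma Dd_meas (h : DGeo μ ρ) : Measurable (fun p : ℂ × ℂ => Dd ρ p.1 p.2) := by
  unfold Dd
  have := h.rho_cont.measurable
  fun_prop

lemma rho_poly (h : DGeo μ ρ) : ∃ k : ℕ, ∃ C : ℝ, 1 ≤ C ∧ ∀ z w,
    ρ z ≤ C * Dd ρ z w ^ k * ρ w := by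
  obtain ⟨n, hn⟩ := h.growth
  obtain ⟨q, hq0, hq⟩ := h.rev_growth
  refine ⟨n * q, 4 * 2 ^ (n * q), ?_, fun z w => ?_⟩
  · have : (1 : ℝ) ≤ 2 ^ (n * q) := one_le_pow₀ (by norm_num)
    linarith
  have hz := h.rho_pos z
  have hw := h.rho_pos w
  have hD := h.Dd_ge z w
  rcases le_or_gt (ρ z) (ρ w) with hle | hlt
  · have h1 : (1 : ℝ) ≤ 2 ^ (n * q) := one_le_pow₀ (by norm_num)
    have h2 : (1 : ℝ) ≤ Dd ρ z w ^ (n * q) := one_le_pow₀ hD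
    have h3 : (1 : ℝ) ≤ 4 * 2 ^ (n * q) * Dd ρ z w ^ (n * q) := by nlinarith
    nlinarith
  · have hs : 1 ≤ ρ z / ρ w := by rw [le_div_iff₀ hw]; linarith
    have h1 := hq w (ρ w) (ρ z / ρ w) hw hs
    rw [h.real_rho, one_pow, mul_one, div_mul_cancel₀ _ hw.ne'] at h1
    have h2 : μ.real (ball w (ρ z)) ≤ μ.real (ball z (Dd ρ z w * ρ z)) := by
      apply h.real_mono
      apply ball_subset_ball'
      rw [mul_comm, h.rho_mul_Dd, dist_comm]
    have h3 := hn z (ρ z) (Dd ρ z w) hz hD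
    rw [h.real_rho, mul_one] at h3
    have h4 : ρ z / ρ w ≤ 4 * ((2 * Dd ρ z w) ^ n) ^ q := by
      refine h1.trans ?_
      gcongr
      exact h2.trans h3
    rw [div_le_iff₀ hw] at h4
    refine h4.trans (le_of_eq ?_)
    rw [← pow_mul, mul_pow]
    ring

/-- quasi-symmetry -/
lemma Dd_symm (h : DGeo μ ρ) : ∃ k : ℕ, ∃ C : ℝ, 1 ≤ C ∧ ∀ z w,
    Dd ρ w z ≤ C * Dd ρ z w ^ k := by
  obtain ⟨k, C, hC, hk⟩ := h.rho_poly
  refine ⟨k + 1, 2 * C, by linarith, fun z w => ?_⟩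
  have hz := h.rho_pos z
  have hw := h.rho_pos w
  have hD := h.Dd_ge z w
  have h1 := hk z w
  have h0 : (1 : ℝ) ≤ C * Dd ρ z w ^ (k + 1) := by
    have : (1 : ℝ) ≤ Dd ρ z w ^ (k + 1) := one_le_pow₀ hD
    nlinarith
  have h2 : dist w z / ρ w ≤ C * Dd ρ z w ^ (k + 1) := by
    rw [div_le_iff₀ hw]
    have h3 : dist w z ≤ ρ z * Dd ρ z w := by
      rw [h.rho_mul_Dd, dist_comm]; linarith
    calc dist w z ≤ ρ z * Dd ρ z w := h3
      _ ≤ (C * Dd ρ z w ^ k * ρ w) * Dd ρ z w := by gcongr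
      _ = _ := by ring
  unfold Dd at h2 h0 ⊢
  linarith

end DGeo
end

noncomputable section

lemma lintegral_scale (F : ℂ → ℝ≥0∞) (hF : Measurable F) (z : ℂ) {r : ℝ} (hr : 0 < r) :
    ∫⁻ w, F (r⁻¹ • (w - z)) = ENNReal.ofReal (r ^ 2) * ∫⁻ w, F w := by
  have h0 : ∫⁻ w, F (r⁻¹ • (w - z)) = ∫⁻ w, F (r⁻¹ • w) :=
    lintegral_sub_right_eq_self (fun w => F (r⁻¹ • w)) z
  rw [h0]
  have h1 := Measure.map_addHaar_smul (volume : Measure ℂ) (r := r⁻¹) (by positivity)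
  have h2 : ∫⁻ w, F (r⁻¹ • w) = ∫⁻ w, F w ∂(Measure.map (fun x : ℂ => r⁻¹ • x) volume) := by
    rw [lintegral_map hF (by fun_prop)]
  rw [h2, h1, lintegral_smul_measure, Complex.finrank_real_complex]
  congr 2
  rw [abs_of_pos (by positivity)]; simp

lemma exists_decay_const : ∃ C : ℝ, 0 < C ∧
    ∫⁻ x : ℂ, ENNReal.ofReal (((1 + ‖x‖) ^ 3)⁻¹) ≤ ENNReal.ofReal C := by
  have h := finite_integral_one_add_norm (E := ℂ) (μ := volume) (r := 3)
    (by rw [Complex.finrank_real_complex]; norm_num)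
  refine ⟨(∫⁻ (x : ℂ), ENNReal.ofReal ((1 + ‖x‖) ^ (-(3 : ℝ)))).toReal + 1, by positivity, ?_⟩
  have h2 : ∫⁻ x : ℂ, ENNReal.ofReal (((1 + ‖x‖) ^ 3)⁻¹) =
      ∫⁻ (x : ℂ), ENNReal.ofReal ((1 + ‖x‖) ^ (-(3 : ℝ))) := by
    apply lintegral_congr
    intro x
    congr 1
    rw [Real.rpow_neg (by positivity)]
    norm_cast
  rw [h2, ENNReal.ofReal_add (by positivity) (by norm_num), ENNReal.ofReal_toReal h.ne]
  exact le_self_add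

namespace DGeo

variable {μ : Measure ℂ} {ρ : ℂ → ℝ}

lemma lint_Dd (h : DGeo μ ρ) : ∃ M : ℕ, ∃ C : ℝ, 0 < C ∧ ∀ z,
    ∫⁻ w, ENNReal.ofReal ((Dd ρ z w ^ M)⁻¹ / ρ w ^ 2) ≤ ENNReal.ofReal C := by
  obtain ⟨k, C, hC, hk⟩ := h.rho_poly
  obtain ⟨C1, hC1, hC1'⟩ := exists_decay_const
  refine ⟨2 * k + 3, C ^ 2 * C1, by positivity, fun z => ?_⟩
  have hz := h.rho_pos z
  have hpt : ∀ w, ENNReal.ofReal ((Dd ρ z w ^ (2 * k + 3))⁻¹ / ρ w ^ 2) ≤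
      ENNReal.ofReal (C ^ 2 / ρ z ^ 2) *
        (fun x : ℂ => ENNReal.ofReal (((1 + ‖x‖) ^ 3)⁻¹)) ((ρ z)⁻¹ • (w - z)) := by
    intro w
    have hw := h.rho_pos w
    have hD := h.Dd_pos z w
    simp only
    rw [← ENNReal.ofReal_mul (by positivity)]
    apply ENNReal.ofReal_le_ofReal
    have e1 : 1 + ‖(ρ z)⁻¹ • (w - z)‖ = Dd ρ z w := by
      unfold Dd
      rw [norm_smul, norm_inv, Real.norm_eq_abs, abs_of_pos hz, dist_comm, dist_eq_norm]
      ring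
    rw [e1]
    have h1 : ρ z ^ 2 ≤ (C * Dd ρ z w ^ k * ρ w) ^ 2 := by
      gcongr; exact hk z w
    rw [div_eq_mul_inv, ← mul_inv, div_eq_mul_inv, mul_assoc, ← mul_inv, ← div_eq_mul_inv,
      inv_eq_one_div, div_le_div_iff₀ (by positivity) (by positivity)]
    calc 1 * (ρ z ^ 2 * Dd ρ z w ^ 3) ≤ 1 * ((C * Dd ρ z w ^ k * ρ w) ^ 2 * Dd ρ z w ^ 3) := by
          gcongr
      _ = _ := by ring
  calc _ ≤ ∫⁻ w, ENNReal.ofReal (C ^ 2 / ρ z ^ 2) *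
        (fun x : ℂ => ENNReal.ofReal (((1 + ‖x‖) ^ 3)⁻¹)) ((ρ z)⁻¹ • (w - z)) :=
        lintegral_mono hpt
    _ = ENNReal.ofReal (C ^ 2 / ρ z ^ 2) * (ENNReal.ofReal (ρ z ^ 2) *
        ∫⁻ x : ℂ, ENNReal.ofReal (((1 + ‖x‖) ^ 3)⁻¹)) := by
        rw [lintegral_const_mul' _ _ ENNReal.ofReal_ne_top,
          lintegral_scale (fun x : ℂ => ENNReal.ofReal (((1 + ‖x‖) ^ 3)⁻¹)) (by fun_prop) z hz]
    _ ≤ ENNReal.ofReal (C ^ 2 / ρ z ^ 2) * (ENNReal.ofReal (ρ z ^ 2) * ENNReal.ofReal C1) := by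
        gcongr
    _ = _ := by
        rw [← ENNReal.ofReal_mul (by positivity), ← ENNReal.ofReal_mul (by positivity)]
        congr 1
        field_simp

lemma inv_pow_mono (h : DGeo μ ρ) (z w : ℂ) {M N : ℕ} (hMN : M ≤ N) :
    (Dd ρ z w ^ N)⁻¹ ≤ (Dd ρ z w ^ M)⁻¹ := by
  have := h.Dd_ge z w
  have := h.Dd_pos z w
  gcongr

/-- transposition of decay -/
lemma transp (h : DGeo μ ρ) (M : ℕ) : ∃ N : ℕ, ∃ C : ℝ, 1 ≤ C ∧ ∀ z w,
    (Dd ρ z w ^ N)⁻¹ ≤ C * (Dd ρ w z ^ M)⁻¹ := by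
  obtain ⟨k, C, hC, hk⟩ := h.Dd_symm
  refine ⟨k * M, C ^ M, one_le_pow₀ hC, fun z w => ?_⟩
  have h1 := h.Dd_pos z w
  have h2 := h.Dd_pos w z
  have h3 : Dd ρ w z ^ M ≤ C ^ M * Dd ρ z w ^ (k * M) := by
    rw [pow_mul, ← mul_pow]
    gcongr
    exact hk z w
  rw [inv_eq_one_div, ← div_eq_mul_inv, div_le_div_iff₀ (by positivity) (by positivity)]
  linarith

lemma lint_Dd' (h : DGeo μ ρ) : ∃ M : ℕ, ∃ C : ℝ, 0 < C ∧ ∀ w,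
    ∫⁻ z, ENNReal.ofReal ((Dd ρ z w ^ M)⁻¹ / ρ z ^ 2) ≤ ENNReal.ofReal C := by
  obtain ⟨M, C, hC, hM⟩ := h.lint_Dd
  obtain ⟨N, C', hC', hN⟩ := h.transp M
  refine ⟨N, C' * C, by positivity, fun w => ?_⟩
  calc _ ≤ ∫⁻ z, ENNReal.ofReal C' * ENNReal.ofReal ((Dd ρ w z ^ M)⁻¹ / ρ z ^ 2) := by
        apply lintegral_mono
        intro z
        simp only
        rw [← ENNReal.ofReal_mul (by positivity), ← mul_div_assoc]
        apply ENNReal.ofReal_le_ofReal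
        gcongr
        exact hN z w
    _ = ENNReal.ofReal C' * ∫⁻ z, ENNReal.ofReal ((Dd ρ w z ^ M)⁻¹ / ρ z ^ 2) := by
        rw [lintegral_const_mul' _ _ ENNReal.ofReal_ne_top]
    _ ≤ ENNReal.ofReal C' * ENNReal.ofReal C := by gcongr; exact hM w
    _ = _ := by rw [← ENNReal.ofReal_mul (by positivity)]

lemma sep_disj (h : DGeo μ ρ) {Λ : Set ℂ} (hsep : RhoSeparated ρ Λ) :
    ∃ δ : ℝ, 0 < δ ∧ δ ≤ 1 / 2 ∧ Λ.PairwiseDisjoint (fun l => ball l (δ * ρ l)) := by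
  obtain ⟨δ, hδ, hs⟩ := hsep
  refine ⟨min (δ / 2) (1 / 2), by positivity, min_le_right _ _, ?_⟩
  intro l hl l' hl' hne
  apply ball_disjoint_ball
  have h1 := hs l hl l' hl' hne
  have h2 : min (δ / 2) (1 / 2) * ρ l ≤ δ / 2 * max (ρ l) (ρ l') := by
    have := h.rho_pos l
    gcongr
    · exact min_le_left _ _
    · exact le_max_left _ _
  have h3 : min (δ / 2) (1 / 2) * ρ l' ≤ δ / 2 * max (ρ l) (ρ l') := by
    have := h.rho_pos l'
    gcongr
    · exact min_le_left _ _
    · exact le_max_right _ _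
  linarith

lemma sep_countable (h : DGeo μ ρ) {Λ : Set ℂ} (hsep : RhoSeparated ρ Λ) : Λ.Countable := by
  obtain ⟨δ, hδ, -, hd⟩ := h.sep_disj hsep
  exact hd.countable_of_isOpen (fun _ _ => isOpen_ball)
    (fun l _ => nonempty_ball.2 (mul_pos hδ (h.rho_pos l)))

lemma sep_sum (h : DGeo μ ρ) {Λ : Set ℂ} (hsep : RhoSeparated ρ Λ) :
    ∃ δ : ℝ, 0 < δ ∧ δ ≤ 1 / 2 ∧ ∀ F : ℂ → ℝ≥0∞,
      ∑' l : Λ, ∫⁻ w in ball l.1 (δ * ρ l.1), F w ≤ ∫⁻ w, F w := by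
  obtain ⟨δ, hδ, hδ2, hd⟩ := h.sep_disj hsep
  refine ⟨δ, hδ, hδ2, fun F => ?_⟩
  have : Countable Λ := (h.sep_countable hsep).to_subtype
  rw [← lintegral_iUnion (fun _ => measurableSet_ball)]
  · exact setLIntegral_le_lintegral _ _
  · intro l l' hne
    exact hd l.2 l'.2 (fun h => hne (Subtype.ext h))

lemma volume_ball_real (z : ℂ) {r : ℝ} (hr : 0 < r) :
    volume (ball z r) = ENNReal.ofReal (π * r ^ 2) := by
  rw [Complex.volume_ball, mul_comm, ENNReal.ofReal_mul Real.pi_pos.le, ENNReal.ofReal_pow hr.le]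
  congr 1
  exact (ENNReal.ofReal_coe_nnreal (p := NNReal.pi)).symm

/-- comparison of a value with a mean over a small ball -/
lemma Dd_ball (h : DGeo μ ρ) {z l w : ℂ} {δ : ℝ} (hδ : δ ≤ 1 / 2)
    (hw : w ∈ ball l (δ * ρ l)) : Dd ρ z w ≤ 2 * Dd ρ z l ∧ ρ w ≤ 2 * ρ l ∧ ρ l ≤ 2 * ρ w := by
  have hl := h.rho_pos l
  rw [mem_ball] at hw
  have h1 : dist w l ≤ ρ l / 2 := by nlinarith
  have h2 := h.rho_lip w l
  have h3 := h.rho_lip l w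
  rw [dist_comm l w] at h3
  refine ⟨?_, by linarith, by linarith⟩
  have h4 := h.Dd_tri z l w
  have h5 : Dd ρ l w ≤ 2 := by
    unfold Dd
    have : dist l w / ρ l ≤ 1 / 2 := by rw [div_le_iff₀ hl, dist_comm]; linarith
    linarith
  have := h.Dd_pos z l
  nlinarith

lemma sep_Dd (h : DGeo μ ρ) {Λ : Set ℂ} (hsep : RhoSeparated ρ Λ) :
    ∃ M : ℕ, ∃ C : ℝ, 0 < C ∧ ∀ z,
      ∑' l : Λ, ENNReal.ofReal ((Dd ρ z l.1 ^ M)⁻¹) ≤ ENNReal.ofReal C := by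
  obtain ⟨M, C, hC, hM⟩ := h.lint_Dd
  obtain ⟨δ, hδ, hδ2, hs⟩ := h.sep_sum hsep
  have hpi := Real.pi_pos
  refine ⟨M, 2 ^ M * 4 / (π * δ ^ 2) * C, by positivity, fun z => ?_⟩
  have hpt : ∀ l : Λ, ENNReal.ofReal ((Dd ρ z l.1 ^ M)⁻¹) ≤
      ENNReal.ofReal (2 ^ M * 4 / (π * δ ^ 2)) *
      ∫⁻ w in ball l.1 (δ * ρ l.1), ENNReal.ofReal ((Dd ρ z w ^ M)⁻¹ / ρ w ^ 2) := by
    rintro ⟨l, hl⟩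
    have hr := h.rho_pos l
    have hD := h.Dd_pos z l
    calc ENNReal.ofReal ((Dd ρ z l ^ M)⁻¹) = ENNReal.ofReal (2 ^ M * 4 / (π * δ ^ 2)) *
          (ENNReal.ofReal (((2 * Dd ρ z l) ^ M)⁻¹ / (2 * ρ l) ^ 2) *
            volume (ball l (δ * ρ l))) := by
          rw [volume_ball_real l (by positivity), ← ENNReal.ofReal_mul (by positivity),
            ← ENNReal.ofReal_mul (by positivity)]
          congr 1
          rw [mul_pow, mul_pow, mul_pow]
          field_simp
          try norm_num
      _ = ENNReal.ofReal (2 ^ M * 4 / (π * δ ^ 2)) * ∫⁻ w in ball l (δ * ρ l),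
            ENNReal.ofReal (((2 * Dd ρ z l) ^ M)⁻¹ / (2 * ρ l) ^ 2) := by
          rw [setLIntegral_const]
      _ ≤ _ := by
          refine mul_le_mul_right ?_ _
          apply setLIntegral_mono' measurableSet_ball
          intro w hw
          obtain ⟨h1, h2, -⟩ := h.Dd_ball (z := z) hδ2 hw
          have := h.rho_pos w
          have := h.Dd_pos z w
          apply ENNReal.ofReal_le_ofReal
          gcongr
  calc _ ≤ ∑' l : Λ, ENNReal.ofReal (2 ^ M * 4 / (π * δ ^ 2)) *
      ∫⁻ w in ball l.1 (δ * ρ l.1), ENNReal.ofReal ((Dd ρ z w ^ M)⁻¹ / ρ w ^ 2) :=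
        ENNReal.tsum_le_tsum hpt
    _ = ENNReal.ofReal (2 ^ M * 4 / (π * δ ^ 2)) * ∑' l : Λ,
      ∫⁻ w in ball l.1 (δ * ρ l.1), ENNReal.ofReal ((Dd ρ z w ^ M)⁻¹ / ρ w ^ 2) :=
        ENNReal.tsum_mul_left
    _ ≤ ENNReal.ofReal (2 ^ M * 4 / (π * δ ^ 2)) * ENNReal.ofReal C := by
        refine mul_le_mul_right ?_ _
        exact (hs _).trans (hM z)
    _ = _ := by rw [← ENNReal.ofReal_mul (by positivity)]

lemma sep_Dd' (h : DGeo μ ρ) {Λ : Set ℂ} (hsep : RhoSeparated ρ Λ) :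
    ∃ M : ℕ, ∃ C : ℝ, 0 < C ∧ ∀ z,
      ∑' l : Λ, ENNReal.ofReal ((Dd ρ l.1 z ^ M)⁻¹) ≤ ENNReal.ofReal C := by
  obtain ⟨M, C, hC, hM⟩ := h.sep_Dd hsep
  obtain ⟨N, C', hC', hN⟩ := h.transp M
  refine ⟨N, C' * C, by positivity, fun z => ?_⟩
  calc _ ≤ ∑' l : Λ, ENNReal.ofReal C' * ENNReal.ofReal ((Dd ρ z l.1 ^ M)⁻¹) := by
        apply ENNReal.tsum_le_tsum
        intro l
        rw [← ENNReal.ofReal_mul (by positivity)]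
        exact ENNReal.ofReal_le_ofReal (hN _ _)
    _ = ENNReal.ofReal C' * ∑' l : Λ, ENNReal.ofReal ((Dd ρ z l.1 ^ M)⁻¹) :=
        ENNReal.tsum_mul_left
    _ ≤ ENNReal.ofReal C' * ENNReal.ofReal C := by gcongr; exact hM z
    _ = _ := by rw [← ENNReal.ofReal_mul (by positivity)]

lemma pathDist_le (h : DGeo μ ρ) : ∃ k : ℕ, ∃ C : ℝ, 1 ≤ C ∧ ∀ z w,
    pathDist ρ z w ≤ C * Dd ρ z w ^ k := by
  obtain ⟨k, C, hC, hk⟩ := h.rho_poly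
  refine ⟨k + 1, C, hC, fun z w => ?_⟩
  have hz := h.rho_pos z
  have hD := h.Dd_ge z w
  set γ : ℝ → ℂ := fun t => z + t • (w - z) with hγ
  have hder : ∀ t, HasDerivAt γ (w - z) t := by
    intro t
    have h1 : HasDerivAt (fun t : ℝ => t • (w - z)) ((1 : ℝ) • (w - z)) t :=
      (hasDerivAt_id t).smul_const (w - z)
    have h2 := h1.const_add z
    rw [one_smul] at h2
    exact h2
  have hγc : Continuous γ := by rw [hγ]; fun_prop
  have hmem : (∫ t in (0:ℝ)..1, ‖deriv γ t‖ / ρ (γ t)) ∈ { L : ℝ | ∃ γ : ℝ → ℂ, γ 0 = z ∧ γ 1 = w ∧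
      ContDiff ℝ 1 γ ∧ L = ∫ t in (0:ℝ)..1, ‖deriv γ t‖ / ρ (γ t) } := by
    refine ⟨γ, by simp [hγ], by simp [hγ], ?_, rfl⟩
    rw [hγ]; fun_prop
  have hbdd : BddBelow { L : ℝ | ∃ γ : ℝ → ℂ, γ 0 = z ∧ γ 1 = w ∧
      ContDiff ℝ 1 γ ∧ L = ∫ t in (0:ℝ)..1, ‖deriv γ t‖ / ρ (γ t) } := by
    refine ⟨0, ?_⟩
    rintro L ⟨γ, -, -, -, rfl⟩
    apply intervalIntegral.integral_nonneg (by norm_num)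
    intro t _
    have := h.rho_pos (γ t)
    positivity
  refine (csInf_le hbdd hmem).trans ?_
  have hb : ∀ t ∈ Icc (0 : ℝ) 1, ‖deriv γ t‖ / ρ (γ t) ≤ C * Dd ρ z w ^ (k + 1) := by
    intro t ht
    rw [(hder t).deriv, div_le_iff₀ (h.rho_pos _)]
    have h1 : Dd ρ z (γ t) ≤ Dd ρ z w := by
      unfold Dd
      gcongr
      rw [dist_eq_norm, dist_eq_norm, hγ]
      have : z - (z + t • (w - z)) = (-t) • (w - z) := by simp
      simp only [this]
      rw [norm_smul, norm_neg, Real.norm_eq_abs, abs_of_nonneg ht.1, norm_sub_rev]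
      have := ht.2
      have := norm_nonneg (z - w)
      nlinarith
    have h2 : ρ z ≤ C * Dd ρ z w ^ k * ρ (γ t) := by
      refine (hk z (γ t)).trans ?_
      have := h.rho_pos (γ t)
      have := h.Dd_pos z (γ t)
      gcongr
    have h3 : ‖w - z‖ ≤ ρ z * Dd ρ z w := by
      rw [h.rho_mul_Dd, dist_comm, dist_eq_norm]; linarith
    calc ‖w - z‖ ≤ ρ z * Dd ρ z w := h3
      _ ≤ C * Dd ρ z w ^ k * ρ (γ t) * Dd ρ z w := by gcongr
      _ = _ := by ring
  have hcont : Continuous (fun t => ‖deriv γ t‖ / ρ (γ t)) := by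
    have e : deriv γ = fun _ => w - z := funext fun t => (hder t).deriv
    rw [e]
    apply Continuous.div continuous_const (h.rho_cont.comp hγc)
    intro t; exact (h.rho_pos _).ne'
  calc _ ≤ ∫ t in (0:ℝ)..1, C * Dd ρ z w ^ (k + 1) :=
        intervalIntegral.integral_mono_on (by norm_num) (hcont.intervalIntegrable _ _)
          (by simp) hb
    _ = _ := by simp

/-- polynomial flatness -/
def PFlat (ρ : ℂ → ℝ) (m : ℕ) (L : ℝ) (ω : ℂ → ℝ) : Prop :=
  ∀ z w, ω w ≤ L * Dd ρ z w ^ m * ω z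

lemma flat (h : DGeo μ ρ) {ω : ℂ → ℝ} (hω : IsFlatWeight ρ ω) :
    ∃ m : ℕ, ∃ L : ℝ, 1 ≤ L ∧ PFlat ρ m L ω := by
  obtain ⟨hpos, hmeas, C, hC, hf⟩ := hω
  obtain ⟨k, A, hA, hk⟩ := h.pathDist_le
  obtain ⟨N, hN⟩ := exists_nat_ge C
  refine ⟨k * N, Real.exp N * A ^ N, ?_, fun z w => ?_⟩
  · have : (1 : ℝ) ≤ Real.exp N := Real.one_le_exp (by positivity)
    have : (1 : ℝ) ≤ A ^ N := one_le_pow₀ hA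
    nlinarith
  have hD := h.Dd_ge z w
  have hX : 1 ≤ A * Dd ρ z w ^ k := by
    have : (1 : ℝ) ≤ Dd ρ z w ^ k := one_le_pow₀ hD
    nlinarith
  have h1 : max (Real.log (pathDist ρ z w)) 0 ≤ Real.log (A * Dd ρ z w ^ k) := by
    apply max_le
    · have h0 : 0 ≤ pathDist ρ z w := by
        apply Real.sInf_nonneg
        rintro L ⟨γ, -, -, -, rfl⟩
        apply intervalIntegral.integral_nonneg (by norm_num)
        intro t _
        have := h.rho_pos (γ t)
        positivity
      rcases h0.eq_or_lt with h0 | h0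
      · rw [← h0, Real.log_zero]; exact Real.log_nonneg hX
      · exact Real.log_le_log h0 (hk z w)
    · exact Real.log_nonneg hX
  have h2 : Real.log (ω w) ≤ Real.log (ω z) + N * (1 + Real.log (A * Dd ρ z w ^ k)) := by
    have h3 := hf z w
    have h4 := neg_le_of_abs_le h3
    have h5 : C * (1 + max (Real.log (pathDist ρ z w)) 0) ≤
        N * (1 + Real.log (A * Dd ρ z w ^ k)) := by
      gcongr
    linarith
  have h6 := Real.exp_le_exp.2 h2
  rw [Real.exp_log (hpos w), Real.exp_add, Real.exp_log (hpos z), mul_add, mul_one, Real.exp_add,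
    Real.exp_nat_mul, Real.exp_log (by linarith)] at h6
  refine h6.trans (le_of_eq ?_)
  rw [mul_pow, pow_mul]
  ring

end DGeo
end

noncomputable section

namespace DGeo
variable {μ : Measure ℂ} {ρ : ℂ → ℝ}

lemma log_one_add_le {x σ : ℝ} (hx : 0 ≤ x) (hσ : 0 < σ) (hσ1 : σ ≤ 1) :
    Real.log (1 + x) ≤ x ^ σ / σ := by
  have h1 : (1 + x) ^ σ ≤ 1 + x ^ σ := by
    have := Real.rpow_add_le_add_rpow (p := σ) zero_le_one hx hσ.le hσ1
    rwa [Real.one_rpow] at this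
  have h2 : σ * Real.log (1 + x) = Real.log ((1 + x) ^ σ) := by
    rw [Real.log_rpow (by linarith)]
  rw [le_div_iff₀ hσ, mul_comm, h2]
  have h3 : 0 < (1 + x) ^ σ := Real.rpow_pos_of_pos (by linarith) _
  have := Real.log_le_sub_one_of_pos h3
  linarith

/-- shell estimate -/
lemma shell (h : DGeo μ ρ) : ∃ s C : ℝ, 0 < s ∧ s ≤ 1 ∧ 0 < C ∧ ∀ z : ℂ, ∀ R : ℝ, 0 < R →
    ∫⁻ w in ball z R, ENNReal.ofReal ((R / ‖z - w‖) ^ s) ∂μ ≤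
      ENNReal.ofReal (C * μ.real (ball z R)) := by
  obtain ⟨b, hb, hrev⟩ := h.rev
  obtain ⟨n, hn⟩ := h.growth
  have hl4 : 0 < Real.log 4 := Real.log_pos (by norm_num)
  have hlb : 0 < Real.log b := Real.log_pos hb
  set s : ℝ := min 1 (Real.log b / (2 * Real.log 4)) with hs
  have hs0 : 0 < s := lt_min one_pos (by positivity)
  set τ : ℝ := (4 : ℝ) ^ s with hτ
  have hτ0 : 0 < τ := by positivity
  have hτb : τ < b := by
    rw [hτ, Real.rpow_def_of_pos (by norm_num), ← Real.lt_log_iff_exp_lt (by linarith)]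
    have : s ≤ Real.log b / (2 * Real.log 4) := min_le_right _ _
    calc Real.log 4 * s ≤ Real.log 4 * (Real.log b / (2 * Real.log 4)) := by gcongr
      _ = Real.log b / 2 := by field_simp
      _ < _ := by linarith
  have hq : τ / b < 1 := by rw [div_lt_one (by linarith)]; exact hτb
  refine ⟨s, τ * (1 - τ / b)⁻¹ * (2 * 4) ^ n, hs0, min_le_left _ _, ?_, fun z R hR => ?_⟩
  · have : 0 < 1 - τ / b := by linarith
    positivity
  have hiter : ∀ k : ℕ, μ.real (ball z (4 * R / 4 ^ k)) ≤ (b⁻¹) ^ k * μ.real (ball z (4 * R)) := by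
    intro k
    induction k with
    | zero => simp
    | succ k ih =>
      have h1 := hrev z (4 * R / 4 ^ (k + 1)) (by positivity)
      have h2 : 4 * (4 * R / 4 ^ (k + 1)) = 4 * R / 4 ^ k := by field_simp; ring
      rw [h2] at h1
      have hb0 : 0 < b := by linarith
      calc _ = b⁻¹ * (b * μ.real (ball z (4 * R / 4 ^ (k + 1)))) := by field_simp
        _ ≤ b⁻¹ * ((b⁻¹) ^ k * μ.real (ball z (4 * R))) := by
            exact mul_le_mul_of_nonneg_left (h1.trans ih) (by positivity)
        _ = _ := by ring
  have hpt : ∀ w ∈ ball z R, ENNReal.ofReal ((R / ‖z - w‖) ^ s) ≤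
      ∑' k : ℕ, (ball z (4 * R / 4 ^ k)).indicator (fun _ => ENNReal.ofReal (τ ^ (k + 1))) w := by
    intro w hw
    rcases eq_or_ne w z with rfl | hne
    · simp [hs0.ne']
    have hd : 0 < ‖z - w‖ := by rw [norm_pos_iff, sub_ne_zero]; exact hne.symm
    have hlt : ‖z - w‖ < R := by rwa [mem_ball, dist_comm, dist_eq_norm] at hw
    obtain ⟨k, hk1, hk2⟩ := exists_nat_pow_near (x := R / ‖z - w‖) (y := 4)
      (by rw [one_le_div hd]; exact hlt.le) (by norm_num)
    refine le_trans ?_ (ENNReal.le_tsum k)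
    rw [indicator_of_mem]
    · apply ENNReal.ofReal_le_ofReal
      calc (R / ‖z - w‖) ^ s ≤ ((4 : ℝ) ^ (k + 1)) ^ s := by gcongr
        _ = τ ^ (k + 1) := by
          rw [hτ, ← Real.rpow_natCast, ← Real.rpow_mul (by norm_num), mul_comm,
            Real.rpow_mul (by norm_num), Real.rpow_natCast]
    · rw [mem_ball, dist_comm, dist_eq_norm, lt_div_iff₀ (by positivity)]
      rw [le_div_iff₀ hd] at hk1
      linarith
  calc _ ≤ ∫⁻ w in ball z R, ∑' k : ℕ, (ball z (4 * R / 4 ^ k)).indicator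
          (fun _ => ENNReal.ofReal (τ ^ (k + 1))) w ∂μ := setLIntegral_mono' measurableSet_ball hpt
    _ ≤ ∫⁻ w, ∑' k : ℕ, (ball z (4 * R / 4 ^ k)).indicator
          (fun _ => ENNReal.ofReal (τ ^ (k + 1))) w ∂μ := setLIntegral_le_lintegral _ _
    _ = ∑' k : ℕ, ENNReal.ofReal (τ ^ (k + 1)) * μ (ball z (4 * R / 4 ^ k)) := by
        rw [lintegral_tsum (fun k => (measurable_const.indicator measurableSet_ball).aemeasurable)]
        congr 1; ext k
        rw [lintegral_indicator_const measurableSet_ball]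
    _ ≤ ∑' k : ℕ, ENNReal.ofReal (τ * (τ / b) ^ k * μ.real (ball z (4 * R))) := by
        apply ENNReal.tsum_le_tsum
        intro k
        rw [← ENNReal.ofReal_toReal (h.finite_ball z (4 * R / 4 ^ k)).ne,
          ← ENNReal.ofReal_mul (by positivity)]
        apply ENNReal.ofReal_le_ofReal
        calc _ ≤ τ ^ (k + 1) * ((b⁻¹) ^ k * μ.real (ball z (4 * R))) := by
              gcongr; exact hiter k
          _ = _ := by rw [div_pow, inv_pow]; ring
    _ = ENNReal.ofReal (τ * (1 - τ / b)⁻¹ * μ.real (ball z (4 * R))) := by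
        have hb0 : 0 < b := by linarith
        have hsum := ((hasSum_geometric_of_lt_one (r := τ / b) (by positivity) hq).mul_left τ).mul_right
          (μ.real (ball z (4 * R)))
        rw [← ENNReal.ofReal_tsum_of_nonneg _ hsum.summable, hsum.tsum_eq]
        intro k; positivity
    _ ≤ _ := by
        apply ENNReal.ofReal_le_ofReal
        have : 0 < 1 - τ / b := by linarith
        rw [mul_assoc _ (_ ^ n)]
        gcongr
        exact hn z R 4 hR (by norm_num)


/-- integrable form of the shell estimate -/
lemma shell_int (h : DGeo μ ρ) : ∃ s C : ℝ, 0 < s ∧ s ≤ 1 ∧ 0 < C ∧ ∀ z : ℂ, ∀ R : ℝ, 0 < R →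
    IntegrableOn (fun w => (R / ‖z - w‖) ^ s) (ball z R) μ ∧
    ∫ w in ball z R, (R / ‖z - w‖) ^ s ∂μ ≤ C * μ.real (ball z R) := by
  obtain ⟨s, C, hs, hs1, hC, H⟩ := h.shell
  refine ⟨s, C, hs, hs1, hC, fun z R hR => ?_⟩
  have h0 : ∀ w, 0 ≤ (R / ‖z - w‖) ^ s := fun w => by positivity
  have hm : Measurable (fun w => (R / ‖z - w‖) ^ s) := by fun_prop
  constructor
  · refine ⟨hm.aestronglyMeasurable, ?_⟩
    rw [hasFiniteIntegral_iff_ofReal (ae_of_all _ h0)]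
    exact (H z R hR).trans_lt ENNReal.ofReal_lt_top
  · rw [integral_eq_lintegral_of_nonneg_ae (ae_of_all _ h0) hm.aestronglyMeasurable]
    exact ENNReal.toReal_le_of_le_ofReal (by positivity) (H z R hR)

lemma singleton_zero (h : DGeo μ ρ) (z : ℂ) : μ {z} = 0 := by
  obtain ⟨b, hb, hrev⟩ := h.rev
  by_contra hne
  have hfin : μ {z} ≠ ∞ := (lt_of_le_of_lt (measure_mono (singleton_subset_iff.2
    (mem_ball_self one_pos))) (h.finite_ball z 1)).ne
  have hpos : 0 < μ.real {z} := ENNReal.toReal_pos hne hfin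
  have hk : ∀ k : ℕ, b ^ k * μ.real {z} ≤ μ.real (ball z 1) := by
    intro k
    have : ∀ k : ℕ, b ^ k * μ.real (ball z (1 / 4 ^ k)) ≤ μ.real (ball z 1) := by
      intro k
      induction k with
      | zero => simp
      | succ k ih =>
        have h1 := hrev z (1 / 4 ^ (k + 1)) (by positivity)
        have h2 : 4 * ((1:ℝ) / 4 ^ (k + 1)) = 1 / 4 ^ k := by field_simp; ring
        rw [h2] at h1
        refine le_trans ?_ ih
        rw [pow_succ, mul_assoc]
        exact mul_le_mul_of_nonneg_left h1 (by positivity)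
    refine le_trans ?_ (this k)
    refine mul_le_mul_of_nonneg_left (h.real_mono ?_) (by positivity)
    rw [singleton_subset_iff]; exact mem_ball_self (by positivity)
  obtain ⟨k, hk2⟩ := pow_unbounded_of_one_lt (μ.real (ball z 1) / μ.real {z}) hb
  rw [div_lt_iff₀ hpos] at hk2
  linarith [hk k]

lemma locFin (h : DGeo μ ρ) : IsLocallyFiniteMeasure μ :=
  ⟨fun z => ⟨ball z 1, ball_mem_nhds z one_pos, h.finite_ball z 1⟩⟩

end DGeo

/-- differentiation of a smoothing integral for a general locally finite measure -/
lemma hasFDerivAt_smooth {F : Type*} [NormedAddCommGroup F] [NormedSpace ℝ F]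
    {ν : Measure ℂ} {f : ℂ → ℝ} (hf : LocallyIntegrable f ν)
    {c : ℂ → F} (hc : ContDiff ℝ 1 c) (hs : HasCompactSupport c) (z : ℂ) :
    HasFDerivAt (fun x => ∫ w, f w • c (x - w) ∂ν) (∫ w, f w • fderiv ℝ c (z - w) ∂ν) z := by
  have hc' : Continuous (fderiv ℝ c) := hc.continuous_fderiv one_ne_zero
  have hs' : HasCompactSupport (fderiv ℝ c) := hs.fderiv ℝ
  obtain ⟨r, hr⟩ := (hs.isCompact.union hs'.isCompact).isBounded.subset_closedBall 0
  obtain ⟨B, hB⟩ := hs'.exists_bound_of_continuous hc'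
  obtain ⟨B0, hB0⟩ := hs.exists_bound_of_continuous hc.continuous
  have hK : IntegrableOn f (closedBall z (r + 1)) ν :=
    hf.integrableOn_isCompact (isCompact_closedBall _ _)
  have hfm : AEStronglyMeasurable f ν := hf.aestronglyMeasurable
  have hz0 : ∀ x ∈ ball z 1, ∀ w, w ∉ closedBall z (r + 1) → x - w ∉ tsupport c ∪ tsupport (fderiv ℝ c) := by
    intro x hx w hw hm
    apply hw
    have h1 := hr hm
    rw [mem_closedBall, dist_zero_right] at h1
    rw [mem_ball] at hx
    rw [mem_closedBall]
    calc dist w z ≤ dist w x + dist x z := dist_triangle _ _ _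
      _ ≤ _ := by rw [dist_comm w x, dist_eq_norm x w]; linarith
  have hcz : ∀ x ∈ ball z 1, ∀ w, w ∉ closedBall z (r + 1) → c (x - w) = 0 := fun x hx w hw =>
    image_eq_zero_of_notMem_tsupport fun hh => hz0 x hx w hw (Or.inl hh)
  have hcz' : ∀ x ∈ ball z 1, ∀ w, w ∉ closedBall z (r + 1) → fderiv ℝ c (x - w) = 0 :=
    fun x hx w hw => image_eq_zero_of_notMem_tsupport fun hh => hz0 x hx w hw (Or.inr hh)
  have hm : ∀ x, AEStronglyMeasurable (fun w => f w • c (x - w)) ν := fun x =>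
    hfm.smul ((hc.continuous.comp (continuous_const.sub continuous_id)).aestronglyMeasurable)
  refine hasFDerivAt_integral_of_dominated_of_fderiv_le (F' := fun x w => f w • fderiv ℝ c (x - w))
    (bound := (closedBall z (r + 1)).indicator (fun w => ‖f w‖ * B)) (s := ball z 1)
    (ball_mem_nhds z one_pos) (Eventually.of_forall hm) ?_ ?_ ?_ ?_ ?_
  · refine Integrable.mono' (g := (closedBall z (r + 1)).indicator (fun w => ‖f w‖ * B0)) ?_ (hm z) ?_
    · rw [integrable_indicator_iff measurableSet_closedBall]
      exact hK.norm.mul_const B0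
    · refine ae_of_all _ fun w => ?_
      by_cases hw : w ∈ closedBall z (r + 1)
      · rw [indicator_of_mem hw, norm_smul]
        gcongr; exact hB0 _
      · rw [hcz z (mem_ball_self one_pos) w hw, indicator_of_notMem hw]; simp
  · exact hfm.smul ((hc'.comp (continuous_const.sub continuous_id)).aestronglyMeasurable)
  · refine ae_of_all _ fun w x hx => ?_
    by_cases hw : w ∈ closedBall z (r + 1)
    · rw [indicator_of_mem hw, norm_smul]
      gcongr; exact hB _
    · rw [hcz' x hx w hw, indicator_of_notMem hw]; simp
  · rw [integrable_indicator_iff measurableSet_closedBall]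
    exact hK.norm.mul_const B
  · refine ae_of_all _ fun w x hx => ?_
    have h1 : HasFDerivAt c (fderiv ℝ c (x - w)) (x - w) :=
      (hc.differentiable one_ne_zero _).hasFDerivAt
    have h2 : HasFDerivAt (fun x => c (x - w)) (fderiv ℝ c (x - w)) x := by
      have h3 := h1.comp x ((hasFDerivAt_id (𝕜 := ℝ) x).sub_const w)
      rwa [ContinuousLinearMap.comp_id] at h3
    exact h2.const_smul (f w)

lemma integrable_smooth {F : Type*} [NormedAddCommGroup F] [NormedSpace ℝ F]
    {ν : Measure ℂ} {f : ℂ → ℝ} (hf : LocallyIntegrable f ν)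
    {c : ℂ → F} (hc : Continuous c) (hs : HasCompactSupport c) (z : ℂ) :
    Integrable (fun w => f w • c (z - w)) ν := by
  apply hf.integrable_smul_right_of_hasCompactSupport (hc.comp (continuous_const.sub continuous_id))
  exact hs.comp_homeomorph (Homeomorph.subLeft z)

lemma lap_eq_dir {c : ℂ → ℝ} (hc : ContDiff ℝ 2 c) (z : ℂ) :
    lap c z = fderiv ℝ (fun x => fderiv ℝ c x 1) z 1 +
      fderiv ℝ (fun x => fderiv ℝ c x Complex.I) z Complex.I := by
  have hd1 : Differentiable ℝ (fderiv ℝ c) :=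
    (hc.fderiv_right (m := 1) (by norm_num)).differentiable one_ne_zero
  have key : ∀ a b : ℂ, fderiv ℝ (fun x => fderiv ℝ c x b) z a = fderiv ℝ (fderiv ℝ c) z a b := by
    intro a b
    have := ((hd1 z).hasFDerivAt.clm_apply (hasFDerivAt_const b z)).fderiv
    rw [this]; simp
  simp only [lap, iteratedFDeriv_two_apply, key]
  simp

lemma dir_smooth {ν : Measure ℂ} {f : ℂ → ℝ} (hf : LocallyIntegrable f ν)
    {c : ℂ → ℝ} (hc : ContDiff ℝ 1 c) (hs : HasCompactSupport c) (z a : ℂ) :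
    fderiv ℝ (fun x => ∫ w, f w * c (x - w) ∂ν) z a = ∫ w, f w * fderiv ℝ c (z - w) a ∂ν := by
  have e1 := (hasFDerivAt_smooth hf hc hs z).fderiv
  simp only [smul_eq_mul] at e1
  rw [e1, ContinuousLinearMap.integral_apply
    (integrable_smooth hf (hc.continuous_fderiv one_ne_zero) (hs.fderiv ℝ) z)]
  rfl

lemma lap_smooth {ν : Measure ℂ} {f : ℂ → ℝ} (hf : LocallyIntegrable f ν)
    {c : ℂ → ℝ} (hc : ContDiff ℝ 2 c) (hs : HasCompactSupport c) :
    ContDiff ℝ 2 (fun x => ∫ w, f w * c (x - w) ∂ν) ∧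
    ∀ z, lap (fun x => ∫ w, f w * c (x - w) ∂ν) z = ∫ w, f w * lap c (z - w) ∂ν := by
  have hc1 : ContDiff ℝ 1 c := hc.of_le (by norm_num)
  have hd1 : ∀ a, ContDiff ℝ 1 (fun x => fderiv ℝ c x a) := fun a =>
    (hc.fderiv_right (m := 1) (by norm_num)).clm_apply contDiff_const
  have hs1 : ∀ a, HasCompactSupport (fun x => fderiv ℝ c x a) := fun a => hs.fderiv_apply ℝ a
  have hreg : ContDiff ℝ 2 (fun x => ∫ w, f w * c (x - w) ∂ν) :=
    hs.contDiff_convolution_right (n := 2) (ContinuousLinearMap.mul ℝ ℝ) hf hc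
  refine ⟨hreg, fun z => ?_⟩
  have hinteg : ∀ a : ℂ, Integrable (fun w => f w *
      fderiv ℝ (fun x => fderiv ℝ c x a) (z - w) a) ν := by
    intro a
    have h2 : Continuous (fun y => fderiv ℝ (fun x => fderiv ℝ c x a) y a) :=
      ((hd1 a).continuous_fderiv one_ne_zero).clm_apply continuous_const
    exact integrable_smooth hf h2 ((hs1 a).fderiv_apply ℝ a) z
  rw [lap_eq_dir hreg]
  simp only [dir_smooth hf hc1 hs]
  rw [dir_smooth hf (hd1 1) (hs1 1), dir_smooth hf (hd1 Complex.I) (hs1 Complex.I),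
    ← integral_add (hinteg _) (hinteg _)]
  congr 1; ext w
  rw [lap_eq_dir hc]; ring
end

noncomputable section

lemma contDiff_one_deriv {G : ℝ → ℝ} (hG : ContDiff ℝ 2 G) : ContDiff ℝ 1 (deriv G) := by
  have h : ContDiff ℝ (1 + 1) G := by
    have : (1 + 1 : WithTop ℕ∞) = 2 := by norm_num
    rw [this]; exact hG
  exact (contDiff_succ_iff_deriv.1 h).2.2

/-- smooth truncation of the logarithm -/
def Tl (x : ℝ) : ℝ := Real.smoothTransition (2 * x - 1) * Real.log x

lemma Tl_smooth {n : ℕ∞} : ContDiff ℝ n Tl := by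
  rw [contDiff_iff_contDiffAt]
  intro x
  rcases lt_or_ge x (1/2) with hx | hx
  · have : Tl =ᶠ[𝓝 x] fun _ => 0 := by
      filter_upwards [eventually_lt_nhds hx] with y hy
      rw [Tl, Real.smoothTransition.zero_of_nonpos (by linarith), zero_mul]
    exact contDiffAt_const.congr_of_eventuallyEq this
  · have hx0 : x ≠ 0 := by linarith
    apply ContDiffAt.mul
    · exact (Real.smoothTransition.contDiff.comp ((contDiff_const.mul contDiff_id).sub
        contDiff_const)).contDiffAt
    · exact Real.contDiffAt_log.2 hx0

lemma Tl_eq {x : ℝ} (hx : 1 ≤ x) : Tl x = Real.log x := by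
  rw [Tl, Real.smoothTransition.one_of_one_le (by linarith), one_mul]

lemma log_le_Tl {x : ℝ} (hx : 0 < x) : Real.log x ≤ Tl x := by
  rcases le_total 1 x with h | h
  · rw [Tl_eq h]
  · have := Real.log_nonpos hx.le h
    have h1 := Real.smoothTransition.le_one (2 * x - 1)
    rw [Tl]; nlinarith

lemma Tl_nonpos {x : ℝ} (hx : 0 ≤ x) (h : x ≤ 1) : Tl x ≤ 0 := by
  have := Real.log_nonpos hx h
  have h1 := Real.smoothTransition.nonneg (2 * x - 1)
  rw [Tl]; nlinarith

lemma dTl {x : ℝ} (hx : 1 < x) : deriv Tl x = x⁻¹ := by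
  have : Tl =ᶠ[𝓝 x] Real.log := by
    filter_upwards [eventually_gt_nhds hx] with y hy using Tl_eq hy.le
  rw [this.deriv_eq, Real.deriv_log]

lemma ddTl {x : ℝ} (hx : 1 < x) : deriv (deriv Tl) x = -(x ^ 2)⁻¹ := by
  have : deriv Tl =ᶠ[𝓝 x] fun y => y⁻¹ := by
    filter_upwards [eventually_gt_nhds hx] with y hy using dTl hy
  rw [this.deriv_eq, deriv_inv]

lemma lap_radial {G : ℝ → ℝ} (hG : ContDiff ℝ 2 G) (z : ℂ) :
    lap (fun z => G (‖z‖ ^ 2)) z =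
      4 * (‖z‖ ^ 2 * deriv (deriv G) (‖z‖ ^ 2) + deriv G (‖z‖ ^ 2)) := by
  have hn : ∀ z : ℂ, HasFDerivAt (fun z : ℂ => ‖z‖ ^ 2) (2 • (innerSL ℝ z)) z := by
    intro z
    have := (hasFDerivAt_id (𝕜 := ℝ) z).norm_sq
    simpa using this
  have hGd : Differentiable ℝ G := hG.differentiable (by norm_num)
  have hGd1 : Differentiable ℝ (deriv G) :=
    (contDiff_one_deriv hG).differentiable one_ne_zero
  have h1 : ∀ z a : ℂ, fderiv ℝ (fun z : ℂ => G (‖z‖ ^ 2)) z a =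
      deriv G (‖z‖ ^ 2) * (2 * inner ℝ z a) := by
    intro z a
    have := ((hGd _).hasDerivAt.comp_hasFDerivAt z (hn z)).fderiv
    have h2 : fderiv ℝ (fun z : ℂ => G (‖z‖ ^ 2)) z = fderiv ℝ (G ∘ fun z : ℂ => ‖z‖ ^ 2) z := rfl
    rw [h2, this]
    simp [innerSL_apply_apply]
    left; ring
  have hreg : ContDiff ℝ 2 (fun z : ℂ => G (‖z‖ ^ 2)) := hG.comp (contDiff_norm_sq ℝ)
  have h3 : ∀ a : ℂ, fderiv ℝ (fun x : ℂ => fderiv ℝ (fun z : ℂ => G (‖z‖ ^ 2)) x a) z a =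
      4 * deriv (deriv G) (‖z‖ ^ 2) * (inner ℝ z a) ^ 2 + 2 * deriv G (‖z‖ ^ 2) * inner ℝ a a := by
    intro a
    simp only [h1]
    have e1 := ((hGd1 _).hasDerivAt.comp_hasFDerivAt z (hn z))
    have e2 : HasFDerivAt (fun x : ℂ => 2 * inner ℝ x a) (2 • (innerSL ℝ a)) z := by
      have := ((innerSL ℝ a).hasFDerivAt (x := z)).const_mul (2 : ℝ)
      have h5 : (fun x : ℂ => 2 * inner ℝ x a) = fun x => 2 * (innerSL ℝ a) x := by
        ext x; rw [innerSL_apply_apply, real_inner_comm]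
      rw [h5]
      refine this.congr_fderiv ?_
      ext x; simp; ring
    have := (e1.mul e2).fderiv
    have h6 : fderiv ℝ (fun x : ℂ => deriv G (‖x‖ ^ 2) * (2 * inner ℝ x a)) z =
      fderiv ℝ ((deriv G ∘ fun z : ℂ => ‖z‖ ^ 2) * fun x => 2 * inner ℝ x a) z := rfl
    rw [h6, this]
    simp [innerSL_apply_apply]
    ring
  rw [lap_eq_dir hreg, h3, h3]
  have e : ‖z‖ ^ 2 = z.re ^ 2 + z.im ^ 2 := by rw [← Complex.normSq_eq_norm_sq, Complex.normSq_apply]; ring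
  simp [Complex.inner]
  rw [e]; ring

/-- smoothed fundamental solution at scale `t` -/
def Es (t : ℝ) (z : ℂ) : ℝ := (4 * π)⁻¹ * (Tl (‖z‖ ^ 2 / t ^ 2) + Real.log (t ^ 2))

def kk (y : ℝ) : ℝ := π⁻¹ * (y ^ 2 * deriv (deriv Tl) (y ^ 2) + deriv Tl (y ^ 2))

def ek (t : ℝ) (z : ℂ) : ℝ := (t ^ 2)⁻¹ * kk (‖z‖ / t)

lemma Es_smooth (t : ℝ) {n : ℕ∞} : ContDiff ℝ n (Es t) :=
  contDiff_const.mul ((Tl_smooth.comp ((contDiff_norm_sq ℝ).div_const _)).add contDiff_const)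

lemma kk_cont : Continuous kk := by
  have h : ContDiff ℝ 2 Tl := Tl_smooth
  have h2 := contDiff_one_deriv h
  have h3 := h2.continuous_deriv le_rfl
  have h4 := h2.continuous
  unfold kk
  fun_prop

lemma ek_cont (t : ℝ) : Continuous (ek t) := by
  unfold ek; exact continuous_const.mul (kk_cont.comp (continuous_norm.div_const _))

lemma lap_Es {t : ℝ} (ht : 0 < t) (z : ℂ) : lap (Es t) z = ek t z := by
  set G : ℝ → ℝ := fun x => (4 * π)⁻¹ * (Tl (x / t ^ 2) + Real.log (t ^ 2)) with hG
  have h : ContDiff ℝ 2 Tl := Tl_smooth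
  have hT : Differentiable ℝ Tl := h.differentiable (by norm_num)
  have hT1 : Differentiable ℝ (deriv Tl) :=
    (contDiff_one_deriv h).differentiable one_ne_zero
  have h1 : deriv G = fun x => (4 * π)⁻¹ * (deriv Tl (x / t ^ 2) * (t ^ 2)⁻¹) := by
    ext x
    have := (((hT (x / t ^ 2)).hasDerivAt.comp x ((hasDerivAt_id x).div_const (t ^ 2))).add_const
      (Real.log (t ^ 2))).const_mul ((4 * π)⁻¹)
    rw [one_div] at this
    exact this.deriv
  have h2 : deriv (deriv G) = fun x => (4 * π)⁻¹ * (deriv (deriv Tl) (x / t ^ 2) * (t ^ 2)⁻¹ * (t ^ 2)⁻¹) := by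
    rw [h1]
    ext x
    have := (((hT1 (x / t ^ 2)).hasDerivAt.comp x ((hasDerivAt_id x).div_const (t ^ 2))).mul_const
      ((t ^ 2)⁻¹)).const_mul ((4 * π)⁻¹)
    rw [one_div] at this
    exact this.deriv
  have hGs : ContDiff ℝ 2 G := contDiff_const.mul ((h.comp (contDiff_id.div_const _)).add contDiff_const)
  have h3 : lap (Es t) z = lap (fun z => G (‖z‖ ^ 2)) z := rfl
  rw [h3, lap_radial hGs, h2, h1, ek, kk, div_pow]
  field_simp

lemma kk_zero {y : ℝ} (hy : 1 < y) : kk y = 0 := by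
  have h : 1 < y ^ 2 := by nlinarith
  rw [kk, dTl h, ddTl h]
  have : y ^ 2 ≠ 0 := by positivity
  field_simp; ring

lemma ek_zero {t : ℝ} (ht : 0 < t) {z : ℂ} (hz : t < ‖z‖) : ek t z = 0 := by
  rw [ek, kk_zero (by rwa [one_lt_div ht]), mul_zero]

lemma ek_supp {t : ℝ} (ht : 0 < t) : HasCompactSupport (ek t) :=
  HasCompactSupport.of_support_subset_isCompact (isCompact_closedBall 0 t) (by
    intro z hz
    by_contra hn
    rw [mem_closedBall, dist_zero_right, not_le] at hn
    exact hz (ek_zero ht hn))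

lemma ek_integral_one : ∫ z, ek 1 z = 1 := by
  have h0 : ∀ z : ℂ, ek 1 z = kk ‖z‖ := by intro z; simp [ek]
  simp_rw [h0]
  rw [integral_fun_norm_addHaar volume kk, Complex.finrank_real_complex]
  have hb : (volume : Measure ℂ).real (ball 0 1) = π := by
    rw [Measure.real, Complex.volume_ball]; simp
  rw [hb]
  have h : ContDiff ℝ 2 Tl := Tl_smooth
  have hT1 : Differentiable ℝ (deriv Tl) :=
    (contDiff_one_deriv h).differentiable one_ne_zero
  have h1 : ∀ y : ℝ, HasDerivAt (fun y => (2 * π)⁻¹ * (y ^ 2 * deriv Tl (y ^ 2))) (y * kk y) y := by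
    intro y
    have e1 : HasDerivAt (fun y : ℝ => y ^ 2) (2 * y) y := by simpa using hasDerivAt_pow 2 y
    have e2 := (hT1 (y ^ 2)).hasDerivAt.comp y e1
    have e3 := (e1.mul e2).const_mul ((2 * π)⁻¹)
    refine HasDerivAt.congr_deriv (f := fun y => (2 * π)⁻¹ * (y ^ 2 * deriv Tl (y ^ 2))) e3 ?_
    symm
    show y * kk y = (2 * π)⁻¹ * (2 * y * deriv Tl (y ^ 2) + y ^ 2 * (deriv (deriv Tl) (y ^ 2) * (2 * y)))
    rw [kk]
    field_simp
    ring
  have h2 : ∫ y in Ioi (0:ℝ), y ^ (2 - 1) • kk y = ∫ y in (0:ℝ)..2, y * kk y := by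
    rw [intervalIntegral.integral_of_le (by norm_num)]
    symm
    rw [← integral_indicator measurableSet_Ioc, ← integral_indicator measurableSet_Ioi]
    congr 1; ext y
    by_cases hy : 0 < y
    · by_cases hy2 : y ≤ 2
      · rw [indicator_of_mem (show y ∈ Ioc (0:ℝ) 2 from ⟨hy, hy2⟩), indicator_of_mem (show y ∈ Ioi (0:ℝ) from hy)]; simp
      · rw [indicator_of_notMem (by simp [hy2]), indicator_of_mem (show y ∈ Ioi (0:ℝ) from hy),
          kk_zero (by push Not at hy2; linarith)]; simp
    · rw [indicator_of_notMem (by simp [hy]), indicator_of_notMem (by simpa using hy)]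
  rw [h2, intervalIntegral.integral_eq_sub_of_hasDerivAt (fun y _ => h1 y)
    ((continuous_id.mul kk_cont).intervalIntegrable _ _), dTl (by norm_num)]
  simp

lemma Es_far {t : ℝ} (ht : 0 < t) {z : ℂ} (hz : t ≤ ‖z‖) : Es t z = (2 * π)⁻¹ * Real.log ‖z‖ := by
  have h0 : 0 < ‖z‖ := by linarith
  rw [Es, Tl_eq (by rw [one_le_div (by positivity)]; gcongr), Real.log_div (by positivity) (by positivity),
    Real.log_pow]
  push_cast; field_simp; ring

lemma log_le_Es {t : ℝ} (ht : 0 < t) {z : ℂ} (hz : z ≠ 0) : (2 * π)⁻¹ * Real.log ‖z‖ ≤ Es t z := by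
  have h0 : 0 < ‖z‖ := norm_pos_iff.2 hz
  have h1 := log_le_Tl (x := ‖z‖ ^ 2 / t ^ 2) (by positivity)
  rw [Real.log_div (by positivity) (by positivity), Real.log_pow ] at h1
  rw [Es]
  have : (2 * π)⁻¹ * Real.log ‖z‖ = (4 * π)⁻¹ * (2 * Real.log ‖z‖) := by field_simp; ring
  rw [this]
  gcongr
  push_cast at h1
  linarith

lemma Es_le {t : ℝ} (ht : 0 < t) {z : ℂ} (hz : ‖z‖ ≤ t) : Es t z ≤ (2 * π)⁻¹ * Real.log t := by
  have h1 := Tl_nonpos (x := ‖z‖ ^ 2 / t ^ 2) (by positivity)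
    (by rw [div_le_one (by positivity)]; gcongr)
  have : (2 * π)⁻¹ * Real.log t = (4 * π)⁻¹ * (2 * Real.log t) := by field_simp; ring
  rw [this, Es, Real.log_pow]
  gcongr
  push_cast
  linarith

lemma Es_neg (t : ℝ) (z : ℂ) : Es t (-z) = Es t z := by simp [Es]
lemma ek_neg (t : ℝ) (z : ℂ) : ek t (-z) = ek t z := by simp [ek]

lemma ek_tendsto {φ : ℂ → ℝ} (hφ : Continuous φ) (z : ℂ) :
    Tendsto (fun s => ∫ w, φ w * ek s (z - w)) (𝓝[>] 0) (𝓝 (φ z)) := by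
  have h1 : ∀ s : ℝ, 0 < s → ∫ w, φ w * ek s (z - w) =
      ∫ x in closedBall (0:ℂ) 1, φ (z - s • x) * ek 1 x := by
    intro s hs
    have e1 := integral_sub_left_eq_self (fun w => φ w * ek s (z - w)) volume z
    rw [← e1]
    simp only [sub_sub_cancel]
    have e2 := Measure.integral_comp_smul (volume : Measure ℂ) (fun x => φ (z - x) * ek s x) s
    rw [Complex.finrank_real_complex, abs_of_pos (by positivity)] at e2
    have e3 : ∫ x, φ (z - x) * ek s x = s ^ 2 * ∫ x, φ (z - s • x) * ek s (s • x) := by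
      rw [e2, smul_eq_mul, ← mul_assoc, mul_inv_cancel₀ (by positivity), one_mul]
    rw [e3, ← integral_const_mul, ← integral_indicator measurableSet_closedBall]
    congr 1; ext x
    have e4 : ek s (s • x) = (s ^ 2)⁻¹ * ek 1 x := by
      simp only [ek, norm_smul, Real.norm_eq_abs, abs_of_pos hs]
      have : s * ‖x‖ / s = ‖x‖ / 1 := by field_simp
      rw [this]; ring
    rw [e4]
    by_cases hx : x ∈ closedBall (0:ℂ) 1
    · rw [indicator_of_mem hx]; field_simp
    · rw [indicator_of_notMem hx, ek_zero one_pos (by simpa using hx)]; simp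
  have hc : Continuous fun s : ℝ => ∫ x in closedBall (0:ℂ) 1, φ (z - s • x) * ek 1 x := by
    apply continuous_parametric_integral_of_continuous _ (isCompact_closedBall _ _)
    have := ek_cont 1
    simp only [Function.uncurry_def]
    fun_prop
  have h0 : ∫ x in closedBall (0:ℂ) 1, φ (z - (0:ℝ) • x) * ek 1 x = φ z := by
    simp only [zero_smul, sub_zero]
    rw [integral_const_mul, setIntegral_eq_integral_of_forall_compl_eq_zero, ek_integral_one, mul_one]
    intro x hx
    exact ek_zero one_pos (by simpa using hx)
  have h2 := (hc.tendsto 0).mono_left (nhdsWithin_le_nhds (s := Ioi 0))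
  rw [h0] at h2
  refine h2.congr' ?_
  filter_upwards [self_mem_nhdsWithin] with s hs
  exact (h1 s hs).symm
end

noncomputable section

lemma lap_sub {u v : ℂ → ℝ} (hu : ContDiff ℝ 2 u) (hv : ContDiff ℝ 2 v) (z : ℂ) :
    lap (fun x => u x - v x) z = lap u z - lap v z := by
  have hd : ∀ {u : ℂ → ℝ}, ContDiff ℝ 2 u → Differentiable ℝ u := fun hu => hu.differentiable (by norm_num)
  have hd1 : ∀ {u : ℂ → ℝ}, ContDiff ℝ 2 u → ∀ a, Differentiable ℝ (fun x => fderiv ℝ u x a) := fun hu a =>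
    ((hu.fderiv_right (m := 1) (by norm_num)).clm_apply contDiff_const).differentiable one_ne_zero
  rw [lap_eq_dir (hu.sub hv), lap_eq_dir hu, lap_eq_dir hv]
  have e : ∀ x, fderiv ℝ (fun x => u x - v x) x = fderiv ℝ u x - fderiv ℝ v x := fun x =>
    fderiv_fun_sub (hd hu x) (hd hv x)
  simp only [e, sub_apply]
  rw [fderiv_fun_sub (hd1 hu 1 z) (hd1 hv 1 z), fderiv_fun_sub (hd1 hu _ z) (hd1 hv _ z)]
  simp only [sub_apply]
  ring

lemma lap_add {u v : ℂ → ℝ} (hu : ContDiff ℝ 2 u) (hv : ContDiff ℝ 2 v) (z : ℂ) :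
    lap (fun x => u x + v x) z = lap u z + lap v z := by
  have hd : ∀ {u : ℂ → ℝ}, ContDiff ℝ 2 u → Differentiable ℝ u := fun hu => hu.differentiable (by norm_num)
  have hd1 : ∀ {u : ℂ → ℝ}, ContDiff ℝ 2 u → ∀ a, Differentiable ℝ (fun x => fderiv ℝ u x a) := fun hu a =>
    ((hu.fderiv_right (m := 1) (by norm_num)).clm_apply contDiff_const).differentiable one_ne_zero
  rw [lap_eq_dir (hu.add hv), lap_eq_dir hu, lap_eq_dir hv]
  have e : ∀ x, fderiv ℝ (fun x => u x + v x) x = fderiv ℝ u x + fderiv ℝ v x := fun x =>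
    fderiv_fun_add (hd hu x) (hd hv x)
  simp only [e, add_apply]
  rw [fderiv_fun_add (hd1 hu 1 z) (hd1 hv 1 z), fderiv_fun_add (hd1 hu _ z) (hd1 hv _ z)]
  simp only [add_apply]
  ring

lemma lap_comp_sub (u : ℂ → ℝ) (a z : ℂ) : lap (fun x => u (x - a)) z = lap u (z - a) := by
  simp only [lap, iteratedFDeriv_comp_sub]

lemma ek_smooth (t : ℝ) : ContDiff ℝ (⊤ : ℕ∞) (ek t) := by
  have h1 : ContDiff ℝ (⊤ : ℕ∞) (deriv Tl) := (contDiff_infty_iff_deriv.1 Tl_smooth).2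
  have h2 : ContDiff ℝ (⊤ : ℕ∞) (deriv (deriv Tl)) := (contDiff_infty_iff_deriv.1 h1).2
  have hn : ContDiff ℝ (⊤ : ℕ∞) (fun z : ℂ => ‖z‖ ^ 2 / t ^ 2) := (contDiff_norm_sq ℝ).div_const _
  have : ek t = fun z => (t ^ 2)⁻¹ * (π⁻¹ * (‖z‖ ^ 2 / t ^ 2 * deriv (deriv Tl) (‖z‖ ^ 2 / t ^ 2)
      + deriv Tl (‖z‖ ^ 2 / t ^ 2))) := by
    ext z; rw [ek, kk, div_pow]
  rw [this]
  exact contDiff_const.mul (contDiff_const.mul ((hn.mul (h2.comp hn)).add (h1.comp hn)))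

lemma Es_near {t : ℝ} (ht : 0 < t) {z : ℂ} (hz : ‖z‖ ≤ t / 2) : Es t z = (4 * π)⁻¹ * Real.log (t ^ 2) := by
  have h : ‖z‖ ^ 2 / t ^ 2 ≤ 1 / 4 := by
    rw [div_le_iff₀ (by positivity)]
    nlinarith [norm_nonneg z]
  rw [Es, Tl, Real.smoothTransition.zero_of_nonpos (by linarith)]; simp

lemma ek_near {t : ℝ} (ht : 0 < t) {z : ℂ} (hz : ‖z‖ ≤ t / 2) : ek t z = 0 := by
  have h : (‖z‖ / t) ^ 2 < 1 / 2 := by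
    rw [div_pow, div_lt_iff₀ (by positivity)]
    nlinarith [norm_nonneg z, mul_pos ht ht]
  have h0 : ∀ y : ℝ, y < 1 / 2 → deriv Tl y = 0 := by
    intro y hy
    have : Tl =ᶠ[𝓝 y] fun _ => 0 := by
      filter_upwards [eventually_lt_nhds hy] with x hx
      rw [Tl, Real.smoothTransition.zero_of_nonpos (by linarith), zero_mul]
    rw [this.deriv_eq]; simp
  have h1 : deriv (deriv Tl) ((‖z‖ / t) ^ 2) = 0 := by
    have : deriv Tl =ᶠ[𝓝 ((‖z‖ / t) ^ 2)] fun _ => 0 := by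
      filter_upwards [eventually_lt_nhds h] with x hx using h0 x hx
    rw [this.deriv_eq]; simp
  rw [ek, kk, h1, h0 _ h]; simp

namespace DGeo
variable {μ : Measure ℂ} {ρ : ℂ → ℝ} {φ : ℂ → ℝ}

lemma log_integrable (h : DGeo μ ρ) (z a : ℂ) (R : ℝ) :
    IntegrableOn (fun w => Real.log ‖z - w‖) (ball a R) μ := by
  obtain ⟨s, C, hs, -, hC, H⟩ := h.shell_int
  set R' := |R| + dist z a + 1 with hR'
  have hR0 : 0 < R' := by positivity
  have hsub : ball a R ⊆ ball z R' := by
    apply ball_subset_ball'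
    rw [dist_comm]; linarith [le_abs_self R]
  have hfin : IsFiniteMeasure (μ.restrict (ball z R')) := ⟨by simpa using h.finite_ball z R'⟩
  refine IntegrableOn.mono_set ?_ hsub
  have hi : IntegrableOn (fun w => s⁻¹ * (R' / ‖z - w‖) ^ s + |Real.log R'|) (ball z R') μ :=
    ((H z R' hR0).1.const_mul _).add (integrable_const _)
  refine Integrable.mono' hi (Measurable.aestronglyMeasurable (by fun_prop)) ?_
  rw [ae_restrict_iff' measurableSet_ball]
  refine ae_of_all _ fun w hw => ?_
  rcases eq_or_ne w z with rfl | hne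
  · simp only [sub_self, norm_zero, Real.log_zero]; positivity
  have hd : 0 < ‖z - w‖ := by rw [norm_pos_iff, sub_ne_zero]; exact hne.symm
  have hlt : ‖z - w‖ < R' := by rwa [mem_ball, dist_comm, dist_eq_norm] at hw
  have h1 : Real.log (R' / ‖z - w‖) ≤ s⁻¹ * (R' / ‖z - w‖) ^ s := by
    have := Real.log_le_rpow_div (x := R' / ‖z - w‖) (by positivity) hs
    exact this.trans_eq (by ring)
  have h2 : 0 ≤ Real.log (R' / ‖z - w‖) := Real.log_nonneg (by rw [one_le_div hd]; exact hlt.le)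
  rw [Real.log_div hR0.ne' hd.ne'] at h1 h2
  rw [Real.norm_eq_abs, abs_le]
  have := le_abs_self (Real.log R')
  have := neg_abs_le (Real.log R')
  constructor <;> linarith

lemma riesz (h : DGeo μ ρ) (hφ : HasDoublingLaplacian φ μ) (z : ℂ) {t : ℝ} (ht : 0 < t) :
    φ z = (∫ w, φ w * ek t (z - w)) -
      ∫ w in ball z t, (Es t (z - w) - (2 * π)⁻¹ * Real.log ‖z - w‖) ∂μ := by
  have hl := h.log_integrable z z t
  have hloc := h.locFin
  have hfin : IsFiniteMeasure (μ.restrict (ball z t)) := ⟨by simpa using h.finite_ball z t⟩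
  -- identity for s
  have hzero : ∀ s, 0 < s → s ≤ t → ∀ x : ℂ, t ≤ ‖x‖ → Es s x - Es t x = 0 := by
    intro s hs hst x hx
    rw [Es_far ht hx, Es_far hs (hst.trans hx), sub_self]
  have hid : ∀ s, 0 < s → s ≤ t → (∫ w, φ w * ek s (z - w)) - (∫ w, φ w * ek t (z - w)) =
      ∫ w in ball z t, (Es s (z - w) - Es t (z - w)) ∂μ := by
    intro s hs hst
    have hcs : HasCompactSupport (fun w => Es s (w - z) - Es t (w - z)) := by
      refine HasCompactSupport.of_support_subset_isCompact (isCompact_closedBall z t) ?_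
      intro w hw
      by_contra hn
      rw [mem_closedBall, dist_eq_norm, not_le] at hn
      exact hw (hzero s hs hst _ hn.le)
    have hsm : ∀ s, ContDiff ℝ (⊤ : ℕ∞) (fun w => Es s (w - z)) := fun s =>
      (Es_smooth s).comp (contDiff_id.sub contDiff_const)
    have h1 := hφ.lap_eq (fun w => Es s (w - z) - Es t (w - z)) ((hsm s).sub (hsm t)) hcs
    have h2 : ∀ w, φ w * lap (fun w => Es s (w - z) - Es t (w - z)) w =
        φ w * ek s (z - w) - φ w * ek t (z - w) := by
      intro w
      have hsm2 : ∀ s, ContDiff ℝ 2 (fun w => Es s (w - z)) := fun s =>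
        (Es_smooth (n := 2) s).comp (contDiff_id.sub contDiff_const)
      rw [lap_sub (hsm2 s) (hsm2 t),
        lap_comp_sub, lap_comp_sub, lap_Es hs, lap_Es ht, ← ek_neg s, ← ek_neg t, neg_sub, mul_sub]
    have hi : ∀ s, 0 < s → Integrable (fun w => φ w * ek s (z - w)) := fun s hs =>
      integrable_smooth hφ.continuous.locallyIntegrable (ek_cont s) (ek_supp hs) z
    simp_rw [h2] at h1
    rw [integral_sub (hi s hs) (hi t ht)] at h1
    rw [h1, setIntegral_eq_integral_of_forall_compl_eq_zero]
    · congr 1; ext w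
      rw [← Es_neg s, ← Es_neg t, neg_sub]
    · intro w hw
      rw [mem_ball, dist_comm, dist_eq_norm, not_lt] at hw
      exact hzero s hs hst _ hw
  have hT1 : Tendsto (fun s => (∫ w, φ w * ek s (z - w)) - (∫ w, φ w * ek t (z - w))) (𝓝[>] 0)
      (𝓝 (φ z - ∫ w, φ w * ek t (z - w))) := (ek_tendsto hφ.continuous z).sub_const _
  have hsm : Ioc 0 t ∈ 𝓝[>] (0:ℝ) := Ioc_mem_nhdsGT ht
  have hne : ∀ᵐ w ∂(μ.restrict (ball z t)), w ≠ z := by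
    apply ae_restrict_of_ae
    rw [ae_iff]; simpa using h.singleton_zero z
  have hT2 : Tendsto (fun s => ∫ w in ball z t, (Es s (z - w) - Es t (z - w)) ∂μ) (𝓝[>] 0)
      (𝓝 (∫ w in ball z t, ((2 * π)⁻¹ * Real.log ‖z - w‖ - Es t (z - w)) ∂μ)) := by
    refine tendsto_integral_filter_of_dominated_convergence
      (fun w => (2 * π)⁻¹ * (|Real.log t| + |Real.log ‖z - w‖|)) ?_ ?_ ?_ ?_
    · refine Eventually.of_forall fun s => ?_
      have h1 : Continuous (Es s) := (Es_smooth (n := 0) s).continuous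
      have h2 : Continuous (Es t) := (Es_smooth (n := 0) t).continuous
      exact Continuous.aestronglyMeasurable (by fun_prop)
    · filter_upwards [hsm] with s hs
      filter_upwards [hne, ae_restrict_mem measurableSet_ball] with w hw hwb
      have hd : z - w ≠ 0 := sub_ne_zero.2 hw.symm
      have hd0 : 0 < ‖z - w‖ := norm_pos_iff.2 hd
      have hlt : ‖z - w‖ ≤ t := by
        rw [mem_ball, dist_comm, dist_eq_norm] at hwb; exact hwb.le
      have e1 := log_le_Es hs.1 hd
      have e2 := log_le_Es ht hd
      have e3 := Es_le ht hlt
      have e4 : Es s (z - w) ≤ (2 * π)⁻¹ * Real.log t := by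
        rcases le_total ‖z - w‖ s with h4 | h4
        · refine (Es_le hs.1 h4).trans ?_
          have := Real.log_le_log hs.1 hs.2
          gcongr
        · rw [Es_far hs.1 h4]
          have := Real.log_le_log hd0 hlt
          gcongr
      have e5 : (2 * π)⁻¹ * (|Real.log t| + |Real.log ‖z - w‖|) ≥
          (2 * π)⁻¹ * Real.log t - (2 * π)⁻¹ * Real.log ‖z - w‖ := by
        rw [← mul_sub]
        have := le_abs_self (Real.log t)
        have := neg_abs_le (Real.log ‖z - w‖)
        apply mul_le_mul_of_nonneg_left _ (by positivity)
        linarith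
      rw [Real.norm_eq_abs, abs_le]
      constructor <;> linarith
    · exact ((integrable_const _).add hl.abs).const_mul _
    · filter_upwards [hne] with w hw
      have hd : 0 < ‖z - w‖ := norm_pos_iff.2 (sub_ne_zero.2 hw.symm)
      refine tendsto_const_nhds.congr' ?_
      filter_upwards [Ioc_mem_nhdsGT hd] with s hs
      rw [Es_far hs.1 hs.2]
  have hT3 := hT1.congr' (by filter_upwards [hsm] with s hs using hid s hs.1 hs.2)
  have hT4 := tendsto_nhds_unique hT3 hT2
  have hflip : ∫ w in ball z t, ((2 * π)⁻¹ * Real.log ‖z - w‖ - Es t (z - w)) ∂μ =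
      - ∫ w in ball z t, (Es t (z - w) - (2 * π)⁻¹ * Real.log ‖z - w‖) ∂μ := by
    rw [← integral_neg]; congr 1; ext w; ring
  rw [hflip] at hT4
  linarith
end DGeo
end

noncomputable section

/-- Green function of the disc `ball a R` -/
def grn (a : ℂ) (R : ℝ) (z w : ℂ) : ℝ :=
  2⁻¹ * Real.log (1 + (R ^ 2 - ‖w - a‖ ^ 2) * (R ^ 2 - ‖z - a‖ ^ 2) / (R ^ 2 * ‖z - w‖ ^ 2))

/-- reflected factor -/
def rfl' (a : ℂ) (R : ℝ) (z w : ℂ) : ℂ := (R ^ 2 - (starRingEnd ℂ) (w - a) * (z - a)) / R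

lemma rfl_re {a : ℂ} {R : ℝ} (hR : 0 < R) {z w : ℂ} (hz : ‖z - a‖ < R) (hw : ‖w - a‖ < R) :
    R - ‖z - a‖ ≤ (rfl' a R z w).re := by
  have h1 : (rfl' a R z w).re = (R ^ 2 - ((starRingEnd ℂ) (w - a) * (z - a)).re) / R := by
    have : rfl' a R z w = (((R ^ 2 : ℝ) : ℂ) - (starRingEnd ℂ) (w - a) * (z - a)) / (R : ℂ) := by
      simp [rfl']
    rw [this, Complex.div_ofReal_re, Complex.sub_re, Complex.ofReal_re]
  have h2 : ((starRingEnd ℂ) (w - a) * (z - a)).re ≤ R * ‖z - a‖ := by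
    refine (Complex.re_le_norm _).trans ?_
    rw [norm_mul, RCLike.norm_conj]
    gcongr
  rw [h1, le_div_iff₀ hR]
  nlinarith

lemma grn_id {a : ℂ} {R : ℝ} (hR : 0 < R) {z w : ℂ} (hz : ‖z - a‖ < R) (hw : ‖w - a‖ < R)
    (hne : w ≠ z) : grn a R z w = Real.log ‖rfl' a R z w‖ - Real.log ‖z - w‖ := by
  have hd : 0 < ‖z - w‖ := norm_pos_iff.2 (sub_ne_zero.2 hne.symm)
  have hr : 0 < ‖rfl' a R z w‖ := by
    refine lt_of_lt_of_le ?_ ((rfl_re hR hz hw).trans (Complex.re_le_norm _))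
    linarith
  have key : 1 + (R ^ 2 - ‖w - a‖ ^ 2) * (R ^ 2 - ‖z - a‖ ^ 2) / (R ^ 2 * ‖z - w‖ ^ 2) =
      (‖rfl' a R z w‖ / ‖z - w‖) ^ 2 := by
    have h1 : ‖rfl' a R z w‖ ^ 2 = ((R ^ 2 - ((w - a).re * (z - a).re + (w - a).im * (z - a).im)) ^ 2 +
        ((w - a).re * (z - a).im - (w - a).im * (z - a).re) ^ 2) / R ^ 2 := by
      have : rfl' a R z w = (((R ^ 2 : ℝ) : ℂ) - (starRingEnd ℂ) (w - a) * (z - a)) / (R : ℂ) := by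
        simp [rfl']
      rw [this, norm_div, div_pow, ← Complex.normSq_eq_norm_sq, Complex.normSq_apply, Complex.norm_real,
        Real.norm_eq_abs, sq_abs, Complex.sub_re, Complex.sub_im, Complex.mul_re, Complex.mul_im,
        Complex.conj_re, Complex.conj_im, Complex.ofReal_re, Complex.ofReal_im]
      ring
    rw [div_pow, h1, ← Complex.normSq_eq_norm_sq (z - w), ← Complex.normSq_eq_norm_sq (z - a),
      ← Complex.normSq_eq_norm_sq (w - a)]
    have hd2 : Complex.normSq (z - w) ≠ 0 := by
      rw [Complex.normSq_eq_norm_sq]; positivity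
    field_simp
    simp only [Complex.normSq_apply, Complex.sub_re, Complex.sub_im]
    ring
  rw [grn, key, Real.log_pow, Real.log_div hr.ne' hd.ne']
  push_cast; ring

namespace DGeo
variable {μ : Measure ℂ} {ρ : ℂ → ℝ} {φ : ℂ → ℝ}

lemma holo_rfl (h : DGeo μ ρ) (a : ℂ) {R : ℝ} (hR : 0 < R) :
    (∀ z ∈ ball a R, IntegrableOn (fun w => Complex.log (rfl' a R z w)) (ball a R) μ) ∧
    DifferentiableOn ℂ (fun z => ∫ w in ball a R, Complex.log (rfl' a R z w) ∂μ) (ball a R) := by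
  have hfin : IsFiniteMeasure (μ.restrict (ball a R)) := ⟨by simpa using h.finite_ball a R⟩
  have hm : ∀ z, Measurable (fun w => Complex.log (rfl' a R z w)) := by
    intro z; unfold rfl'; fun_prop
  have hderiv : ∀ z ∈ ball a R, ∀ w ∈ ball a R, HasDerivAt (fun z => Complex.log (rfl' a R z w))
      ((-(starRingEnd ℂ) (w - a) / R) / rfl' a R z w) z := by
    intro z hz w hw
    rw [mem_ball, dist_eq_norm] at hz hw
    have h1 : HasDerivAt (fun z => rfl' a R z w) (-(starRingEnd ℂ) (w - a) / R) z := by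
      have := ((((hasDerivAt_id z).sub_const a).const_mul ((starRingEnd ℂ) (w - a))).const_sub
        ((R : ℂ) ^ 2)).div_const (R : ℂ)
      simpa [rfl'] using this
    refine h1.clog ?_
    left
    have := rfl_re hR hz hw
    linarith
  have hbd : ∀ z ∈ ball a R, ∀ w ∈ ball a R,
      ‖(-(starRingEnd ℂ) (w - a) / R) / rfl' a R z w‖ ≤ (R - ‖z - a‖)⁻¹ := by
    intro z hz w hw
    rw [mem_ball, dist_eq_norm] at hz hw
    have h1 := (rfl_re hR hz hw).trans (Complex.re_le_norm _)
    have h2 : 0 < R - ‖z - a‖ := by linarith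
    rw [norm_div, norm_div, norm_neg, RCLike.norm_conj, Complex.norm_real, Real.norm_eq_abs, abs_of_pos hR,
      div_eq_mul_inv _ ‖rfl' a R z w‖]
    calc ‖w - a‖ / R * ‖rfl' a R z w‖⁻¹ ≤ 1 * (R - ‖z - a‖)⁻¹ := by
          gcongr
          rw [div_le_one hR]; exact hw.le
      _ = _ := one_mul _
  have hinteg : ∀ z ∈ ball a R, IntegrableOn (fun w => Complex.log (rfl' a R z w)) (ball a R) μ := by
    intro z hz
    rw [mem_ball, dist_eq_norm] at hz
    refine Integrable.mono' (g := fun _ => |Real.log (2 * R)| + |Real.log (R - ‖z - a‖)| + π)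
      (integrable_const _) (hm z).aestronglyMeasurable ?_
    rw [ae_restrict_iff' measurableSet_ball]
    refine ae_of_all _ fun w hw => ?_
    rw [mem_ball, dist_eq_norm] at hw
    have h1 := (rfl_re hR hz hw).trans (Complex.re_le_norm _)
    have h2 : 0 < R - ‖z - a‖ := by linarith
    have h3 : ‖rfl' a R z w‖ ≤ 2 * R := by
      rw [rfl', norm_div, Complex.norm_real, Real.norm_eq_abs, abs_of_pos hR, div_le_iff₀ hR]
      refine (norm_sub_le _ _).trans ?_
      rw [norm_mul, RCLike.norm_conj, norm_pow, Complex.norm_real, Real.norm_eq_abs, abs_of_pos hR]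
      nlinarith [norm_nonneg (w - a), norm_nonneg (z - a)]
    refine (Complex.norm_le_abs_re_add_abs_im _).trans ?_
    rw [Complex.log_re, Complex.log_im]
    have h4 := Complex.abs_arg_le_pi (rfl' a R z w)
    have h5 : |Real.log ‖rfl' a R z w‖| ≤ |Real.log (2 * R)| + |Real.log (R - ‖z - a‖)| := by
      have e1 := Real.log_le_log h2 h1
      have e2 := Real.log_le_log (by linarith) h3
      have := neg_abs_le (Real.log (R - ‖z - a‖))
      have := le_abs_self (Real.log (2 * R))
      have := abs_nonneg (Real.log (2 * R))
      have := abs_nonneg (Real.log (R - ‖z - a‖))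
      rw [abs_le]; constructor <;> linarith
    linarith
  refine ⟨hinteg, fun z hz => ?_⟩
  have hz' : ‖z - a‖ < R := by rwa [mem_ball, dist_eq_norm] at hz
  set r := (R + ‖z - a‖) / 2 with hr
  have hrR : r < R := by linarith
  have hsub : ball a r ⊆ ball a R := ball_subset_ball hrR.le
  have hnh : ball a r ∈ 𝓝 z := isOpen_ball.mem_nhds (by rw [mem_ball, dist_eq_norm]; linarith)
  have := hasDerivAt_integral_of_dominated_loc_of_deriv_le (μ := μ.restrict (ball a R))
    (F := fun z w => Complex.log (rfl' a R z w))
    (F' := fun z w => (-(starRingEnd ℂ) (w - a) / R) / rfl' a R z w) (x₀ := z) (s := ball a r)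
    (bound := fun _ => (R - r)⁻¹) hnh
    (Eventually.of_forall fun x => (hm x).aestronglyMeasurable) (hinteg z hz)
    (by apply Measurable.aestronglyMeasurable; unfold rfl'; fun_prop)
    (by
      rw [ae_restrict_iff' measurableSet_ball]
      refine ae_of_all _ fun w hw x hx => ?_
      refine (hbd x (hsub hx) w hw).trans ?_
      rw [mem_ball, dist_eq_norm] at hx
      have : 0 < R - r := by linarith
      gcongr)
    (integrable_const _)
    (by
      rw [ae_restrict_iff' measurableSet_ball]
      exact ae_of_all _ fun w hw x hx => hderiv x (hsub hx) w hw)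
  exact this.2.differentiableAt.differentiableWithinAt

/-- harmonic part -/
lemma harm_part (h : DGeo μ ρ) (hφ : HasDoublingLaplacian φ μ) (a : ℂ) {R t : ℝ} (ht : 0 < t)
    (htR : t < R) : ∃ F : ℂ → ℂ, DifferentiableOn ℂ F (ball a (R - t)) ∧ ∀ z ∈ ball a (R - t),
      (F z).re = (∫ w, φ w * ek t (z - w)) - ∫ w in ball a R, Es t (z - w) ∂μ := by
  have hloc := h.locFin
  have hR : 0 < R := by linarith
  have hfin : IsFiniteMeasure (μ.restrict (ball a R)) := ⟨by simpa using h.finite_ball a R⟩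
  set c : ℂ → ℝ := fun x => Es (4 * R) x - Es t x with hc
  have hcsm : ContDiff ℝ 2 c := (Es_smooth (n := 2) _).sub (Es_smooth (n := 2) _)
  have hcs : HasCompactSupport c := by
    refine HasCompactSupport.of_support_subset_isCompact (isCompact_closedBall 0 (4 * R)) ?_
    intro w hw
    by_contra hn
    rw [mem_closedBall, dist_zero_right, not_le] at hn
    apply hw
    rw [hc]; simp only
    rw [Es_far (by positivity) hn.le, Es_far ht (by linarith), sub_self]
  have hlc : ∀ x, lap c x = ek (4 * R) x - ek t x := by
    intro x
    rw [hc, lap_sub (Es_smooth (n := 2) _) (Es_smooth (n := 2) _), lap_Es (by positivity), lap_Es ht]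
  have heks : ContDiff ℝ 2 (ek t) := (ek_smooth t).of_le (by norm_cast)
  obtain ⟨hA, hAl⟩ := lap_smooth (ν := volume) (f := φ) hφ.continuous.locallyIntegrable heks (ek_supp ht)
  have hone : LocallyIntegrable (fun _ : ℂ => (1:ℝ)) (μ.restrict (ball a R)) :=
    (integrable_const _).locallyIntegrable
  obtain ⟨hB, hBl⟩ := lap_smooth (ν := μ.restrict (ball a R)) hone hcsm hcs
  set H : ℂ → ℝ := fun x => (∫ w, φ w * ek t (x - w)) + ∫ w in ball a R, 1 * c (x - w) ∂μ with hH
  have hHs : ContDiff ℝ 2 H := hA.add hB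
  have hlap : ∀ z ∈ ball a (R - t), lap H z = 0 := by
    intro z hz
    rw [mem_ball, dist_eq_norm] at hz
    rw [hH, lap_add hA hB, hAl, hBl]
    have e1 : ∫ w, φ w * lap (ek t) (z - w) = ∫ w, ek t (z - w) ∂μ := by
      have := hφ.lap_eq (fun w => ek t (w - z)) ((ek_smooth t).comp (contDiff_id.sub contDiff_const))
        ((ek_supp ht).comp_homeomorph (Homeomorph.subRight z))
      have e2 : ∀ x, lap (ek t) (-x) = lap (ek t) x := by
        intro x
        have hev : (ek t) ∘ (-(ContinuousLinearMap.id ℝ ℂ)) = ek t := by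
          ext y; exact ek_neg t y
        have h3 := (-(ContinuousLinearMap.id ℝ ℂ)).iteratedFDeriv_comp_right heks x (i := 2) le_rfl
        rw [hev] at h3
        have h4 := fun m : Fin 2 → ℂ => congrArg (fun T => T m) h3
        simp only [ContinuousMultilinearMap.compContinuousLinearMap_apply] at h4
        simp only [lap]
        rw [h4, h4]
        simp only [iteratedFDeriv_two_apply]
        simp
      simp only [lap_comp_sub] at this
      have e3 : ∀ w, lap (ek t) (z - w) = lap (ek t) (w - z) := by
        intro w; rw [← e2, neg_sub]
      have e4 : ∀ w, ek t (z - w) = ek t (w - z) := by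
        intro w; rw [← ek_neg, neg_sub]
      simp_rw [e3, e4]; exact this
    have e2 : ∫ w in ball a R, 1 * lap c (z - w) ∂μ = - ∫ w, ek t (z - w) ∂μ := by
      have e5 : ∫ w in ball a R, -ek t (z - w) ∂μ = ∫ w, -ek t (z - w) ∂μ := by
        apply setIntegral_eq_integral_of_forall_compl_eq_zero
        intro w hw
        rw [mem_ball, dist_eq_norm, not_lt] at hw
        rw [ek_zero ht, neg_zero]
        have : w - a = (z - a) - (z - w) := by ring
        rw [this] at hw
        have := norm_sub_le (z - a) (z - w)
        linarith
      rw [← integral_neg, ← e5]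
      · apply setIntegral_congr_fun measurableSet_ball
        intro w hw
        rw [mem_ball, dist_eq_norm] at hw
        simp only [hlc]
        rw [ek_near (by positivity)]
        · ring
        · have : z - w = (z - a) - (w - a) := by ring
          rw [this]
          refine (norm_sub_le _ _).trans ?_
          linarith
    rw [e1, e2]; ring
  have hharm : InnerProductSpace.HarmonicOnNhd H (ball a (R - t)) := by
    intro z hz
    refine ⟨hHs.contDiffAt, ?_⟩
    filter_upwards [isOpen_ball.mem_nhds hz] with x hx
    rw [InnerProductSpace.laplacian_eq_iteratedFDeriv_complexPlane]
    exact hlap x hx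
  obtain ⟨F, hF, hFe⟩ := hharm.exists_analyticOnNhd_ball_re_eq
  set K : ℝ := (4 * π)⁻¹ * Real.log ((4 * R) ^ 2) * μ.real (ball a R) with hK
  refine ⟨fun z => F z - (K : ℂ), hF.differentiableOn.sub_const _, fun z hz => ?_⟩
  have h1 : (F z).re = H z := hFe hz
  rw [Complex.sub_re, h1, Complex.ofReal_re]
  rw [mem_ball, dist_eq_norm] at hz
  have hinteg : IntegrableOn (fun w => Es t (z - w)) (ball a R) μ := by
    have : Continuous (fun w => Es t (z - w)) :=
      (Es_smooth (n := 0) t).continuous.comp (continuous_const.sub continuous_id)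
    exact (this.continuousOn.integrableOn_compact (isCompact_closedBall a R)).mono_set ball_subset_closedBall
  have h2 : ∫ w in ball a R, 1 * c (z - w) ∂μ = K - ∫ w in ball a R, Es t (z - w) ∂μ := by
    have : ∫ w in ball a R, 1 * c (z - w) ∂μ =
        ∫ w in ball a R, ((4 * π)⁻¹ * Real.log ((4 * R) ^ 2) - Es t (z - w)) ∂μ := by
      apply setIntegral_congr_fun measurableSet_ball
      intro w hw
      rw [mem_ball, dist_eq_norm] at hw
      simp only [hc, one_mul]
      rw [Es_near (by positivity)]
      have : z - w = (z - a) - (w - a) := by ring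
      rw [this]
      refine (norm_sub_le _ _).trans ?_
      linarith
    rw [this, integral_sub (integrable_const _) hinteg, hK]
    simp [Measure.real, mul_comm]
  rw [hH]; simp only
  rw [h2]; ring

lemma local_holo0 (h : DGeo μ ρ) (hφ : HasDoublingLaplacian φ μ) (a : ℂ) {R t : ℝ} (ht : 0 < t)
    (htR : t < R) : ∃ F : ℂ → ℂ, DifferentiableOn ℂ F (ball a (R - t)) ∧ ∀ z ∈ ball a (R - t),
      (F z).re = φ z + (2 * π)⁻¹ * ∫ w in ball a R, grn a R z w ∂μ := by
  have hR : 0 < R := by linarith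
  have hloc := h.locFin
  obtain ⟨F1, hF1, hF1e⟩ := h.harm_part hφ a ht htR
  obtain ⟨hi2, hF2⟩ := h.holo_rfl a hR
  have hsub : ball a (R - t) ⊆ ball a R := ball_subset_ball (by linarith)
  refine ⟨fun z => F1 z + ((2 * π)⁻¹ : ℝ) * ∫ w in ball a R, Complex.log (rfl' a R z w) ∂μ,
    hF1.add ((hF2.mono hsub).const_mul _), fun z hz => ?_⟩
  have hinteg : IntegrableOn (fun w => Es t (z - w)) (ball a R) μ := by
    have : Continuous (fun w => Es t (z - w)) :=
      (Es_smooth (n := 0) t).continuous.comp (continuous_const.sub continuous_id)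
    exact (this.continuousOn.integrableOn_compact (isCompact_closedBall a R)).mono_set ball_subset_closedBall
  have hl := h.log_integrable z a R
  rw [Complex.add_re, hF1e z hz, h.riesz hφ z ht, Complex.re_ofReal_mul]
  have e1 : (∫ w in ball a R, Complex.log (rfl' a R z w) ∂μ).re =
      ∫ w in ball a R, Real.log ‖rfl' a R z w‖ ∂μ := by
    have := integral_re (hi2 z (hsub hz))
    simp only [RCLike.re_to_complex, Complex.log_re] at this
    exact this.symm
  have hz' : ‖z - a‖ < R - t := by rwa [mem_ball, dist_eq_norm] at hz
  have e2 : ∫ w in ball a R, grn a R z w ∂μ = (∫ w in ball a R, Real.log ‖rfl' a R z w‖ ∂μ) -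
      ∫ w in ball a R, Real.log ‖z - w‖ ∂μ := by
    have hi3 : IntegrableOn (fun w => Real.log ‖rfl' a R z w‖) (ball a R) μ := by
      have := (hi2 z (hsub hz)).re
      simp only [RCLike.re_to_complex, Complex.log_re] at this
      exact this
    rw [← integral_sub hi3 hl]
    apply integral_congr_ae
    have hne : ∀ᵐ w ∂(μ.restrict (ball a R)), w ≠ z := by
      apply ae_restrict_of_ae
      rw [ae_iff]; simpa using h.singleton_zero z
    filter_upwards [hne, ae_restrict_mem measurableSet_ball] with w hw hwb
    rw [mem_ball, dist_eq_norm] at hwb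
    exact grn_id hR (by linarith) hwb hw
  have e3 : ∫ w in ball z t, (Es t (z - w) - (2 * π)⁻¹ * Real.log ‖z - w‖) ∂μ =
      (∫ w in ball a R, Es t (z - w) ∂μ) - (2 * π)⁻¹ * ∫ w in ball a R, Real.log ‖z - w‖ ∂μ := by
    rw [← integral_const_mul, ← integral_sub hinteg (hl.const_mul _)]
    symm
    apply setIntegral_eq_of_subset_of_forall_sdiff_eq_zero measurableSet_ball
    · apply ball_subset_ball'
      rw [dist_eq_norm]; linarith
    · intro w hw
      have : t ≤ ‖z - w‖ := by
        have := hw.2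
        rwa [mem_ball, dist_comm, dist_eq_norm, not_lt] at this
      rw [Es_far ht this]; ring
  rw [e1, e2, e3]; ring
end DGeo
end

noncomputable section

lemma grn_nonneg {a : ℂ} {R : ℝ} {z w : ℂ} (hz : ‖z - a‖ ≤ R) (hw : ‖w - a‖ ≤ R) :
    0 ≤ grn a R z w := by
  have h1 : 0 ≤ R ^ 2 - ‖w - a‖ ^ 2 := by nlinarith [norm_nonneg (w - a)]
  have h2 : 0 ≤ R ^ 2 - ‖z - a‖ ^ 2 := by nlinarith [norm_nonneg (z - a)]
  unfold grn
  refine mul_nonneg (by norm_num) (Real.log_nonneg ?_)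
  have : 0 ≤ (R ^ 2 - ‖w - a‖ ^ 2) * (R ^ 2 - ‖z - a‖ ^ 2) / (R ^ 2 * ‖z - w‖ ^ 2) := by positivity
  linarith

lemma grn_le {a : ℂ} {R θ s : ℝ} (hR : 0 < R) (hs : 0 < s) (hs1 : s ≤ 1) (hθ : 0 ≤ θ) {z w : ℂ}
    (hz : ‖z - a‖ ≤ R) (hw : ‖w - a‖ ≤ R) (hzθ : R ^ 2 - ‖z - a‖ ^ 2 ≤ θ * R ^ 2) :
    grn a R z w ≤ s⁻¹ * θ ^ (s / 2) * (2 * R / ‖z - w‖) ^ s := by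
  have h1 : 0 ≤ R ^ 2 - ‖w - a‖ ^ 2 := by nlinarith [norm_nonneg (w - a)]
  have h2 : 0 ≤ R ^ 2 - ‖z - a‖ ^ 2 := by nlinarith [norm_nonneg (z - a)]
  set d := ‖z - w‖
  have hd : 0 ≤ d := norm_nonneg _
  have h3 : (R ^ 2 - ‖w - a‖ ^ 2) * (R ^ 2 - ‖z - a‖ ^ 2) / (R ^ 2 * d ^ 2) ≤ θ * (2 * R / d) ^ 2 := by
    calc _ ≤ (R ^ 2) * (θ * R ^ 2) / (R ^ 2 * d ^ 2) := by
          gcongr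
          nlinarith [norm_nonneg (w - a)]
      _ = θ * (R / d) ^ 2 := by
          rw [div_pow, mul_div_mul_left _ _ (by positivity)]; ring
      _ ≤ _ := by gcongr; linarith
  have h0 : 0 ≤ (R ^ 2 - ‖w - a‖ ^ 2) * (R ^ 2 - ‖z - a‖ ^ 2) / (R ^ 2 * d ^ 2) := by positivity
  have h4 : (θ * (2 * R / d) ^ 2) ^ (s / 2) = θ ^ (s / 2) * (2 * R / d) ^ s := by
    rw [Real.mul_rpow hθ (by positivity), ← Real.rpow_natCast, ← Real.rpow_mul (by positivity)]
    congr 2; push_cast; ring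
  unfold grn
  calc _ ≤ 2⁻¹ * Real.log (1 + θ * (2 * R / d) ^ 2) := by gcongr
    _ ≤ 2⁻¹ * ((θ * (2 * R / d) ^ 2) ^ (s / 2) / (s / 2)) := by
        gcongr
        exact DGeo.log_one_add_le (by positivity) (by positivity) (by linarith)
    _ = _ := by rw [h4]; field_simp

lemma grn_ge {a : ℂ} {R : ℝ} (hR : 0 < R) {z w : ℂ} (hne : z ≠ w)
    (hz : ‖z - a‖ ≤ R / 4) (hw : ‖w - a‖ ≤ R / 4) : 2⁻¹ ≤ grn a R z w := by
  have hd : 0 < ‖z - w‖ := norm_pos_iff.2 (sub_ne_zero.2 hne)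
  have hd2 : ‖z - w‖ ≤ R / 2 := by
    have : z - w = (z - a) - (w - a) := by ring
    rw [this]; refine (norm_sub_le _ _).trans ?_; linarith
  have h1 : 15 / 16 * R ^ 2 ≤ R ^ 2 - ‖w - a‖ ^ 2 := by nlinarith [norm_nonneg (w - a)]
  have h2 : 15 / 16 * R ^ 2 ≤ R ^ 2 - ‖z - a‖ ^ 2 := by nlinarith [norm_nonneg (z - a)]
  have h3 : 2 ≤ (R ^ 2 - ‖w - a‖ ^ 2) * (R ^ 2 - ‖z - a‖ ^ 2) / (R ^ 2 * ‖z - w‖ ^ 2) := by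
    rw [le_div_iff₀ (by positivity)]
    have e1 : (15 / 16 * R ^ 2) * (15 / 16 * R ^ 2) ≤ (R ^ 2 - ‖w - a‖ ^ 2) * (R ^ 2 - ‖z - a‖ ^ 2) := by
      gcongr
      exact le_trans (by positivity) h1
    have e2 : ‖z - w‖ ^ 2 ≤ (R / 2) ^ 2 := by gcongr
    have e3 : R ^ 2 * ‖z - w‖ ^ 2 ≤ R ^ 2 * (R / 2) ^ 2 := by gcongr
    nlinarith [pow_pos hR 4]
  have h4 : 1 ≤ Real.log (1 + (R ^ 2 - ‖w - a‖ ^ 2) * (R ^ 2 - ‖z - a‖ ^ 2) / (R ^ 2 * ‖z - w‖ ^ 2)) := by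
    rw [Real.le_log_iff_exp_le (by linarith)]
    have := Real.exp_one_lt_d9
    linarith
  unfold grn
  linarith

namespace DGeo
variable {μ : Measure ℂ} {ρ : ℂ → ℝ} {φ : ℂ → ℝ}

lemma grn_int (h : DGeo μ ρ) : ∃ s A : ℝ, 0 < s ∧ s ≤ 1 ∧ 0 < A ∧ ∀ (a : ℂ) (R θ : ℝ), 0 < R → 0 ≤ θ →
    ∀ z ∈ ball a R, R ^ 2 - ‖z - a‖ ^ 2 ≤ θ * R ^ 2 →
    IntegrableOn (fun w => grn a R z w) (ball a R) μ ∧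
    ∫ w in ball a R, grn a R z w ∂μ ≤ A * θ ^ (s / 2) * μ.real (ball a R) := by
  obtain ⟨s, C, hs, hs1, hC, hsh⟩ := h.shell_int
  obtain ⟨n, hn⟩ := h.growth
  refine ⟨s, s⁻¹ * C * 6 ^ n, hs, hs1, by positivity, fun a R θ hR hθ z hz hzθ => ?_⟩
  obtain ⟨hi, hb⟩ := hsh z (2 * R) (by positivity)
  have hsub : ball a R ⊆ ball z (2 * R) := by
    apply ball_subset_ball'
    rw [mem_ball, dist_comm] at hz; linarith
  have hsub2 : ball z (2 * R) ⊆ ball a (3 * R) := by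
    apply ball_subset_ball'
    rw [mem_ball] at hz; linarith
  have hzR : ‖z - a‖ ≤ R := by rw [mem_ball, dist_eq_norm] at hz; exact hz.le
  set g : ℂ → ℝ := fun w => s⁻¹ * θ ^ (s / 2) * (2 * R / ‖z - w‖) ^ s with hg
  have hgi : IntegrableOn g (ball a R) μ := (hi.mono_set hsub).const_mul _
  have hle : ∀ᵐ w ∂(μ.restrict (ball a R)), grn a R z w ≤ g w := by
    filter_upwards [ae_restrict_mem measurableSet_ball] with w hw
    rw [mem_ball, dist_eq_norm] at hw
    exact grn_le hR hs hs1 hθ hzR hw.le hzθ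
  have h0 : ∀ᵐ w ∂(μ.restrict (ball a R)), 0 ≤ grn a R z w := by
    filter_upwards [ae_restrict_mem measurableSet_ball] with w hw
    rw [mem_ball, dist_eq_norm] at hw
    exact grn_nonneg hzR hw.le
  have hm : Measurable (fun w => grn a R z w) := by unfold grn; fun_prop
  refine ⟨hgi.mono' hm.aestronglyMeasurable ?_, ?_⟩
  · filter_upwards [hle, h0] with w h1 h2
    rwa [Real.norm_eq_abs, abs_of_nonneg h2]
  · calc _ ≤ ∫ w in ball a R, g w ∂μ := integral_mono_of_nonneg h0 hgi hle
      _ = s⁻¹ * θ ^ (s / 2) * ∫ w in ball a R, (2 * R / ‖z - w‖) ^ s ∂μ := integral_const_mul _ _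
      _ ≤ s⁻¹ * θ ^ (s / 2) * ∫ w in ball z (2 * R), (2 * R / ‖z - w‖) ^ s ∂μ := by
          refine mul_le_mul_of_nonneg_left ?_ (by positivity)
          refine setIntegral_mono_set hi ?_ hsub.eventuallyLE
          exact ae_of_all _ fun w => by simp only [Pi.zero_apply]; positivity
      _ ≤ s⁻¹ * θ ^ (s / 2) * (C * ((2 * 3) ^ n * μ.real (ball a R))) := by
          refine mul_le_mul_of_nonneg_left ?_ (by positivity)
          refine hb.trans (mul_le_mul_of_nonneg_left ?_ hC.le)
          exact (h.real_mono hsub2).trans (hn a R 3 hR (by norm_num))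
      _ = _ := by norm_num; ring

lemma local_holo (h : DGeo μ ρ) (hφ : HasDoublingLaplacian φ μ) :
    ∃ c η C : ℝ, 0 < c ∧ 0 < η ∧ η ≤ 1 / 16 ∧ 0 < C ∧ ∀ (a : ℂ) (R : ℝ), 0 < R → ∃ F : ℂ → ℂ,
      DifferentiableOn ℂ F (ball a ((1 - η) * R)) ∧
      (∀ z ∈ ball a ((1 - η) * R), φ z ≤ (F z).re ∧ (F z).re ≤ φ z + C * μ.real (ball a R)) ∧
      (∀ z ∈ ball a (R / 4), φ z + c * μ.real (ball a R) ≤ (F z).re) ∧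
      (∀ z ∈ ball a ((1 - η) * R), (1 - 3 * η) * R ≤ dist z a →
        (F z).re ≤ φ z + c / 2 * μ.real (ball a R)) := by
  obtain ⟨s, A, hs, hs1, hA, hgi⟩ := h.grn_int
  obtain ⟨n, hn⟩ := h.growth
  set c : ℝ := (2 * π)⁻¹ * (2⁻¹ * (8 ^ n)⁻¹) with hc
  have hcp : 0 < c := by positivity
  set x : ℝ := c * π / A with hx
  have hxp : 0 < x := by positivity
  set η : ℝ := min (1 / 16) (x ^ (2 / s) / 6) with hη
  have hηp : 0 < η := by positivity
  have hη1 : η ≤ 1 / 16 := min_le_left _ _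
  have hηx : (6 * η) ^ (s / 2) ≤ x := by
    have : 6 * η ≤ x ^ (2 / s) := by
      have : η ≤ x ^ (2 / s) / 6 := min_le_right _ _
      linarith
    calc (6 * η) ^ (s / 2) ≤ (x ^ (2 / s)) ^ (s / 2) := by gcongr
      _ = x := by
        rw [← Real.rpow_mul hxp.le]
        have : 2 / s * (s / 2) = 1 := by field_simp
        rw [this, Real.rpow_one]
  refine ⟨c, η, (2 * π)⁻¹ * A, hcp, hηp, hη1, by positivity, fun a R hR => ?_⟩
  obtain ⟨F, hF, hFe⟩ := h.local_holo0 hφ a (t := η * R) (R := R) (by positivity) (by nlinarith)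
  have e : R - η * R = (1 - η) * R := by ring
  rw [e] at hF hFe
  have hb : ball a ((1 - η) * R) ⊆ ball a R := ball_subset_ball (by nlinarith)
  have hm0 : 0 ≤ μ.real (ball a R) := measureReal_nonneg
  refine ⟨F, hF, fun z hz => ?_, fun z hz => ?_, fun z hz hza => ?_⟩
  · rw [hFe z hz]
    have hzR := hb hz
    rw [mem_ball, dist_eq_norm] at hzR
    have h0 : 0 ≤ ∫ w in ball a R, grn a R z w ∂μ := by
      apply setIntegral_nonneg measurableSet_ball
      intro w hw
      rw [mem_ball, dist_eq_norm] at hw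
      exact grn_nonneg hzR.le hw.le
    have h1 := (hgi a R 1 hR (by norm_num) z (hb hz) (by nlinarith [norm_nonneg (z - a)])).2
    rw [Real.one_rpow, mul_one] at h1
    constructor
    · have : 0 ≤ (2 * π)⁻¹ * ∫ w in ball a R, grn a R z w ∂μ := by positivity
      linarith
    · rw [mul_assoc]; gcongr
  · have hz1 : z ∈ ball a ((1 - η) * R) := ball_subset_ball (by nlinarith) hz
    rw [hFe z hz1]
    have h1 := (hgi a R 1 hR (by norm_num) z (hb hz1) (by nlinarith [norm_nonneg (z - a)])).1
    have hsub : ball a (R / 4) ⊆ ball a R := ball_subset_ball (by linarith)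
    have hzR := hb hz1
    rw [mem_ball, dist_eq_norm] at hzR hz
    have h2 : ∫ w in ball a (R / 4), grn a R z w ∂μ ≤ ∫ w in ball a R, grn a R z w ∂μ := by
      refine setIntegral_mono_set h1 ?_ hsub.eventuallyLE
      filter_upwards [ae_restrict_mem measurableSet_ball] with w hw
      rw [mem_ball, dist_eq_norm] at hw
      exact grn_nonneg hzR.le hw.le
    have hfin : IsFiniteMeasure (μ.restrict (ball a (R / 4))) := ⟨by simpa using h.finite_ball a (R / 4)⟩
    have h3 : 2⁻¹ * μ.real (ball a (R / 4)) ≤ ∫ w in ball a (R / 4), grn a R z w ∂μ := by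
      have : ∫ w in ball a (R / 4), (2⁻¹ : ℝ) ∂μ = 2⁻¹ * μ.real (ball a (R / 4)) := by
        simp [mul_comm]
      rw [← this]
      apply integral_mono_ae (integrable_const _) (h1.mono_set hsub)
      have hne : ∀ᵐ w ∂(μ.restrict (ball a (R / 4))), w ≠ z := by
        apply ae_restrict_of_ae
        rw [ae_iff]; simpa using h.singleton_zero z
      filter_upwards [hne, ae_restrict_mem measurableSet_ball] with w hw1 hw
      rw [mem_ball, dist_eq_norm] at hw
      exact grn_ge hR hw1.symm hz.le hw.le
    have h4 := hn a (R / 4) 4 (by positivity) (by norm_num)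
    have e4 : 4 * (R / 4) = R := by ring
    rw [e4] at h4
    norm_num at h4
    have h5 : (8 ^ n)⁻¹ * μ.real (ball a R) ≤ μ.real (ball a (R / 4)) := by
      rw [inv_mul_le_iff₀ (by positivity)]; exact h4
    have h6 : c * μ.real (ball a R) ≤ (2 * π)⁻¹ * ∫ w in ball a R, grn a R z w ∂μ := by
      rw [hc, mul_assoc]
      gcongr
      linarith
    linarith
  · rw [hFe z hz]
    have h1 := (hgi a R (6 * η) hR (by positivity) z (hb hz) ?_).2
    · have : (2 * π)⁻¹ * ∫ w in ball a R, grn a R z w ∂μ ≤ c / 2 * μ.real (ball a R) := by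
        calc _ ≤ (2 * π)⁻¹ * (A * (6 * η) ^ (s / 2) * μ.real (ball a R)) := by gcongr
          _ ≤ (2 * π)⁻¹ * (A * x * μ.real (ball a R)) := by gcongr
          _ = _ := by rw [hx]; field_simp
      linarith
    · rw [dist_eq_norm] at hza
      have h2 : 0 ≤ (1 - 3 * η) * R := by apply mul_nonneg _ hR.le; linarith
      have h3 : ((1 - 3 * η) * R) ^ 2 ≤ ‖z - a‖ ^ 2 := by gcongr
      nlinarith [sq_nonneg (η * R)]
end DGeo
end

noncomputable section

lemma lint_inv_norm {R : ℝ} (hR : 0 < R) :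
    ∫⁻ x in ball (0 : ℂ) R, ENNReal.ofReal (‖x‖⁻¹) ≤ ENNReal.ofReal (2 * π * R) := by
  rw [← lintegral_indicator measurableSet_ball, ← Complex.lintegral_comp_polarCoord_symm]
  have hle : ∀ p ∈ polarCoord.target, ENNReal.ofReal p.1 •
      (ball (0:ℂ) R).indicator (fun x => ENNReal.ofReal (‖x‖⁻¹)) (Complex.polarCoord.symm p) ≤
      (Ioo 0 R ×ˢ Ioo (-π) π).indicator (fun _ => (1:ℝ≥0∞)) p := by
    intro p hp
    rw [polarCoord_target, mem_prod] at hp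
    have hp1 : 0 < p.1 := hp.1
    by_cases hm : Complex.polarCoord.symm p ∈ ball (0:ℂ) R
    · rw [indicator_of_mem hm]
      rw [mem_ball, dist_zero_right, Complex.norm_polarCoord_symm, abs_of_pos hp1] at hm
      rw [indicator_of_mem (by exact ⟨⟨hp1, hm⟩, hp.2⟩), Complex.norm_polarCoord_symm, abs_of_pos hp1,
        smul_eq_mul, ← ENNReal.ofReal_mul hp1.le, mul_inv_cancel₀ hp1.ne']
      simp
    · rw [indicator_of_notMem hm]; simp
  calc _ ≤ ∫⁻ p in polarCoord.target, (Ioo 0 R ×ˢ Ioo (-π) π).indicator (fun _ => (1:ℝ≥0∞)) p := by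
        apply setLIntegral_mono' polarCoord.open_target.measurableSet hle
    _ ≤ ∫⁻ p, (Ioo 0 R ×ˢ Ioo (-π) π).indicator (fun _ => (1:ℝ≥0∞)) p := setLIntegral_le_lintegral _ _
    _ = volume (Ioo 0 R ×ˢ Ioo (-π) π) := by
        rw [lintegral_indicator (measurableSet_Ioo.prod measurableSet_Ioo)]; simp
    _ = ENNReal.ofReal (2 * π * R) := by
        rw [Measure.volume_eq_prod, Measure.prod_prod, Real.volume_Ioo, Real.volume_Ioo,
          ← ENNReal.ofReal_mul (by linarith)]
        congr 1; ring

lemma lint_inv_ball (c ζ : ℂ) {r : ℝ} (hr : 0 < r) :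
    ∫⁻ w in ball c r, ENNReal.ofReal (‖ζ - w‖⁻¹) ≤ ENNReal.ofReal (6 * π * r) := by
  by_cases hc : ‖ζ - c‖ < 2 * r
  · have hsub : ball c r ⊆ ball ζ (3 * r) := by
      apply ball_subset_ball'
      rw [dist_comm, dist_eq_norm]; linarith
    calc _ ≤ ∫⁻ w in ball ζ (3 * r), ENNReal.ofReal (‖ζ - w‖⁻¹) := lintegral_mono_set hsub
      _ = ∫⁻ w in ball (0:ℂ) (3 * r), ENNReal.ofReal (‖w‖⁻¹) := by
          rw [← lintegral_indicator measurableSet_ball, ← lintegral_indicator measurableSet_ball,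
            ← lintegral_sub_left_eq_self _ ζ]
          congr 1; ext w
          simp only [indicator, mem_ball, dist_eq_norm]
          rw [sub_sub_cancel_left, norm_neg, sub_zero, sub_sub_cancel]
      _ ≤ _ := by
          refine (lint_inv_norm (by positivity)).trans_eq ?_
          congr 1; ring
  · push Not at hc
    calc _ ≤ ∫⁻ w in ball c r, ENNReal.ofReal (r⁻¹) := by
          apply setLIntegral_mono' measurableSet_ball
          intro w hw
          apply ENNReal.ofReal_le_ofReal
          rw [mem_ball, dist_eq_norm] at hw
          have : ζ - c = (ζ - w) + (w - c) := by ring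
          rw [this] at hc
          have := norm_add_le (ζ - w) (w - c)
          gcongr; linarith
      _ = ENNReal.ofReal (π * r) := by
          rw [setLIntegral_const, Complex.volume_ball, ← ENNReal.ofReal_pow hr.le]
          have : (NNReal.pi : ℝ≥0∞) = ENNReal.ofReal π := by
            rw [ENNReal.ofReal]; congr 1; ext; simp [Real.pi_pos.le]
          rw [this, ← ENNReal.ofReal_mul (by positivity), ← ENNReal.ofReal_mul (by positivity)]
          congr 1; field_simp
      _ ≤ _ := by
          apply ENNReal.ofReal_le_ofReal
          nlinarith [mul_pos Real.pi_pos hr]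

/-- Cauchy transform -/
def Cau (f : ℂ → ℂ) (ζ : ℂ) : ℂ := (π : ℂ)⁻¹ * ∫ w, f w / (ζ - w)

lemma cau_lint {f : ℂ → ℂ} {A r : ℝ} {c : ℂ} (hr : 0 < r) (hA : ∀ w, ‖f w‖ ≤ A)
    (hs : ∀ w, w ∉ ball c r → f w = 0) (ζ : ℂ) :
    ∫⁻ w, ‖f w / (ζ - w)‖ₑ ≤ ENNReal.ofReal (6 * π * r * A) := by
  have hA0 : 0 ≤ A := (norm_nonneg _).trans (hA 0)
  calc _ ≤ ∫⁻ w in ball c r, ENNReal.ofReal A * ENNReal.ofReal (‖ζ - w‖⁻¹) := by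
        rw [← lintegral_indicator measurableSet_ball]
        apply lintegral_mono
        intro w
        by_cases hw : w ∈ ball c r
        · simp only [indicator_of_mem hw]
          rw [← ENNReal.ofReal_mul hA0, ← ofReal_norm, norm_div, div_eq_mul_inv]
          apply ENNReal.ofReal_le_ofReal
          gcongr; exact hA w
        · simp [hs w hw]
    _ = ENNReal.ofReal A * ∫⁻ w in ball c r, ENNReal.ofReal (‖ζ - w‖⁻¹) :=
        lintegral_const_mul' _ _ ENNReal.ofReal_ne_top
    _ ≤ ENNReal.ofReal A * ENNReal.ofReal (6 * π * r) := by
        gcongr; exact lint_inv_ball c ζ hr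
    _ = _ := by rw [← ENNReal.ofReal_mul hA0, mul_comm]

lemma cau_int {f : ℂ → ℂ} {A r : ℝ} {c : ℂ} (hf : Measurable f) (hr : 0 < r) (hA : ∀ w, ‖f w‖ ≤ A)
    (hs : ∀ w, w ∉ ball c r → f w = 0) (ζ : ℂ) : Integrable (fun w => f w / (ζ - w)) :=
  ⟨(by fun_prop : Measurable _).aestronglyMeasurable, (cau_lint hr hA hs ζ).trans_lt (by simp)⟩

lemma cau_bound {f : ℂ → ℂ} {A r : ℝ} {c : ℂ} (hr : 0 < r) (hA : ∀ w, ‖f w‖ ≤ A)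
    (hs : ∀ w, w ∉ ball c r → f w = 0) (ζ : ℂ) : ‖Cau f ζ‖ ≤ 6 * r * A := by
  have hA0 : 0 ≤ A := (norm_nonneg _).trans (hA 0)
  have h1 : ‖∫ w, f w / (ζ - w)‖ ≤ 6 * π * r * A := by
    have := (enorm_integral_le_lintegral_enorm (fun w => f w / (ζ - w))).trans (cau_lint hr hA hs ζ)
    rw [← ofReal_norm] at this
    exact (ENNReal.ofReal_le_ofReal_iff (by positivity)).1 this
  rw [Cau, norm_mul, norm_inv, Complex.norm_real, Real.norm_eq_abs, abs_of_pos Real.pi_pos,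
    inv_mul_le_iff₀ Real.pi_pos]
  linarith

lemma cau_meas {f : ℂ → ℂ} (hf : Measurable f) : Measurable (Cau f) := by
  unfold Cau
  refine Measurable.const_mul ?_ _
  have : StronglyMeasurable (Function.uncurry fun ζ w : ℂ => f w / (ζ - w)) := by
    apply Measurable.stronglyMeasurable
    unfold Function.uncurry
    fun_prop
  exact this.integral_prod_right.measurable

/-- bounded, measurable, boundedly supported -/
structure Nice (f : ℂ → ℂ) : Prop where
  meas : Measurable f
  bdd : ∃ A, ∀ w, ‖f w‖ ≤ A
  supp : ∃ r, 0 < r ∧ ∀ w, w ∉ ball (0:ℂ) r → f w = 0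

namespace Nice
lemma int {f : ℂ → ℂ} (h : Nice f) (ζ : ℂ) : Integrable (fun w => f w / (ζ - w)) := by
  obtain ⟨A, hA⟩ := h.bdd
  obtain ⟨r, hr, hs⟩ := h.supp
  exact cau_int h.meas hr hA hs ζ

lemma zero : Nice (fun _ => 0) := ⟨measurable_const, ⟨0, by simp⟩, ⟨1, one_pos, by simp⟩⟩

lemma add {f g : ℂ → ℂ} (hf : Nice f) (hg : Nice g) : Nice (fun z => f z + g z) := by
  obtain ⟨A, hA⟩ := hf.bdd
  obtain ⟨r, hr, hs⟩ := hf.supp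
  obtain ⟨A', hA'⟩ := hg.bdd
  obtain ⟨r', hr', hs'⟩ := hg.supp
  refine ⟨hf.meas.add hg.meas, ⟨A + A', fun w => (norm_add_le _ _).trans (add_le_add (hA w) (hA' w))⟩,
    max r r', lt_max_of_lt_left hr, fun w hw => ?_⟩
  rw [hs w fun h' => hw (ball_subset_ball (le_max_left _ _) h'),
    hs' w fun h' => hw (ball_subset_ball (le_max_right _ _) h'), add_zero]

lemma bmul {f g : ℂ → ℂ} (hf : Nice f) (hg : Measurable g) {A : ℝ} (hA : ∀ w, ‖g w‖ ≤ A) :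
    Nice (fun z => g z * f z) := by
  obtain ⟨B, hB⟩ := hf.bdd
  obtain ⟨r, hr, hs⟩ := hf.supp
  refine ⟨hg.mul hf.meas, ⟨A * B, fun w => ?_⟩, r, hr, fun w hw => by rw [hs w hw, mul_zero]⟩
  rw [norm_mul]
  exact mul_le_mul (hA w) (hB w) (norm_nonneg _) ((norm_nonneg _).trans (hA w))

lemma neg {f : ℂ → ℂ} (hf : Nice f) : Nice (fun z => - f z) := by
  simpa using hf.bmul (g := fun _ => -1) measurable_const (A := 1) (by simp)

lemma sum {ι : Type*} (s : Finset ι) {f : ι → ℂ → ℂ} (hf : ∀ i ∈ s, Nice (f i)) :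
    Nice (fun z => ∑ i ∈ s, f i z) := by
  induction s using Finset.induction_on with
  | empty => simpa using zero
  | insert a s ha ih =>
    simp only [Finset.sum_insert ha]
    exact (hf a (by simp)).add (ih fun i hi => hf i (by simp [hi]))

lemma of_cont {f : ℂ → ℂ} (hf : Continuous f) (hs : HasCompactSupport f) : Nice f := by
  obtain ⟨C, hC⟩ := hs.exists_bound_of_continuous hf
  refine ⟨hf.measurable, ⟨C, hC⟩, ?_⟩
  obtain ⟨r, hr⟩ := (hs.isCompact.isBounded).subset_ball 0
  refine ⟨max r 1, by positivity, fun w hw => ?_⟩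
  apply image_eq_zero_of_notMem_tsupport
  exact fun h' => hw (ball_subset_ball (le_max_left _ _) (hr h'))

lemma cau_bdd {f : ℂ → ℂ} (h : Nice f) : ∃ A, ∀ ζ, ‖Cau f ζ‖ ≤ A := by
  obtain ⟨A, hA⟩ := h.bdd
  obtain ⟨r, hr, hs⟩ := h.supp
  exact ⟨_, cau_bound hr hA hs⟩
end Nice

lemma cau_add {f g : ℂ → ℂ} (hf : Nice f) (hg : Nice g) (ζ : ℂ) :
    Cau (fun z => f z + g z) ζ = Cau f ζ + Cau g ζ := by
  simp only [Cau, add_div]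
  rw [integral_add (hf.int ζ) (hg.int ζ), mul_add]

lemma cau_neg (f : ℂ → ℂ) (ζ : ℂ) : Cau (fun z => - f z) ζ = - Cau f ζ := by
  simp only [Cau, neg_div]
  rw [integral_neg, mul_neg]

lemma cau_sum {ι : Type*} (s : Finset ι) {f : ι → ℂ → ℂ} (hf : ∀ i ∈ s, Nice (f i)) (ζ : ℂ) :
    Cau (fun z => ∑ i ∈ s, f i z) ζ = ∑ i ∈ s, Cau (f i) ζ := by
  induction s using Finset.induction_on with
  | empty => simp [Cau]
  | insert a s ha ih =>
    simp only [Finset.sum_insert ha]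
    rw [cau_add (hf a (by simp)) (Nice.sum s fun i hi => hf i (by simp [hi])),
      ih fun i hi => hf i (by simp [hi])]

/-- holomorphy off the support -/
lemma cau_holo {f : ℂ → ℂ} (hf : Nice f) {a : ℂ} {R : ℝ} (h0 : ∀ w ∈ ball a R, f w = 0) :
    DifferentiableOn ℂ (Cau f) (ball a R) := by
  intro z hz
  have hz' : dist z a < R := hz
  set d := (R - dist z a) / 2 with hd
  have hdp : 0 < d := by linarith
  obtain ⟨A, hA⟩ := hf.bdd
  obtain ⟨r, hr, hs⟩ := hf.supp
  have hA0 : 0 ≤ A := (norm_nonneg _).trans (hA 0)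
  have hfar : ∀ x ∈ ball z d, ∀ w, f w ≠ 0 → d ≤ ‖x - w‖ := by
    intro x hx w hw
    have : w ∉ ball a R := fun h' => hw (h0 w h')
    rw [mem_ball, not_lt] at this
    rw [mem_ball] at hx
    have e1 := dist_triangle w x a
    have e2 := dist_triangle x z a
    rw [← dist_eq_norm, dist_comm]
    linarith
  have key := hasDerivAt_integral_of_dominated_loc_of_deriv_le (μ := (volume : Measure ℂ))
    (F := fun z w => f w / (z - w)) (F' := fun z w => - f w / (z - w) ^ 2) (x₀ := z) (s := ball z d)
    (bound := (ball (0:ℂ) r).indicator fun _ => A / d ^ 2) (ball_mem_nhds z hdp)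
    (Eventually.of_forall fun x => (hf.int x).aestronglyMeasurable) (hf.int z)
    (by have := hf.meas; exact (by fun_prop : Measurable _).aestronglyMeasurable)
    (by
      refine ae_of_all _ fun w x hx => ?_
      by_cases hw : f w = 0
      · rw [hw]; simp only [neg_zero, zero_div, norm_zero]
        exact indicator_nonneg (fun _ _ => by positivity) _
      · have hwb : w ∈ ball (0:ℂ) r := by by_contra hn; exact hw (hs w hn)
        rw [indicator_of_mem hwb, norm_div, norm_neg, norm_pow]
        have := hfar x hx w hw
        gcongr
        exact hA w)
    (by
      rw [integrable_indicator_iff measurableSet_ball]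
      exact integrableOn_const (by exact measure_ball_lt_top.ne))
    (by
      refine ae_of_all _ fun w x hx => ?_
      by_cases hw : f w = 0
      · simp only [hw, zero_div, neg_zero]; exact hasDerivAt_const x 0
      · have hne : x - w ≠ 0 := by
          have := hfar x hx w hw
          intro h'; rw [h', norm_zero] at this; linarith
        have := ((hasDerivAt_id x).sub_const w).inv hne |>.const_mul (f w)
        refine (this.congr_deriv ?_).congr_of_eventuallyEq ?_
        · simp only [id]; ring
        · filter_upwards with y; simp [div_eq_mul_inv])
  exact (key.2.differentiableAt.const_mul _).differentiableWithinAt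
end

noncomputable section

lemma pompeiu {K : ℂ → ℂ} (hK : ContDiff ℝ 1 K) (hs : HasCompactSupport K) (ζ : ℂ) :
    Cau (dbar K) ζ = K ζ := by
  set e : ℝ → ℂ := fun θ => Real.cos θ + Real.sin θ * Complex.I with he
  have hec : Continuous e := by
    rw [he]; fun_prop
  have hen : ∀ θ, ‖e θ‖ = 1 := by
    intro θ
    have : e θ = Complex.exp (θ * Complex.I) := by
      rw [he]; simp only [Complex.exp_mul_I, Complex.ofReal_cos, Complex.ofReal_sin]
    rw [this, Complex.norm_exp_ofReal_mul_I]
  have hed : ∀ θ, HasDerivAt e (Complex.I * e θ) θ := by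
    intro θ
    have h1 := ((Real.hasDerivAt_cos θ).ofReal_comp).add
      (((Real.hasDerivAt_sin θ).ofReal_comp).mul_const Complex.I)
    refine h1.congr_deriv ?_
    rw [he]; simp only; push_cast
    ring_nf; rw [Complex.I_sq]; ring
  have hdiff : Differentiable ℝ K := hK.differentiable one_ne_zero
  have hDc : Continuous (fderiv ℝ K) := hK.continuous_fderiv one_ne_zero
  obtain ⟨R0, hR0⟩ := (hs.fderiv (𝕜 := ℝ)).isCompact.isBounded.subset_closedBall ζ
  obtain ⟨R1, hR1⟩ := hs.isCompact.isBounded.subset_closedBall ζ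
  set R : ℝ := max (max R0 R1) 1 with hR
  have hRp : 0 < R := by positivity
  have hfar : ∀ r θ, R < r → fderiv ℝ K (ζ - r * e θ) = 0 ∧ K (ζ - r * e θ) = 0 := by
    intro r θ hr
    have hd : dist (ζ - r * e θ) ζ = r := by
      rw [dist_eq_norm, sub_sub_cancel_left, norm_neg, norm_mul, hen, mul_one, Complex.norm_real,
        Real.norm_eq_abs, abs_of_pos (hRp.trans hr)]
    constructor
    · apply image_eq_zero_of_notMem_tsupport
      intro h'
      have := hR0 h'
      rw [mem_closedBall, hd] at this
      have : R0 ≤ R := (le_max_left _ _).trans (le_max_left _ _)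
      linarith
    · apply image_eq_zero_of_notMem_tsupport
      intro h'
      have := hR1 h'
      rw [mem_closedBall, hd] at this
      have : R1 ≤ R := (le_max_right _ _).trans (le_max_left _ _)
      linarith
  set A : ℝ × ℝ → ℂ := fun p => fderiv ℝ K (ζ - p.1 * e p.2) (e p.2) with hA
  set B : ℝ × ℝ → ℂ := fun p => fderiv ℝ K (ζ - p.1 * e p.2) (Complex.I * e p.2) with hB
  have hAc : Continuous A := by
    rw [hA]
    exact (hDc.comp (by fun_prop)).clm_apply (by fun_prop)
  have hBc : Continuous B := by
    rw [hB]
    exact (hDc.comp (by fun_prop)).clm_apply (by fun_prop)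
  have hinteg : ∀ G : ℝ × ℝ → ℂ, Continuous G → (∀ p : ℝ × ℝ, R < p.1 → G p = 0) →
      IntegrableOn G (Ioi 0 ×ˢ Ioo (-π) π) := by
    intro G hG h0
    have h1 : IntegrableOn G (Icc 0 R ×ˢ Icc (-π) π) :=
      hG.continuousOn.integrableOn_compact (isCompact_Icc.prod isCompact_Icc)
    refine h1.of_forall_sdiff_eq_zero (measurableSet_Ioi.prod measurableSet_Ioo) ?_
    intro p hp
    apply h0
    by_contra hn
    push Not at hn
    exact hp.2 ⟨⟨le_of_lt hp.1.1, hn⟩, ⟨hp.1.2.1.le, hp.1.2.2.le⟩⟩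
  have hAi := hinteg A hAc fun p hp => by rw [hA]; simp only; rw [(hfar _ _ hp).1]; rfl
  have hBi := hinteg B hBc fun p hp => by rw [hB]; simp only; rw [(hfar _ _ hp).1]; rfl
  have e1 : ∫ w, dbar K w / (ζ - w) = ∫ p in Ioi (0:ℝ) ×ˢ Ioo (-π) π, (2⁻¹ * A p + Complex.I / 2 * B p) := by
    rw [← integral_sub_left_eq_self _ _ ζ, ← Complex.integral_comp_polarCoord_symm, polarCoord_target]
    apply setIntegral_congr_fun (measurableSet_Ioi.prod measurableSet_Ioo)
    intro p hp
    have hp1 : 0 < p.1 := hp.1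
    simp only [Complex.polarCoord_symm_apply]
    change p.1 • (dbar K (ζ - p.1 * e p.2) / (ζ - (ζ - p.1 * e p.2))) = _
    have hne : e p.2 ≠ 0 := by intro h'; have := hen p.2; rw [h', norm_zero] at this; norm_num at this
    have hp1' : (p.1 : ℂ) ≠ 0 := by exact_mod_cast hp1.ne'
    rw [hA, hB, dbar]; simp only
    set T := fderiv ℝ K (ζ - p.1 * e p.2)
    have t1 : T (e p.2) = Real.cos p.2 * T 1 + Real.sin p.2 * T Complex.I := by
      have : e p.2 = Real.cos p.2 • (1:ℂ) + Real.sin p.2 • Complex.I := by simp [he]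
      rw [this, map_add, map_smul, map_smul, Complex.real_smul, Complex.real_smul]
    have t2 : T (Complex.I * e p.2) = - Real.sin p.2 * T 1 + Real.cos p.2 * T Complex.I := by
      have : Complex.I * e p.2 = (-Real.sin p.2) • (1:ℂ) + Real.cos p.2 • Complex.I := by
        simp only [he, Complex.real_smul]; push_cast; ring_nf; rw [Complex.I_sq]; ring
      rw [this, map_add, map_smul, map_smul, Complex.real_smul, Complex.real_smul]; push_cast; rfl
    rw [t1, t2, Complex.real_smul, smul_eq_mul, sub_sub_cancel]
    have hcs : (Real.cos p.2 : ℂ) ^ 2 + (Real.sin p.2 : ℂ) ^ 2 = 1 := by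
      norm_cast; rw [add_comm]; exact Real.sin_sq_add_cos_sq p.2
    have : ((p.1:ℂ)) * ((T 1 + Complex.I * T Complex.I) / 2 / (p.1 * e p.2)) =
      (T 1 + Complex.I * T Complex.I) / 2 / e p.2 := by field_simp
    rw [this, div_eq_iff hne]
    simp only [he]
    linear_combination (-(T 1 + Complex.I * T Complex.I) / 2) * hcs +
      ((T 1) / 2 * (Real.sin p.2 : ℂ) ^ 2 - (T Complex.I) / 2 * (Real.sin p.2 : ℂ) * (Real.cos p.2 : ℂ)) *
        Complex.I_sq
  have eA : ∫ p in Ioi (0:ℝ) ×ˢ Ioo (-π) π, A p = 2 * π * K ζ := by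
    rw [Measure.volume_eq_prod, ← Measure.prod_restrict, integral_prod_symm _ (by
      rw [Measure.prod_restrict]; exact hAi)]
    have : ∀ θ, ∫ r in Ioi (0:ℝ), A (r, θ) = K ζ := by
      intro θ
      have hd : ∀ r ∈ Ici (0:ℝ), HasDerivAt (fun r : ℝ => - K (ζ - r * e θ)) (A (r, θ)) r := by
        intro r _
        have h1 : HasDerivAt (fun r : ℝ => ζ - r * e θ) (-(1 * e θ)) r := by
          have := ((Complex.ofRealCLM.hasDerivAt (x := r)).mul_const (e θ)).const_sub ζ
          simpa using this
        have h2 := ((hdiff (ζ - r * e θ)).hasFDerivAt.comp_hasDerivAt r h1).neg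
        refine h2.congr_deriv ?_
        rw [one_mul, map_neg, neg_neg]
      have hi : IntegrableOn (fun r => A (r, θ)) (Ioi 0) := by
        have hc : Continuous (fun r => A (r, θ)) := by fun_prop
        refine (hc.continuousOn.integrableOn_compact (isCompact_Icc (a := 0) (b := R))).of_forall_sdiff_eq_zero
          measurableSet_Ioi ?_
        intro r hr
        rw [hA]; simp only
        rw [(hfar _ _ _).1]
        · rfl
        · by_contra hn
          push Not at hn
          exact hr.2 ⟨le_of_lt hr.1, hn⟩
      have ht : Tendsto (fun r : ℝ => - K (ζ - r * e θ)) atTop (𝓝 0) := by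
        apply tendsto_const_nhds.congr'
        filter_upwards [eventually_gt_atTop R] with r hr
        rw [(hfar r θ hr).2, neg_zero]
      rw [integral_Ioi_of_hasDerivAt_of_tendsto' hd hi ht]
      simp
    simp only [this]
    rw [setIntegral_const]
    simp only [Measure.real, Real.volume_Ioo]
    rw [ENNReal.toReal_ofReal (by linarith [Real.pi_pos]), Complex.real_smul]
    push_cast; ring
  have eB : ∫ p in Ioi (0:ℝ) ×ˢ Ioo (-π) π, B p = 0 := by
    rw [Measure.volume_eq_prod, setIntegral_prod _ hBi]
    have : ∀ r ∈ Ioi (0:ℝ), ∫ θ in Ioo (-π) π, B (r, θ) = 0 := by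
      intro r hr
      have hr' : (0:ℝ) < r := hr
      have hd : ∀ θ ∈ uIcc (-π) π, HasDerivAt (fun θ : ℝ => K (ζ - r * e θ)) (-(r * B (r, θ))) θ := by
        intro θ _
        have h1 : HasDerivAt (fun θ : ℝ => ζ - r * e θ) (-(r * (Complex.I * e θ))) θ :=
          ((hed θ).const_mul (r:ℂ)).const_sub ζ
        have h2 := ((hdiff (ζ - r * e θ)).hasFDerivAt.comp_hasDerivAt θ h1)
        refine h2.congr_deriv ?_
        have h3 : -((r:ℂ) * (Complex.I * e θ)) = (-r) • (Complex.I * e θ) := by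
          rw [Complex.real_smul]; push_cast; ring
        rw [h3, map_smul, Complex.real_smul]; push_cast; ring
      have hi : IntervalIntegrable (fun θ => -(r * B (r, θ))) volume (-π) π := by
        apply Continuous.intervalIntegrable; fun_prop
      have := intervalIntegral.integral_eq_sub_of_hasDerivAt hd hi
      rw [intervalIntegral.integral_neg, intervalIntegral.integral_const_mul] at this
      have hz : e π = e (-π) := by simp [he]
      rw [hz, sub_self, neg_eq_zero, mul_eq_zero] at this
      have h3 : ∫ θ in (-π)..π, B (r, θ) = 0 := by
        rcases this with h' | h'
        · exact absurd h' (by exact_mod_cast hr'.ne')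
        · exact h'
      rw [← integral_Ioc_eq_integral_Ioo, ← intervalIntegral.integral_of_le (by linarith [Real.pi_pos]), h3]
    rw [setIntegral_congr_fun measurableSet_Ioi this]; simp
  rw [Cau, e1, integral_add (hAi.const_mul _) (hBi.const_mul _), integral_const_mul, integral_const_mul,
    eA, eB]
  have : (π:ℂ) ≠ 0 := by exact_mod_cast Real.pi_ne_zero
  field_simp
  ring

lemma dbar_nice {K : ℂ → ℂ} (hK : ContDiff ℝ 1 K) (hs : HasCompactSupport K) : Nice (dbar K) := by
  have hDc : Continuous (fderiv ℝ K) := hK.continuous_fderiv one_ne_zero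
  apply Nice.of_cont
  · unfold dbar
    exact ((hDc.clm_apply continuous_const).add
      ((hDc.clm_apply continuous_const).const_smul Complex.I)).div_const 2
  · refine (hs.fderiv (𝕜 := ℝ)).mono' ?_
    intro z hz
    by_contra hn
    have : fderiv ℝ K z = 0 := image_eq_zero_of_notMem_tsupport hn
    apply hz
    simp [dbar, this]

/-- product rule for the Cauchy transform -/
lemma cau_mul {K f : ℂ → ℂ} (hK : ContDiff ℝ 1 K) (hs : HasCompactSupport K) (hf : Nice f) (ζ : ℂ) :
    K ζ * Cau f ζ = Cau (fun z => K z * f z + dbar K z * Cau f z) ζ := by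
  have hD := dbar_nice hK hs
  have hKn := Nice.of_cont hK.continuous hs
  obtain ⟨AK, hAK⟩ := hKn.bdd
  have h1 : Nice (fun z => K z * f z) := hf.bmul hKn.meas hAK
  obtain ⟨AC, hAC⟩ := hf.cau_bdd
  have h2 : Nice (fun z => dbar K z * Cau f z) := by
    have := hD.bmul (cau_meas hf.meas) hAC
    simpa only [mul_comm] using this
  rw [cau_add h1 h2]
  obtain ⟨A, hA⟩ := hf.bdd
  obtain ⟨r, hr, hrs⟩ := hf.supp
  obtain ⟨A', hA'⟩ := hD.bdd
  obtain ⟨r', hr', hrs'⟩ := hD.supp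
  have hA0 : 0 ≤ A := (norm_nonneg _).trans (hA 0)
  have hfm := hf.meas
  have hDm := hD.meas
  have hprod : Integrable (fun p : ℂ × ℂ => dbar K p.1 / (ζ - p.1) * (f p.2 / (p.1 - p.2)))
      ((volume : Measure ℂ).prod volume) := by
    refine ⟨(by fun_prop : Measurable _).aestronglyMeasurable, ?_⟩
    unfold HasFiniteIntegral
    rw [lintegral_prod _ (by fun_prop)]
    simp only [enorm_mul]
    have : ∀ x, ∫⁻ y, ‖dbar K x / (ζ - x)‖ₑ * ‖f y / (x - y)‖ₑ ≤
        ‖dbar K x / (ζ - x)‖ₑ * ENNReal.ofReal (6 * π * r * A) := by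
      intro x
      rw [lintegral_const_mul _ (by fun_prop)]
      gcongr
      exact cau_lint hr hA hrs x
    refine (lintegral_mono this).trans_lt ?_
    rw [lintegral_mul_const _ (by fun_prop)]
    exact ENNReal.mul_lt_top ((cau_lint hr' hA' hrs' ζ).trans_lt (by simp)) (by simp)
  have e1 : Cau (fun z => dbar K z * Cau f z) ζ = (π : ℂ)⁻¹ * ((π : ℂ)⁻¹ *
      ∫ x, ∫ y, dbar K x / (ζ - x) * (f y / (x - y))) := by
    have e0 : ∫ x, dbar K x * Cau f x / (ζ - x) = (π : ℂ)⁻¹ *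
        ∫ x, ∫ y, dbar K x / (ζ - x) * (f y / (x - y)) := by
      rw [← integral_const_mul]
      refine integral_congr_ae (ae_of_all _ fun x => ?_)
      simp only
      rw [integral_const_mul, Cau]; ring
    rw [Cau, e0]
  have e2 : ∀ y, y ≠ ζ → ∫ x, dbar K x / (ζ - x) * (f y / (x - y)) =
      π * ((K ζ - K y) * (f y / (ζ - y))) := by
    intro y hy
    have hy' : ζ - y ≠ 0 := sub_ne_zero.2 hy.symm
    have h3 : (fun x => dbar K x / (ζ - x) * (f y / (x - y))) =ᵐ[volume]
        fun x => (f y / (ζ - y)) * (dbar K x / (ζ - x) - dbar K x / (y - x)) := by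
      have n1 : ∀ᵐ x : ℂ, x ≠ ζ := by rw [ae_iff]; simp
      have n2 : ∀ᵐ x : ℂ, x ≠ y := by rw [ae_iff]; simp
      filter_upwards [n1, n2] with x hx1 hx2
      have i1 : ζ - x ≠ 0 := sub_ne_zero.2 hx1.symm
      have i2 : y - x ≠ 0 := sub_ne_zero.2 hx2.symm
      have i3 : x - y ≠ 0 := sub_ne_zero.2 hx2
      have i4 : x - y = -(y - x) := by ring
      rw [i4]
      field_simp
      ring
    rw [integral_congr_ae h3, integral_const_mul, integral_sub (hD.int ζ) (hD.int y)]
    have p1 := pompeiu hK hs ζ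
    have p2 := pompeiu hK hs y
    have hpi : (π : ℂ) ≠ 0 := by exact_mod_cast Real.pi_ne_zero
    rw [Cau, inv_mul_eq_iff_eq_mul₀ hpi] at p1 p2
    rw [p1, p2]; ring
  rw [e1, integral_integral_swap hprod]
  have e3 : ∫ y, ∫ x, dbar K x / (ζ - x) * (f y / (x - y)) =
      ∫ y, π * (K ζ * (f y / (ζ - y)) - K y * f y / (ζ - y)) := by
    apply integral_congr_ae
    have n1 : ∀ᵐ x : ℂ, x ≠ ζ := by rw [ae_iff]; simp
    filter_upwards [n1] with y hy
    rw [e2 y hy]; ring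
  rw [e3, integral_const_mul, integral_sub ((hf.int ζ).const_mul _) (h1.int ζ), integral_const_mul]
  have hpi : (π : ℂ) ≠ 0 := by exact_mod_cast Real.pi_ne_zero
  simp only [Cau]
  field_simp
  ring

/-- scaled cut-offs -/
lemma bump_exists {α β : ℝ} (hα : 0 < α) (hαβ : α < β) : ∃ B : ℝ, 0 < B ∧ ∀ (a : ℂ) (R : ℝ), 0 < R →
    ∃ χ : ℂ → ℝ, ContDiff ℝ 1 χ ∧ (∀ z, 0 ≤ χ z) ∧ (∀ z, χ z ≤ 1) ∧
      (∀ z, dist z a ≤ α * R → χ z = 1) ∧ (∀ z, β * R ≤ dist z a → χ z = 0) ∧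
      (∀ z, ‖fderiv ℝ χ z‖ ≤ B / R) := by
  let b : ContDiffBump (0 : ℂ) := ⟨α, β, hα, hαβ⟩
  have hbs : ContDiff ℝ 1 (b : ℂ → ℝ) := b.contDiff
  obtain ⟨B, hB⟩ := (b.hasCompactSupport.fderiv (𝕜 := ℝ)).exists_bound_of_continuous
    (hbs.continuous_fderiv one_ne_zero)
  refine ⟨max B 1, by positivity, fun a R hR => ?_⟩
  have hlin : ∀ z, HasFDerivAt (fun z : ℂ => R⁻¹ • (z - a)) (R⁻¹ • ContinuousLinearMap.id ℝ ℂ) z := by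
    intro z
    exact ((hasFDerivAt_id z).sub_const a).const_smul R⁻¹
  have hnorm : ∀ z : ℂ, ‖R⁻¹ • (z - a)‖ = dist z a / R := by
    intro z
    rw [norm_smul, Real.norm_eq_abs, abs_of_pos (by positivity), dist_eq_norm, inv_mul_eq_div]
  refine ⟨fun z => b (R⁻¹ • (z - a)), hbs.comp ((contDiff_id.sub contDiff_const).const_smul R⁻¹),
    fun z => b.nonneg, fun z => b.le_one, fun z hz => ?_, fun z hz => ?_, fun z => ?_⟩
  · apply b.one_of_mem_closedBall
    rw [mem_closedBall, dist_zero_right, hnorm, div_le_iff₀ hR]; exact hz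
  · apply b.zero_of_le_dist
    rw [dist_zero_right, hnorm, le_div_iff₀ hR]; exact hz
  · have := ((hbs.differentiable one_ne_zero) (R⁻¹ • (z - a))).hasFDerivAt.comp z (hlin z)
    have e : fderiv ℝ (fun z => b (R⁻¹ • (z - a))) z = _ := this.fderiv
    rw [e, ContinuousLinearMap.comp_smul, norm_smul, Real.norm_eq_abs, abs_of_pos (by positivity),
      inv_mul_eq_div, ContinuousLinearMap.comp_id]
    gcongr
    exact (hB _).trans (le_max_left _ _)

/-- cutting off a holomorphic function -/
lemma cutK {α β B R R' : ℝ} {a : ℂ} {χ : ℂ → ℝ} {F : ℂ → ℂ} (hR : 0 < R) (hR' : β * R < R')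
    (hχ : ContDiff ℝ 1 χ) (h1 : ∀ z, dist z a ≤ α * R → χ z = 1) (h0 : ∀ z, β * R ≤ dist z a → χ z = 0)
    (hB : ∀ z, ‖fderiv ℝ χ z‖ ≤ B / R) (hF : DifferentiableOn ℂ F (ball a R')) :
    ContDiff ℝ 1 (fun z => (χ z : ℂ) * F z) ∧ HasCompactSupport (fun z => (χ z : ℂ) * F z) ∧
    (∀ z, dist z a < α * R → dbar (fun z => (χ z : ℂ) * F z) z = 0) ∧
    (∀ z, β * R < dist z a → dbar (fun z => (χ z : ℂ) * F z) z = 0) ∧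
    (∀ z, dist z a ≤ β * R → ‖dbar (fun z => (χ z : ℂ) * F z) z‖ ≤ B / R * ‖F z‖) := by
  have hχC : ContDiff ℝ 1 (fun z => (χ z : ℂ)) := Complex.ofRealCLM.contDiff.comp hχ
  have hz0 : ∀ z, β * R < dist z a → (fun z => (χ z : ℂ) * F z) =ᶠ[𝓝 z] fun _ => 0 := by
    intro z hz
    have : {w | β * R < dist w a} ∈ 𝓝 z := (isOpen_lt continuous_const (by fun_prop)).mem_nhds hz
    filter_upwards [this] with w hw
    rw [h0 w (le_of_lt hw)]; simp
  have hFd : ∀ z, dist z a < R' → DifferentiableAt ℂ F z := fun z hz =>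
    (hF z hz).differentiableAt (isOpen_ball.mem_nhds hz)
  have hFR : ∀ z, dist z a < R' → ContDiffAt ℝ 1 F z := by
    intro z hz
    have : ContDiffAt ℂ 1 F z := (hF.contDiffOn isOpen_ball).contDiffAt (isOpen_ball.mem_nhds hz)
    exact this.restrict_scalars ℝ
  have hz1 : ∀ z, dist z a < R' → dbar (fun z => (χ z : ℂ) * F z) z =
      ((fderiv ℝ χ z 1 : ℝ) + Complex.I * (fderiv ℝ χ z Complex.I : ℝ)) / 2 * F z := by
    intro z hz
    have d1 : HasFDerivAt (fun z => (χ z : ℂ)) (Complex.ofRealCLM.comp (fderiv ℝ χ z)) z :=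
      Complex.ofRealCLM.hasFDerivAt.comp z ((hχ.differentiable one_ne_zero) z).hasFDerivAt
    have d2 : HasFDerivAt F ((fderiv ℂ F z).restrictScalars ℝ) z := (hFd z hz).hasFDerivAt.restrictScalars ℝ
    have d3 := (d1.mul d2).fderiv
    have e3 : fderiv ℝ (fun z => (χ z : ℂ) * F z) z = _ := d3
    have e4 : fderiv ℂ F z Complex.I = Complex.I * fderiv ℂ F z 1 := by
      simp
    rw [dbar, e3]
    simp only [add_apply, smul_apply, ContinuousLinearMap.coe_restrictScalars', e4,
      ContinuousLinearMap.comp_apply, Complex.ofRealCLM_apply, smul_eq_mul]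
    ring_nf
    rw [Complex.I_sq]; ring
  refine ⟨?_, ?_, ?_, ?_, ?_⟩
  · rw [contDiff_iff_contDiffAt]
    intro z
    rcases lt_or_ge (dist z a) R' with hz | hz
    · exact hχC.contDiffAt.mul (hFR z hz)
    · exact contDiffAt_const.congr_of_eventuallyEq (hz0 z (hR'.trans_le hz))
  · refine HasCompactSupport.of_support_subset_isCompact (isCompact_closedBall a (β * R)) ?_
    intro w hw
    by_contra hn
    rw [mem_closedBall, not_le] at hn
    apply hw
    simp [h0 w hn.le]
  · intro z hz
    rcases lt_or_ge (dist z a) R' with hz' | hz'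
    · have hloc : χ =ᶠ[𝓝 z] fun _ => 1 := by
        have : {w | dist w a < α * R} ∈ 𝓝 z := (isOpen_lt (by fun_prop) continuous_const).mem_nhds hz
        filter_upwards [this] with w hw
        exact h1 w (le_of_lt hw)
      have : fderiv ℝ χ z = 0 := by rw [hloc.fderiv_eq]; simp
      rw [hz1 z hz', this]; simp
    · have := hz0 z (hR'.trans_le hz')
      simp [dbar, this.fderiv_eq]
  · intro z hz
    simp [dbar, (hz0 z hz).fderiv_eq]
  · intro z hz
    rw [hz1 z (hz.trans_lt hR'), norm_mul]
    gcongr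
    rw [norm_div, Complex.norm_ofNat, div_le_iff₀ two_pos]
    refine (norm_add_le _ _).trans ?_
    rw [norm_mul, Complex.norm_I, one_mul, Complex.norm_real, Complex.norm_real]
    have i1 := (fderiv ℝ χ z).le_opNorm 1
    have i2 := (fderiv ℝ χ z).le_opNorm Complex.I
    rw [norm_one, mul_one] at i1
    rw [Complex.norm_I, mul_one] at i2
    have := hB z
    linarith
end

noncomputable section

/-- polynomials against exponentials -/
lemma poly_exp (A a : ℝ) (ha : 0 < a) (N : ℕ) : ∃ m0 : ℝ, 1 ≤ m0 ∧ ∀ m, m0 ≤ m →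
    A * m ^ N * Real.exp (-(a * m)) ≤ 1 / 2 := by
  have h1 : Tendsto (fun m : ℝ => A * (m ^ N * Real.exp (-(a * m)))) atTop (𝓝 (A * 0)) := by
    apply Tendsto.const_mul
    have := Real.tendsto_pow_mul_exp_neg_atTop_nhds_zero N
    have h2 : Tendsto (fun m : ℝ => a * m) atTop atTop := tendsto_id.const_mul_atTop ha
    have h3 := (this.comp h2).const_mul (a ^ N)⁻¹
    rw [mul_zero] at h3
    refine h3.congr fun m => ?_
    simp only [Function.comp, mul_pow]
    have : a ^ N ≠ 0 := by positivity
    field_simp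
  rw [mul_zero] at h1
  have h2 := h1.eventually_le_const (show (0:ℝ) < 1 / 2 by norm_num)
  obtain ⟨m1, hm1⟩ := eventually_atTop.1 h2
  exact ⟨max 1 m1, le_max_left _ _, fun m hm => by
    rw [mul_assoc]; exact hm1 m ((le_max_right _ _).trans hm)⟩

namespace DGeo
variable {μ : Measure ℂ} {ρ : ℂ → ℝ} {φ : ℂ → ℝ}

set_option maxHeartbeats 2000000 in
lemma cell (h : DGeo μ ρ) (hφ : HasDoublingLaplacian φ μ) {t L : ℝ} (ht : 0 < t) (hL : 1 ≤ L) (M : ℕ)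
    (C0 : ℝ) (hC0 : 0 < C0) (M0 : ℕ) : ∃ K C : ℝ, 4 ≤ K ∧ 0 < C ∧ ∀ W : ℂ → ℝ, (∀ z, 0 ≤ W z) → PFlat ρ M L W →
      ∀ (z0 : ℂ) (f0 : ℂ → ℂ), Measurable f0 → (∀ ζ, ζ ∉ ball z0 (ρ z0) → f0 ζ = 0) →
      (∀ ζ, ‖f0 ζ‖ * ρ ζ ≤ W ζ * Real.exp (t * φ ζ)) →
      ∃ v e : ℂ → ℂ, Nice f0 ∧ Nice e ∧ (∀ ζ, v ζ = Cau f0 ζ + Cau e ζ) ∧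
        (∀ ζ, K * ρ z0 ≤ dist ζ z0 → v ζ = 0 ∧ e ζ = 0) ∧
        (∀ ζ, C0 * (1 + K) ^ M0 * (‖e ζ‖ * ρ ζ) ≤ 1 / 2 * (W ζ * Real.exp (t * φ ζ))) ∧
        (∀ ζ, ‖v ζ‖ ≤ C * (W ζ * Real.exp (t * φ ζ))) := by
  obtain ⟨c, η, C, hc, hη, hη2, hC, hloc⟩ := h.local_holo hφ
  obtain ⟨B, hB0, hbump⟩ := bump_exists (α := 1 - 3 * η) (β := 1 - 2 * η) (by linarith) (by linarith)
  obtain ⟨q, hq0, hq⟩ := h.rev_growth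
  obtain ⟨n, hn⟩ := h.growth
  obtain ⟨k1, C1, hC1, hk1⟩ := h.rho_poly
  obtain ⟨k2, C2, hC2, hk2⟩ := h.Dd_symm
  set P0 : ℝ := 6 * L * (2 * C2) ^ M * (C1 * 2 ^ k1) with hP0
  have hP0pos : 0 < P0 := by positivity
  obtain ⟨m0, hm0, hm0'⟩ := poly_exp (C0 * 2 * B * P0 * 5 ^ (M0 + k2 * M)) (t * c / 2) (by positivity)
    (q * (M0 + k2 * M))
  set K : ℝ := 4 * m0 ^ q with hK
  have hK4 : 4 ≤ K := by
    have := one_le_pow₀ hm0 (n := q)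
    linarith
  refine ⟨K, Real.exp (t * (C * (2 * K) ^ n)) * (P0 * (1 + K) ^ (k2 * M)), hK4, by positivity, ?_⟩
  intro W hW hWf z0 f0 hf0 hsupp hbd
  have hρ0 := h.rho_pos z0
  set R : ℝ := K * ρ z0 with hRdef
  have hR : 0 < R := by positivity
  have hRρ : ρ z0 ≤ R / 4 := by rw [hRdef]; nlinarith
  obtain ⟨F, hFd, hF1, hF2, hF3⟩ := hloc z0 R hR
  obtain ⟨χ, hχ, hχ0, hχ1, hχa, hχb, hχB⟩ := hbump z0 R hR
  set m : ℝ := μ.real (ball z0 R) with hm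
  have hm_up : m ≤ (2 * K) ^ n := by
    have := hn z0 (ρ z0) K hρ0 (by linarith)
    rwa [h.real_rho, mul_one] at this
  have hKm : K ≤ 4 * m ^ q := by
    have := hq z0 (ρ z0) K hρ0 (by linarith)
    rwa [h.real_rho, one_pow, mul_one] at this
  have hm_nn : 0 ≤ m := measureReal_nonneg
  have hmm0 : m0 ≤ m := by
    have : m0 ^ q ≤ m ^ q := by linarith
    exact (pow_le_pow_iff_left₀ (by linarith) hm_nn hq0.ne').1 this
  have hEd : DifferentiableOn ℂ (fun z => Complex.exp (t * F z)) (ball z0 ((1 - η) * R)) :=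
    (hFd.const_mul _).cexp
  have hβ : (1 - 2 * η) * R < (1 - η) * R := by nlinarith
  obtain ⟨hKc, hKs, hd1, hd2, hd3⟩ := cutK hR hβ hχ hχa hχb hχB hEd
  set Kf : ℂ → ℂ := fun z => (χ z : ℂ) * Complex.exp (t * F z) with hKf
  have hsub : ball z0 (ρ z0) ⊆ ball z0 (R / 4) := ball_subset_ball hRρ
  have hsub2 : ball z0 (R / 4) ⊆ ball z0 ((1 - η) * R) := ball_subset_ball (by nlinarith)
  -- the function f
  set f : ℂ → ℂ := fun z => f0 z * (ball z0 (ρ z0)).piecewise (fun z => Complex.exp (-(t * F z))) (fun _ => 0) z with hf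
  have hfm : Measurable f := by
    refine hf0.mul (ContinuousOn.measurable_piecewise ?_ continuousOn_const measurableSet_ball)
    exact ((hFd.const_mul _).neg.cexp.continuousOn.mono (hsub.trans hsub2))
  have hfs : ∀ w, w ∉ ball z0 (ρ z0) → f w = 0 := fun w hw => by simp [hf, hsupp w hw]
  have nexp : ∀ z, ‖Complex.exp (t * F z)‖ = Real.exp (t * (F z).re) := fun z => by
    rw [Complex.norm_exp]; simp
  have nexp' : ∀ z, ‖Complex.exp (-(t * F z))‖ = Real.exp (-(t * (F z).re)) := fun z => by
    rw [Complex.norm_exp]; simp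
  have hfb0 : ∀ w ∈ ball z0 (ρ z0), ‖f w‖ ≤ W w * (C1 * 2 ^ k1) / ρ z0 * Real.exp (-(t * c * m)) := by
    intro w hw
    have hρw := h.rho_pos w
    have e1 : ‖f w‖ = ‖f0 w‖ * Real.exp (-(t * (F w).re)) := by
      simp only [hf, Set.piecewise_eq_of_mem _ _ _ hw]; rw [norm_mul, nexp']
    have e2 : ‖f0 w‖ ≤ W w * Real.exp (t * φ w) / ρ w := by
      rw [le_div_iff₀ hρw]; exact hbd w
    have e3 : Real.exp (-(t * (F w).re)) ≤ Real.exp (-(t * φ w)) * Real.exp (-(t * c * m)) := by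
      rw [← Real.exp_add]; apply Real.exp_le_exp.2
      have := hF2 w (hsub hw)
      nlinarith
    have e4 : ρ z0 ≤ C1 * 2 ^ k1 * ρ w := by
      refine (hk1 z0 w).trans ?_
      gcongr
      · exact (h.Dd_pos _ _).le
      · unfold Dd
        have : dist z0 w / ρ z0 ≤ 1 := by
          rw [div_le_one hρ0, dist_comm]; exact (mem_ball.1 hw).le
        linarith
    have e5 : (ρ w)⁻¹ ≤ (C1 * 2 ^ k1) / ρ z0 := by
      rw [inv_le_iff_one_le_mul₀ hρw, div_mul_eq_mul_div, le_div_iff₀ hρ0, one_mul]; exact e4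
    rw [e1]
    calc _ ≤ (W w * Real.exp (t * φ w) / ρ w) * (Real.exp (-(t * φ w)) * Real.exp (-(t * c * m))) := by
          gcongr
          have := hW w
          positivity
      _ = W w * (ρ w)⁻¹ * Real.exp (-(t * c * m)) := by
          have : Real.exp (t * φ w) * Real.exp (-(t * φ w)) = 1 := by rw [← Real.exp_add]; simp
          rw [div_eq_mul_inv]
          linear_combination (W w * (ρ w)⁻¹ * Real.exp (-(t * c * m))) * this
      _ ≤ W w * ((C1 * 2 ^ k1) / ρ z0) * Real.exp (-(t * c * m)) := by
          gcongr
          exact hW w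
      _ = _ := by ring
  -- bound relative to a point
  have hfb : ∀ ζ, dist ζ z0 ≤ R → ∀ w, ‖f w‖ ≤ P0 / 6 * (1 + K) ^ (k2 * M) * W ζ / ρ z0 * Real.exp (-(t * c * m)) := by
    intro ζ hζ w
    have hWζ := hW ζ
    by_cases hw : w ∈ ball z0 (ρ z0)
    swap
    · rw [hfs w hw, norm_zero]; positivity
    refine (hfb0 w hw).trans ?_
    have d1 : Dd ρ z0 ζ ≤ 1 + K := by
      unfold Dd
      have : dist z0 ζ / ρ z0 ≤ K := by
        rw [div_le_iff₀ hρ0, dist_comm]; exact hζ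
      linarith
    have d2 : Dd ρ z0 w ≤ 2 := by
      unfold Dd
      have : dist z0 w / ρ z0 ≤ 1 := by
        rw [div_le_one hρ0, dist_comm]; exact (mem_ball.1 hw).le
      linarith
    have d0 := h.Dd_pos z0 ζ
    have d0' := h.Dd_pos z0 w
    have d3 : Dd ρ ζ w ≤ 2 * C2 * (1 + K) ^ k2 := by
      calc _ ≤ Dd ρ ζ z0 * Dd ρ z0 w := h.Dd_tri _ _ _
        _ ≤ (C2 * Dd ρ z0 ζ ^ k2) * 2 := by
          have := h.Dd_pos ζ z0
          gcongr
          exact hk2 _ _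
        _ ≤ (C2 * (1 + K) ^ k2) * 2 := by gcongr
        _ = _ := by ring
    have d4 : W w ≤ L * (2 * C2 * (1 + K) ^ k2) ^ M * W ζ := by
      refine (hWf ζ w).trans ?_
      have := h.Dd_pos ζ w
      gcongr
    calc _ ≤ (L * (2 * C2 * (1 + K) ^ k2) ^ M * W ζ) * (C1 * 2 ^ k1) / ρ z0 * Real.exp (-(t * c * m)) := by
          gcongr
      _ = _ := by rw [hP0, mul_pow (2 * C2), ← pow_mul]; ring
  have hCau : ∀ ζ, dist ζ z0 ≤ R → ‖Cau f ζ‖ ≤ P0 * (1 + K) ^ (k2 * M) * W ζ * Real.exp (-(t * c * m)) := by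
    intro ζ hζ
    refine (cau_bound hρ0 (hfb ζ hζ) hfs ζ).trans (le_of_eq ?_)
    field_simp
  have hfN : Nice f := by
    refine ⟨hfm, ⟨_, hfb z0 (by simp [hR.le])⟩, ‖z0‖ + ρ z0, by positivity, fun w hw => hfs w fun hw' => hw ?_⟩
    rw [mem_ball] at hw' ⊢
    have := dist_triangle w z0 0
    rw [dist_zero_right z0] at this
    linarith
  have hKN := Nice.of_cont hKc.continuous hKs
  obtain ⟨AK, hAK⟩ := hKN.bdd
  have hKff : (fun z => Kf z * f z) = f0 := by
    ext w
    by_cases hw : w ∈ ball z0 (ρ z0)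
    · simp only [hf, hKf, Set.piecewise_eq_of_mem _ _ _ hw]
      have : χ w = 1 := hχa w (by
        have := hsub hw; rw [mem_ball] at this
        nlinarith)
      rw [this, Complex.exp_neg]
      have := Complex.exp_ne_zero (t * F w)
      push_cast
      field_simp
    · rw [hfs w hw, hsupp w hw, mul_zero]
  have hf0N : Nice f0 := by rw [← hKff]; exact hfN.bmul hKN.meas hAK
  obtain ⟨AC, hAC⟩ := hfN.cau_bdd
  have heN : Nice (fun z => dbar Kf z * Cau f z) := by
    have := (dbar_nice hKc hKs).bmul (cau_meas hfN.meas) hAC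
    simpa only [mul_comm] using this
  refine ⟨fun ζ => Kf ζ * Cau f ζ, fun z => dbar Kf z * Cau f z, hf0N, heN, ?_, ?_, ?_, ?_⟩
  · intro ζ
    beta_reduce
    have e1 := cau_mul hKc hKs hfN ζ
    have e2 : (fun z => Kf z * f z + dbar Kf z * Cau f z) = fun z => f0 z + dbar Kf z * Cau f z := by
      ext z; rw [← hKff]
    rw [e2] at e1
    rw [e1, cau_add hf0N heN]
  · intro ζ hζ
    constructor
    · have : χ ζ = 0 := hχb ζ (by nlinarith)
      simp [hKf, this]
    · have : dbar Kf ζ = 0 := hd2 ζ (by nlinarith)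
      simp only [this, zero_mul]
  · intro ζ
    beta_reduce
    have hWζ := hW ζ
    have hpos : 0 ≤ 1 / 2 * (W ζ * Real.exp (t * φ ζ)) := by positivity
    by_cases hζ1 : dist ζ z0 < (1 - 3 * η) * R
    · rw [hd1 ζ hζ1]; simpa using hpos
    by_cases hζ2 : (1 - 2 * η) * R < dist ζ z0
    · rw [hd2 ζ hζ2]; simpa using hpos
    push Not at hζ1 hζ2
    have hζR : dist ζ z0 ≤ R := by nlinarith
    have hζb : ζ ∈ ball z0 ((1 - η) * R) := by rw [mem_ball]; linarith
    have b1 := hd3 ζ hζ2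
    rw [nexp] at b1
    have b2 : Real.exp (t * (F ζ).re) ≤ Real.exp (t * φ ζ) * Real.exp (t * c * m / 2) := by
      rw [← Real.exp_add]; apply Real.exp_le_exp.2
      have := hF3 ζ hζb hζ1
      nlinarith
    have b3 := hCau ζ hζR
    have b4 : ρ ζ ≤ ρ z0 * (1 + K) := by
      refine (h.rho_le z0 ζ).trans ?_
      gcongr
      unfold Dd
      have : dist z0 ζ / ρ z0 ≤ K := by
        rw [div_le_iff₀ hρ0, dist_comm]; exact hζR
      linarith
    have hρζ := h.rho_pos ζ
    rw [norm_mul]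
    have ee : Real.exp (t * c * m / 2) * Real.exp (-(t * c * m)) = Real.exp (-(t * c / 2 * m)) := by
      rw [← Real.exp_add]; congr 1; ring
    have b5 : ‖dbar Kf ζ‖ * ‖Cau f ζ‖ * ρ ζ ≤
        2 * B * (P0 * (1 + K) ^ (k2 * M) * W ζ) * Real.exp (t * φ ζ) * Real.exp (-(t * c / 2 * m)) := by
      calc _ ≤ (B / R * (Real.exp (t * φ ζ) * Real.exp (t * c * m / 2))) *
            (P0 * (1 + K) ^ (k2 * M) * W ζ * Real.exp (-(t * c * m))) * (ρ z0 * (1 + K)) := by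
            have : ‖dbar Kf ζ‖ ≤ B / R * (Real.exp (t * φ ζ) * Real.exp (t * c * m / 2)) :=
              b1.trans (by gcongr)
            gcongr
        _ = B * ((1 + K) / K) * (P0 * (1 + K) ^ (k2 * M) * W ζ) * Real.exp (t * φ ζ) *
            (Real.exp (t * c * m / 2) * Real.exp (-(t * c * m))) := by
            rw [hRdef]; field_simp
        _ ≤ B * 2 * (P0 * (1 + K) ^ (k2 * M) * W ζ) * Real.exp (t * φ ζ) * Real.exp (-(t * c / 2 * m)) := by
            rw [ee]
            gcongr
            rw [div_le_iff₀ (by linarith)]; linarith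
        _ = _ := by ring
    have b6 : (1 + K) ^ (M0 + k2 * M) ≤ 5 ^ (M0 + k2 * M) * m ^ (q * (M0 + k2 * M)) := by
      rw [pow_mul, ← mul_pow]
      gcongr
      have : 1 ≤ m ^ q := one_le_pow₀ (hm0.trans hmm0)
      linarith
    calc _ ≤ C0 * (1 + K) ^ M0 * (2 * B * (P0 * (1 + K) ^ (k2 * M) * W ζ) * Real.exp (t * φ ζ) *
          Real.exp (-(t * c / 2 * m))) := by gcongr
      _ = (C0 * 2 * B * P0 * (1 + K) ^ (M0 + k2 * M) * Real.exp (-(t * c / 2 * m))) *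
          (W ζ * Real.exp (t * φ ζ)) := by rw [pow_add]; ring
      _ ≤ (C0 * 2 * B * P0 * (5 ^ (M0 + k2 * M) * m ^ (q * (M0 + k2 * M))) * Real.exp (-(t * c / 2 * m))) *
          (W ζ * Real.exp (t * φ ζ)) := by gcongr
      _ ≤ 1 / 2 * (W ζ * Real.exp (t * φ ζ)) := by
          gcongr
          refine le_trans (le_of_eq ?_) (hm0' m hmm0)
          ring
  · intro ζ
    beta_reduce
    have hWζ := hW ζ
    by_cases hζ2 : (1 - 2 * η) * R ≤ dist ζ z0
    · have : χ ζ = 0 := hχb ζ hζ2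
      simp only [hKf, this, Complex.ofReal_zero, zero_mul, norm_zero]; positivity
    push Not at hζ2
    have hζR : dist ζ z0 ≤ R := by nlinarith
    have hζb : ζ ∈ ball z0 ((1 - η) * R) := by rw [mem_ball]; linarith
    have b3 := hCau ζ hζR
    have b2 : ‖Kf ζ‖ ≤ Real.exp (t * φ ζ) * Real.exp (t * (C * (2 * K) ^ n)) := by
      simp only [hKf]
      rw [norm_mul, nexp, Complex.norm_real, Real.norm_eq_abs, abs_of_nonneg (hχ0 ζ), ← Real.exp_add]
      have e1 : Real.exp (t * (F ζ).re) ≤ Real.exp (t * φ ζ + t * (C * (2 * K) ^ n)) := by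
        apply Real.exp_le_exp.2
        have := (hF1 ζ hζb).2
        have : (F ζ).re ≤ φ ζ + C * (2 * K) ^ n := this.trans (by gcongr)
        nlinarith
      calc _ ≤ 1 * Real.exp (t * (F ζ).re) := by gcongr; exact hχ1 ζ
        _ ≤ _ := by rw [one_mul]; exact e1
    rw [norm_mul]
    have b4 : ‖Cau f ζ‖ ≤ P0 * (1 + K) ^ (k2 * M) * W ζ := by
      refine b3.trans (mul_le_of_le_one_right (by positivity) ?_)
      apply Real.exp_le_one_iff.2
      have : 0 ≤ t * c * m := by positivity
      linarith
    calc _ ≤ (Real.exp (t * φ ζ) * Real.exp (t * (C * (2 * K) ^ n))) * (P0 * (1 + K) ^ (k2 * M) * W ζ) := by gcongr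
      _ = _ := by ring

end DGeo
end

noncomputable section

namespace DGeo
variable {μ : Measure ℂ} {ρ : ℂ → ℝ} {φ : ℂ → ℝ}

lemma exists_net (h : DGeo μ ρ) : ∃ S : Set ℂ, RhoSeparated ρ S ∧ ∀ ζ, ∃ z ∈ S, dist ζ z < ρ z := by
  obtain ⟨S, hS⟩ := zorn_subset {S : Set ℂ | ∀ l ∈ S, ∀ l' ∈ S, l ≠ l' → 1 / 2 * max (ρ l) (ρ l') ≤ dist l l'} (by
    intro c hc hch
    refine ⟨⋃₀ c, ?_, fun s hs => subset_sUnion_of_mem hs⟩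
    rintro l ⟨s, hs, hl⟩ l' ⟨s', hs', hl'⟩ hne
    rcases hch.total hs hs' with h1 | h1
    · exact hc hs' l (h1 hl) l' hl' hne
    · exact hc hs l hl l' (h1 hl') hne)
  refine ⟨S, ⟨1 / 2, by norm_num, hS.prop⟩, fun ζ => ?_⟩
  have hζ := h.rho_pos ζ
  by_cases hm : ζ ∈ S
  · exact ⟨ζ, hm, by simpa using hζ⟩
  by_contra! hcon
  have key : ∀ z ∈ S, 1 / 2 * max (ρ ζ) (ρ z) ≤ dist ζ z := by
    intro z hz
    by_contra! hlt
    have h1 := hcon z hz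
    have h2 := h.rho_pos z
    have h3 := h.rho_lip ζ z
    rcases le_total (ρ ζ) (ρ z) with h4 | h4
    · rw [max_eq_right h4] at hlt; linarith
    · rw [max_eq_left h4] at hlt; linarith
  have : insert ζ S ∈ {S : Set ℂ | ∀ l ∈ S, ∀ l' ∈ S, l ≠ l' → 1 / 2 * max (ρ l) (ρ l') ≤ dist l l'} := by
    intro l hl l' hl' hne
    rcases hl with rfl | hl <;> rcases hl' with rfl | hl'
    · exact absurd rfl hne
    · exact key _ hl'
    · rw [dist_comm, max_comm]; exact key _ hl
    · exact hS.prop l hl l' hl' hne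
  exact hm (hS.le_of_ge this (subset_insert _ _) (mem_insert _ _))

lemma sum_le_of_tsum {S : Set ℂ} {C : ℝ} (hC : 0 ≤ C) {G : ℂ → ℝ} (hG : ∀ z, 0 ≤ G z)
    (hs : ∑' l : S, ENNReal.ofReal (G l.1) ≤ ENNReal.ofReal C) (J : Finset ℂ) (hJ : ∀ j ∈ J, j ∈ S) :
    ∑ j ∈ J, G j ≤ C := by
  rw [tsum_subtype S (fun l => ENNReal.ofReal (G l))] at hs
  have h1 := (ENNReal.sum_le_tsum (f := S.indicator fun l => ENNReal.ofReal (G l)) J).trans hs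
  rw [Finset.sum_congr rfl (fun j hj => Set.indicator_of_mem (hJ j hj) _),
    ← ENNReal.ofReal_sum_of_nonneg (fun j _ => hG j)] at h1
  exact (ENNReal.ofReal_le_ofReal_iff hC).1 h1

set_option maxHeartbeats 2000000 in
lemma dbar_step (h : DGeo μ ρ) (hφ : HasDoublingLaplacian φ μ) {t L : ℝ} (ht : 0 < t) (hL : 1 ≤ L) (M : ℕ) :
    ∃ C : ℝ, 0 < C ∧ ∀ W : ℂ → ℝ, (∀ z, 0 ≤ W z) → PFlat ρ M L W →
      ∀ (g : ℂ → ℂ), Measurable g → (∃ r, ∀ ζ, ζ ∉ closedBall (0:ℂ) r → g ζ = 0) →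
      (∀ ζ, ‖g ζ‖ * ρ ζ ≤ W ζ * Real.exp (t * φ ζ)) →
      ∃ v g' : ℂ → ℂ, Nice g ∧ Nice g' ∧ (∀ ζ, v ζ = Cau g ζ - Cau g' ζ) ∧
        (∀ ζ, ‖g' ζ‖ * ρ ζ ≤ 1 / 2 * W ζ * Real.exp (t * φ ζ)) ∧
        (∀ ζ, ‖v ζ‖ ≤ C * W ζ * Real.exp (t * φ ζ)) := by
  obtain ⟨S, hS, hcov⟩ := h.exists_net
  obtain ⟨M0, C0, hC0, hM0⟩ := h.sep_Dd' hS
  obtain ⟨K, C, hK, hC, hcell⟩ := h.cell hφ ht hL M C0 hC0 M0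
  refine ⟨C * (1 + K) ^ M0 * C0, by positivity, ?_⟩
  intro W hW hWf g hg ⟨r, hr⟩ hbd
  obtain ⟨J0, hJ0S, hJ0f, hJ0c⟩ := (isCompact_closedBall (0:ℂ) r).elim_finite_subcover_image
    (b := S) (c := fun j => ball j (ρ j)) (fun j _ => isOpen_ball)
    (fun ζ _ => by
      obtain ⟨z, hz, hd⟩ := hcov ζ
      exact mem_iUnion₂.2 ⟨z, hz, hd⟩)
  set J : Finset ℂ := hJ0f.toFinset with hJ
  have hJS : ∀ j ∈ J, j ∈ S := fun j hj => hJ0S (hJ0f.mem_toFinset.1 hj)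
  set ind : ℂ → ℂ → ℝ := fun j => (ball j (ρ j)).indicator (fun _ => (1:ℝ)) with hind
  have hind0 : ∀ j ζ, 0 ≤ ind j ζ := fun j ζ => Set.indicator_nonneg (fun _ _ => zero_le_one) _
  have hindm : ∀ j, Measurable (ind j) := fun j => measurable_const.indicator measurableSet_ball
  set N : ℂ → ℝ := fun ζ => ∑ j ∈ J, ind j ζ with hN
  have hNm : Measurable N := Finset.measurable_sum _ (fun j _ => hindm j)
  have hindN : ∀ j ∈ J, ∀ ζ, ind j ζ ≤ N ζ := fun j hj ζ =>
    Finset.single_le_sum (f := fun j => ind j ζ) (fun i _ => hind0 i ζ) hj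
  have hN0 : ∀ ζ, 0 ≤ N ζ := fun ζ => Finset.sum_nonneg fun i _ => hind0 i ζ
  set f : ℂ → ℂ → ℂ := fun j ζ => g ζ * ((ind j ζ / N ζ : ℝ) : ℂ) with hf
  have hfm : ∀ j, Measurable (f j) := fun j =>
    hg.mul (Complex.measurable_ofReal.comp ((hindm j).div hNm))
  have hfle : ∀ j ∈ J, ∀ ζ, ‖f j ζ‖ ≤ ‖g ζ‖ := by
    intro j hj ζ
    simp only [hf]
    rw [norm_mul, Complex.norm_real, Real.norm_eq_abs, abs_of_nonneg (div_nonneg (hind0 j ζ) (hN0 ζ))]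
    exact mul_le_of_le_one_right (norm_nonneg _) (div_le_one_of_le₀ (hindN j hj ζ) (hN0 ζ))
  have hfsum : ∀ ζ, ∑ j ∈ J, f j ζ = g ζ := by
    intro ζ
    by_cases hζ : ζ ∈ closedBall (0:ℂ) r
    · obtain ⟨j, hj, hjb⟩ := mem_iUnion₂.1 (hJ0c hζ)
      have h1 : ind j ζ = 1 := Set.indicator_of_mem hjb _
      have h2 : 0 < N ζ := by
        have := hindN j (hJ0f.mem_toFinset.2 hj) ζ
        linarith
      simp only [hf]
      rw [← Finset.mul_sum, ← Complex.ofReal_sum, ← Finset.sum_div, div_self h2.ne']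
      simp
    · simp [hf, hr ζ hζ]
  have hex : ∀ j ∈ J, ∃ v e : ℂ → ℂ, Nice (f j) ∧ Nice e ∧ (∀ ζ, v ζ = Cau (f j) ζ + Cau e ζ) ∧
        (∀ ζ, K * ρ j ≤ dist ζ j → v ζ = 0 ∧ e ζ = 0) ∧
        (∀ ζ, C0 * (1 + K) ^ M0 * (‖e ζ‖ * ρ ζ) ≤ 1 / 2 * (W ζ * Real.exp (t * φ ζ))) ∧
        (∀ ζ, ‖v ζ‖ ≤ C * (W ζ * Real.exp (t * φ ζ))) := by
    intro j hj
    refine hcell W hW hWf j (f j) (hfm j) (fun ζ hζ => ?_) (fun ζ => ?_)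
    · simp [hf, hind, Set.indicator_of_notMem hζ]
    · refine le_trans ?_ (hbd ζ)
      exact mul_le_mul_of_nonneg_right (hfle j hj ζ) (h.rho_pos ζ).le
  have hex' : ∀ j : ℂ, ∃ p : (ℂ → ℂ) × (ℂ → ℂ), j ∈ J → Nice (f j) ∧ Nice p.2 ∧ (∀ ζ, p.1 ζ = Cau (f j) ζ + Cau p.2 ζ) ∧
        (∀ ζ, K * ρ j ≤ dist ζ j → p.1 ζ = 0 ∧ p.2 ζ = 0) ∧
        (∀ ζ, C0 * (1 + K) ^ M0 * (‖p.2 ζ‖ * ρ ζ) ≤ 1 / 2 * (W ζ * Real.exp (t * φ ζ))) ∧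
        (∀ ζ, ‖p.1 ζ‖ ≤ C * (W ζ * Real.exp (t * φ ζ))) := by
    intro j
    by_cases hj : j ∈ J
    · obtain ⟨v, e, hh⟩ := hex j hj
      exact ⟨(v, e), fun _ => hh⟩
    · exact ⟨(0, 0), fun hj' => absurd hj' hj⟩
  choose p hp using hex'
  set v : ℂ → ℂ → ℂ := fun j => (p j).1 with hvdef
  set e : ℂ → ℂ → ℂ := fun j => (p j).2 with hedef
  have hfN : ∀ j ∈ J, Nice (f j) := fun j hj => (hp j hj).1
  have heN : ∀ j ∈ J, Nice (e j) := fun j hj => (hp j hj).2.1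
  have hve : ∀ j ∈ J, ∀ ζ, v j ζ = Cau (f j) ζ + Cau (e j) ζ := fun j hj => (hp j hj).2.2.1
  have h0 : ∀ j ∈ J, ∀ ζ, K * ρ j ≤ dist ζ j → v j ζ = 0 ∧ e j ζ = 0 := fun j hj => (hp j hj).2.2.2.1
  have he : ∀ j ∈ J, ∀ ζ, C0 * (1 + K) ^ M0 * (‖e j ζ‖ * ρ ζ) ≤ 1 / 2 * (W ζ * Real.exp (t * φ ζ)) :=
    fun j hj => (hp j hj).2.2.2.2.1
  have hv : ∀ j ∈ J, ∀ ζ, ‖v j ζ‖ ≤ C * (W ζ * Real.exp (t * φ ζ)) := fun j hj => (hp j hj).2.2.2.2.2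
  clear_value v e
  have hgN : Nice g := by
    have := Nice.sum J hfN
    have e1 : (fun z => ∑ j ∈ J, f j z) = g := funext hfsum
    rwa [e1] at this
  have heNs := Nice.sum J heN
  have hcauG : ∀ ζ, Cau g ζ = ∑ j ∈ J, Cau (f j) ζ := by
    intro ζ
    rw [← cau_sum J hfN]
    congr 1
    exact (funext hfsum).symm
  have hDs : ∀ ζ, ∑ j ∈ J, (Dd ρ j ζ ^ M0)⁻¹ ≤ C0 := fun ζ =>
    sum_le_of_tsum (G := fun l => (Dd ρ l ζ ^ M0)⁻¹) hC0.le (fun z => inv_nonneg.2 (pow_nonneg (h.Dd_pos _ _).le _)) (hM0 ζ) J hJS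
  have hDK : ∀ j ζ, dist ζ j < K * ρ j → 1 ≤ (1 + K) ^ M0 * (Dd ρ j ζ ^ M0)⁻¹ := by
    intro j ζ hd
    have hp := h.Dd_pos j ζ
    rw [← div_eq_mul_inv, one_le_div (by positivity)]
    gcongr
    unfold Dd
    have : dist j ζ / ρ j ≤ K := by
      rw [div_le_iff₀ (h.rho_pos j), dist_comm]; exact hd.le
    linarith
  have hDn : ∀ j ζ, 0 ≤ (Dd ρ j ζ ^ M0)⁻¹ := fun j ζ => inv_nonneg.2 (pow_nonneg (h.Dd_pos _ _).le _)
  refine ⟨fun ζ => ∑ j ∈ J, v j ζ, fun ζ => - ∑ j ∈ J, e j ζ, hgN, heNs.neg, ?_, ?_, ?_⟩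
  · intro ζ
    rw [cau_neg, cau_sum J heN, hcauG, sub_neg_eq_add, ← Finset.sum_add_distrib]
    exact Finset.sum_congr rfl fun j hj => hve j hj ζ
  · intro ζ
    have hρ := h.rho_pos ζ
    set X := W ζ * Real.exp (t * φ ζ) with hX
    have hX0 : 0 ≤ X := mul_nonneg (hW ζ) (Real.exp_pos _).le
    have key : ∀ j ∈ J, C0 * (‖e j ζ‖ * ρ ζ) ≤ (1 / 2 * X) * (Dd ρ j ζ ^ M0)⁻¹ := by
      intro j hj
      by_cases hd : K * ρ j ≤ dist ζ j
      · rw [(h0 j hj ζ hd).2, norm_zero, zero_mul, mul_zero]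
        exact mul_nonneg (by positivity) (hDn j ζ)
      · push Not at hd
        have h1 := hDK j ζ hd
        have h2 := he j hj ζ
        have h3 : 0 ≤ C0 * (‖e j ζ‖ * ρ ζ) := by positivity
        calc _ ≤ C0 * (‖e j ζ‖ * ρ ζ) * ((1 + K) ^ M0 * (Dd ρ j ζ ^ M0)⁻¹) := le_mul_of_one_le_right h3 h1
          _ = (C0 * (1 + K) ^ M0 * (‖e j ζ‖ * ρ ζ)) * (Dd ρ j ζ ^ M0)⁻¹ := by ring
          _ ≤ _ := mul_le_mul_of_nonneg_right h2 (hDn j ζ)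
    have h4 : C0 * (‖∑ j ∈ J, e j ζ‖ * ρ ζ) ≤ C0 * (1 / 2 * X) := by
      calc _ ≤ C0 * ((∑ j ∈ J, ‖e j ζ‖) * ρ ζ) := by
            gcongr; exact norm_sum_le _ _
        _ = ∑ j ∈ J, C0 * (‖e j ζ‖ * ρ ζ) := by rw [Finset.sum_mul, Finset.mul_sum]
        _ ≤ ∑ j ∈ J, (1 / 2 * X) * (Dd ρ j ζ ^ M0)⁻¹ := Finset.sum_le_sum key
        _ = (1 / 2 * X) * ∑ j ∈ J, (Dd ρ j ζ ^ M0)⁻¹ := by rw [Finset.mul_sum]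
        _ ≤ (1 / 2 * X) * C0 := mul_le_mul_of_nonneg_left (hDs ζ) (by positivity)
        _ = _ := by ring
    rw [norm_neg, mul_assoc (1 / 2 : ℝ)]
    exact le_of_mul_le_mul_left h4 hC0
  · intro ζ
    set X := W ζ * Real.exp (t * φ ζ) with hX
    have hX0 : 0 ≤ X := mul_nonneg (hW ζ) (Real.exp_pos _).le
    have key : ∀ j ∈ J, ‖v j ζ‖ ≤ (C * (1 + K) ^ M0 * X) * (Dd ρ j ζ ^ M0)⁻¹ := by
      intro j hj
      by_cases hd : K * ρ j ≤ dist ζ j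
      · rw [(h0 j hj ζ hd).1, norm_zero]
        exact mul_nonneg (by positivity) (hDn j ζ)
      · push Not at hd
        have h1 := hDK j ζ hd
        calc _ ≤ C * X * ((1 + K) ^ M0 * (Dd ρ j ζ ^ M0)⁻¹) :=
              (hv j hj ζ).trans (le_mul_of_one_le_right (by positivity) h1)
          _ = _ := by ring
    calc _ ≤ ∑ j ∈ J, ‖v j ζ‖ := norm_sum_le _ _
      _ ≤ ∑ j ∈ J, (C * (1 + K) ^ M0 * X) * (Dd ρ j ζ ^ M0)⁻¹ := Finset.sum_le_sum key
      _ = (C * (1 + K) ^ M0 * X) * ∑ j ∈ J, (Dd ρ j ζ ^ M0)⁻¹ := by rw [Finset.mul_sum]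
      _ ≤ (C * (1 + K) ^ M0 * X) * C0 := mul_le_mul_of_nonneg_left (hDs ζ) (by positivity)
      _ = _ := by rw [hX]; ring

end DGeo
end

noncomputable section

namespace DGeo
variable {μ : Measure ℂ} {ρ : ℂ → ℝ} {φ : ℂ → ℝ}

lemma flat_bdd (h : DGeo μ ρ) (hφ : Continuous φ) {t L : ℝ} {M : ℕ} {W : ℂ → ℝ} 
    (hWf : PFlat ρ M L W) (r : ℝ) : ∃ A, 0 ≤ A ∧ ∀ ζ ∈ ball (0:ℂ) r, 
      W ζ * Real.exp (t * φ ζ) ≤ A ∧ W ζ * Real.exp (t * φ ζ) / ρ ζ ≤ A := by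
  have hc1 : Continuous fun ζ => (L * Dd ρ 0 ζ ^ M * W 0) * Real.exp (t * φ ζ) := by
    have := h.Dd_cont 0
    fun_prop
  have hc2 : Continuous fun ζ => (L * Dd ρ 0 ζ ^ M * W 0) * Real.exp (t * φ ζ) / ρ ζ := 
    hc1.div h.rho_cont (fun z => (h.rho_pos z).ne')
  obtain ⟨A1, hA1⟩ := ((isCompact_closedBall (0:ℂ) r).image hc1).bddAbove
  obtain ⟨A2, hA2⟩ := ((isCompact_closedBall (0:ℂ) r).image hc2).bddAbove
  refine ⟨max 0 (max A1 A2), le_max_left _ _, fun ζ hζ => ?_⟩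
  have e0 := mul_le_mul_of_nonneg_right (hWf 0 ζ) (Real.exp_pos (t * φ ζ)).le
  have e1 := hA1 (mem_image_of_mem _ (ball_subset_closedBall hζ))
  have e2 := hA2 (mem_image_of_mem _ (ball_subset_closedBall hζ))
  constructor
  · exact e0.trans (e1.trans ((le_max_left _ _).trans (le_max_right _ _)))
  · refine le_trans ?_ (e2.trans ((le_max_right _ _).trans (le_max_right _ _)))
    exact div_le_div_of_nonneg_right e0 (h.rho_pos ζ).le

theorem dbar_solve (h : DGeo μ ρ) (hφ : HasDoublingLaplacian φ μ) {t L : ℝ} (ht : 0 < t) (hL : 1 ≤ L) (M : ℕ) :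
    ∃ C : ℝ, 0 < C ∧ ∀ W : ℂ → ℝ, (∀ z, 0 ≤ W z) → PFlat ρ M L W →
      ∀ (g : ℂ → ℂ), Measurable g → (∃ r, ∀ ζ, ζ ∉ closedBall (0:ℂ) r → g ζ = 0) →
      (∀ ζ, ‖g ζ‖ * ρ ζ ≤ W ζ * Real.exp (t * φ ζ)) →
      ∃ H : ℂ → ℂ, Differentiable ℂ H ∧ Nice g ∧ 
        (∀ ζ, ‖Cau g ζ - H ζ‖ ≤ C * W ζ * Real.exp (t * φ ζ)) := by
  obtain ⟨C, hC, hstep⟩ := h.dbar_step hφ ht hL M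
  refine ⟨2 * C, by positivity, ?_⟩
  intro W hW hWf g hg hr hbd
  have hNs : ∀ f : ℂ → ℂ, Nice f → ∃ r, ∀ ζ, ζ ∉ closedBall (0:ℂ) r → f ζ = 0 := by
    intro f hf
    obtain ⟨r, -, hr⟩ := hf.supp
    exact ⟨r, fun ζ hζ => hr ζ fun h' => hζ (ball_subset_closedBall h')⟩
  have hgN : Nice g := by
    obtain ⟨v, g', hh, -⟩ := hstep W hW hWf g hg hr hbd
    exact hh
  have hnext : ∀ (n : ℕ) (f : ℂ → ℂ), ∃ f' : ℂ → ℂ, 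
      (Nice f ∧ ∀ ζ, ‖f ζ‖ * ρ ζ ≤ (1/2)^n * W ζ * Real.exp (t * φ ζ)) → 
      ((Nice f' ∧ ∀ ζ, ‖f' ζ‖ * ρ ζ ≤ (1/2)^(n+1) * W ζ * Real.exp (t * φ ζ)) ∧ 
        ∀ ζ, ‖Cau f ζ - Cau f' ζ‖ ≤ C * ((1/2)^n * W ζ) * Real.exp (t * φ ζ)) := by
    intro n f
    by_cases hf : Nice f ∧ ∀ ζ, ‖f ζ‖ * ρ ζ ≤ (1/2)^n * W ζ * Real.exp (t * φ ζ)
    · obtain ⟨v, g', -, hg', hv, hb, hvb⟩ := hstep (fun ζ => (1/2)^n * W ζ) 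
        (fun z => mul_nonneg (by positivity) (hW z))
        (fun z w => by
          have := mul_le_mul_of_nonneg_left (hWf z w) (show (0:ℝ) ≤ (1/2)^n by positivity)
          linarith) f hf.1.meas (hNs f hf.1) hf.2
      refine ⟨g', fun _ => ⟨⟨hg', fun ζ => (hb ζ).trans (le_of_eq (by ring))⟩, fun ζ => ?_⟩⟩
      rw [← hv ζ]; exact hvb ζ
    · exact ⟨0, fun h' => absurd h' hf⟩
  choose nxt hnxt using hnext
  let G : ℕ → ℂ → ℂ := fun n => Nat.rec g (fun n f => nxt n f) n
  have hGs : ∀ n, G (n + 1) = nxt n (G n) := fun n => rfl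
  have hG : ∀ n, Nice (G n) ∧ ∀ ζ, ‖G n ζ‖ * ρ ζ ≤ (1/2)^n * W ζ * Real.exp (t * φ ζ) := by
    intro n
    induction n with
    | zero => exact ⟨hgN, fun ζ => by rw [pow_zero, one_mul]; exact hbd ζ⟩
    | succ n ih => rw [hGs]; exact (hnxt n (G n) ih).1
  have hd : ∀ ζ n, dist (Cau (G n) ζ) (Cau (G (n + 1)) ζ) ≤ (C * W ζ * Real.exp (t * φ ζ)) * (1/2)^n := by
    intro ζ n
    rw [dist_eq_norm]
    refine ((hnxt n (G n) (hG n)).2 ζ).trans (le_of_eq (by ring))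
  have hlim : ∀ ζ, ∃ a, Tendsto (fun n => Cau (G n) ζ) atTop (𝓝 a) := fun ζ =>
    cauchySeq_tendsto_of_complete (cauchySeq_of_le_geometric (1/2) _ (by norm_num) (hd ζ))
  choose H hH using hlim
  have hdist : ∀ ζ n, dist (Cau (G n) ζ) (H ζ) ≤ 2 * C * (W ζ * Real.exp (t * φ ζ)) * (1/2)^n := by
    intro ζ n
    refine (dist_le_of_le_geometric_of_tendsto (1/2) _ (by norm_num) (hd ζ) (hH ζ) n).trans (le_of_eq ?_)
    ring
  refine ⟨H, ?_, hgN, fun ζ => ?_⟩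
  swap
  · have := hdist ζ 0
    rw [dist_eq_norm] at this
    refine this.trans (le_of_eq (by ring))
  intro z
  set r : ℝ := ‖z‖ + 1 with hrdef
  have hr0 : 0 < r := by positivity
  obtain ⟨A, hA0, hA⟩ := h.flat_bdd hφ.continuous (t := t) hWf r
  set G1 : ℕ → ℂ → ℂ := fun n => (ball (0:ℂ) r).indicator (G n) with hG1
  set G2 : ℕ → ℂ → ℂ := fun n => (ball (0:ℂ) r)ᶜ.indicator (G n) with hG2
  have nind : ∀ (s : Set ℂ), MeasurableSet s → ∀ n, Nice (s.indicator (G n)) := by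
    intro s hs n
    obtain ⟨⟨hm, ⟨A, hA⟩, r, hr, hrs⟩, -⟩ := hG n
    refine ⟨hm.indicator hs, ⟨A, fun w => (norm_indicator_le_norm_self _ _).trans (hA w)⟩, r, hr, fun w hw => ?_⟩
    rw [Set.indicator_apply]; split_ifs
    · exact hrs w hw
    · rfl
  have hsplit : ∀ n ζ, Cau (G n) ζ = Cau (G1 n) ζ + Cau (G2 n) ζ := by
    intro n ζ
    rw [← cau_add (nind _ measurableSet_ball n) (nind _ measurableSet_ball.compl n)]
    congr 1
    ext w
    exact (congrFun (Set.indicator_self_add_compl (ball (0:ℂ) r) (G n)) w).symm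
  have hhol : ∀ n, DifferentiableOn ℂ (Cau (G2 n)) (ball 0 r) := fun n =>
    cau_holo (nind _ measurableSet_ball.compl n) (fun w hw => Set.indicator_of_notMem (fun h' : w ∈ (ball (0:ℂ) r)ᶜ => h' hw) _)
  have hb1 : ∀ n ζ, ‖Cau (G1 n) ζ‖ ≤ 6 * r * (A * (1/2)^n) := by
    intro n ζ
    refine cau_bound (c := 0) hr0 (fun w => ?_) (fun w hw => Set.indicator_of_notMem hw _) ζ
    by_cases hw : w ∈ ball (0:ℂ) r
    · simp only [Set.indicator_of_mem hw]
      have e1 : ‖G n w‖ ≤ (W w * Real.exp (t * φ w) / ρ w) * (1/2)^n := by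
        rw [div_mul_eq_mul_div, le_div_iff₀ (h.rho_pos w)]
        exact ((hG n).2 w).trans (le_of_eq (by ring))
      exact e1.trans (mul_le_mul_of_nonneg_right (hA w hw).2 (by positivity))
    · simp only [Set.indicator_of_notMem hw, norm_zero]; positivity
  have hunif : TendstoUniformlyOn (fun n => Cau (G2 n)) H atTop (ball 0 r) := by
    rw [Metric.tendstoUniformlyOn_iff]
    intro ε hε
    have ht0 : Tendsto (fun n : ℕ => (2 * C * A + 6 * r * A) * (1/2 : ℝ)^n) atTop (𝓝 0) := by
      have := (tendsto_pow_atTop_nhds_zero_of_lt_one (show (0:ℝ) ≤ 1/2 by norm_num) (by norm_num)).const_mul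
        (2 * C * A + 6 * r * A)
      rwa [mul_zero] at this
    filter_upwards [ht0.eventually_lt_const hε] with n hn ζ hζ
    have e1 := hdist ζ n
    have e2 := hb1 n ζ
    have e3 : dist (H ζ) (Cau (G2 n) ζ) ≤ dist (Cau (G n) ζ) (H ζ) + ‖Cau (G1 n) ζ‖ := by
      rw [dist_comm (Cau (G n) ζ), dist_eq_norm, dist_eq_norm]
      have : H ζ - Cau (G2 n) ζ = (H ζ - Cau (G n) ζ) + Cau (G1 n) ζ := by rw [hsplit]; ring
      rw [this]; exact norm_add_le _ _
    have e4 : 2 * C * (W ζ * Real.exp (t * φ ζ)) * (1/2)^n ≤ 2 * C * A * (1/2)^n := by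
      have := (hA ζ hζ).1
      gcongr
    refine (e3.trans (add_le_add (e1.trans e4) e2)).trans_lt ?_
    refine lt_of_eq_of_lt ?_ hn
    ring
  have := hunif.tendstoLocallyUniformlyOn.differentiableOn (Eventually.of_forall hhol) isOpen_ball
  exact (this z (by simp [hrdef])).differentiableAt (isOpen_ball.mem_nhds (by simp [hrdef]))

end DGeo
end

noncomputable section

/-- Jensen inequality with a kernel -/
lemma jensen {α : Type*} [MeasurableSpace α] (ν : Measure α) {q : ℝ} (hq : 1 ≤ q) {k a : α → ℝ≥0∞}
    (hk : Measurable k) (ha : Measurable a) :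
    (∫⁻ x, k x * a x ∂ν) ^ q ≤ (∫⁻ x, k x ∂ν) ^ (q - 1) * ∫⁻ x, k x * a x ^ q ∂ν := by
  rcases hq.eq_or_lt with rfl | hq1
  · simp
  have hq0 : 0 < q := by linarith
  have hc : q.HolderConjugate (q / (q - 1)) := Real.HolderConjugate.conjExponent hq1
  have h1 := ENNReal.lintegral_mul_le_Lp_mul_Lq ν hc (f := fun x => k x ^ (1 / q) * a x)
    (g := fun x => k x ^ ((q - 1) / q)) ((hk.pow_const _).mul ha).aemeasurable
    (hk.pow_const _).aemeasurable
  have e1 : ∀ x, (k x ^ (1 / q) * a x) * k x ^ ((q - 1) / q) = k x * a x := by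
    intro x
    have : k x ^ (1 / q) * k x ^ ((q - 1) / q) = k x := by
      rw [← ENNReal.rpow_add_of_nonneg _ _ (by positivity) (div_nonneg (by linarith) hq0.le), ← add_div]
      rw [add_sub_cancel, div_self hq0.ne', ENNReal.rpow_one]
    calc _ = (k x ^ (1 / q) * k x ^ ((q - 1) / q)) * a x := by ring
      _ = _ := by rw [this]
  have e2 : ∀ x, (k x ^ (1 / q) * a x) ^ q = k x * a x ^ q := by
    intro x
    rw [ENNReal.mul_rpow_of_nonneg _ _ hq0.le, ← ENNReal.rpow_mul, one_div_mul_cancel hq0.ne', ENNReal.rpow_one]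
  have e3 : ∀ x, (k x ^ ((q - 1) / q)) ^ (q / (q - 1)) = k x := by
    intro x
    have : q - 1 ≠ 0 := by linarith
    rw [← ENNReal.rpow_mul]
    rw [show (q - 1) / q * (q / (q - 1)) = 1 by field_simp, ENNReal.rpow_one]
  simp only [Pi.mul_apply, e1, e2, e3] at h1
  calc _ ≤ ((∫⁻ x, k x * a x ^ q ∂ν) ^ (1 / q) * (∫⁻ x, k x ∂ν) ^ (1 / (q / (q - 1)))) ^ q := by gcongr
    _ = _ := by
      rw [ENNReal.mul_rpow_of_nonneg _ _ hq0.le, ← ENNReal.rpow_mul, ← ENNReal.rpow_mul,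
        one_div_mul_cancel hq0.ne', ENNReal.rpow_one, mul_comm]
      congr 2
      field_simp

/-- weighted modulus -/
def nf (t : ℝ) (φ ω : ℂ → ℝ) (f : ℂ → ℂ) (z : ℂ) : ℝ := ω z * ‖f z‖ * Real.exp (-(t * φ z))

namespace DGeo
variable {μ : Measure ℂ} {ρ : ℂ → ℝ} {φ : ℂ → ℝ}

lemma Dd_le_two (h : DGeo μ ρ) {z w : ℂ} (hw : dist w z ≤ ρ z) : Dd ρ z w ≤ 2 := by
  unfold Dd
  have : dist z w / ρ z ≤ 1 := by
    rw [div_le_one (h.rho_pos z), dist_comm]; exact hw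
  linarith

lemma mv1 (h : DGeo μ ρ) (hφ : HasDoublingLaplacian φ μ) {T δ : ℝ} (hδ : 0 < δ) (hδ1 : δ ≤ 1) :
    ∃ C : ℝ, 0 < C ∧ ∀ t, 0 ≤ t → t ≤ T → ∀ f : ℂ → ℂ, Differentiable ℂ f → ∀ z,
      ENNReal.ofReal (‖f z‖ * Real.exp (-(t * φ z))) ≤ ENNReal.ofReal C *
        ∫⁻ w in ball z (δ * ρ z), ENNReal.ofReal (‖f w‖ * Real.exp (-(t * φ w)) / ρ w ^ 2) := by
  obtain ⟨c, η, C, hc, hη, hη2, hC, hloc⟩ := h.local_holo hφ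
  obtain ⟨B, hB0, hbump⟩ := bump_exists (α := 1 / 2) (β := 3 / 4) (by norm_num) (by norm_num)
  obtain ⟨n, hn⟩ := h.growth
  set E := Real.exp (T * (C * 4 ^ n)) with hE
  have hEpos : 0 < E := Real.exp_pos _
  refine ⟨E * (2 * B / (π * δ ^ 2)) * 4, by positivity, ?_⟩
  intro t ht htT f hf z
  have hρ := h.rho_pos z
  obtain ⟨F, hFd, hF1, -, -⟩ := hloc z (2 * ρ z) (by positivity)
  set R := δ * ρ z with hR
  have hRpos : 0 < R := by positivity
  obtain ⟨χ, hχ, hχ0, hχ1, hχa, hχb, hχB⟩ := hbump z R hRpos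
  have hm : μ.real (ball z (2 * ρ z)) ≤ 4 ^ n := by
    have := hn z (ρ z) 2 hρ (by norm_num)
    rw [h.real_rho, mul_one] at this
    norm_num at this ⊢
    exact this
  have hRle : R ≤ ρ z := by rw [hR]; nlinarith
  have hsub : ball z R ⊆ ball z ((1 - η) * (2 * ρ z)) := ball_subset_ball (by nlinarith)
  have hGd : DifferentiableOn ℂ (fun w => f w * Complex.exp (-(t * F w))) (ball z R) :=
    hf.differentiableOn.mul ((hFd.mono hsub).const_mul _).neg.cexp
  set G : ℂ → ℂ := fun w => f w * Complex.exp (-(t * F w)) with hG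
  obtain ⟨hKc, hKs, hd1, hd2, hd3⟩ := cutK hRpos (show 3 / 4 * R < R by linarith) hχ hχa hχb hχB hGd
  set Kf : ℂ → ℂ := fun z => (χ z : ℂ) * G z with hKf
  have nG : ∀ w, ‖G w‖ = ‖f w‖ * Real.exp (-(t * (F w).re)) := fun w => by
    simp only [hG]; rw [norm_mul, Complex.norm_exp]; simp
  have hχz : χ z = 1 := hχa z (by simp; positivity)
  have hpom := pompeiu hKc hKs z
  have hKz : Kf z = G z := by simp [hKf, hχz]
  have hzb : z ∈ ball z R := mem_ball_self hRpos
  -- main estimate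
  have key : ENNReal.ofReal ‖G z‖ ≤ ∫⁻ w in ball z R, ENNReal.ofReal (2 * B / (π * R ^ 2) * ‖G w‖) := by
    rw [← hKz, ← hpom, Cau, norm_mul, norm_inv, Complex.norm_real, Real.norm_eq_abs, abs_of_pos Real.pi_pos,
      ENNReal.ofReal_mul (by positivity), ofReal_norm]
    calc _ ≤ ENNReal.ofReal π⁻¹ * ∫⁻ w, ‖dbar Kf w / (z - w)‖ₑ := by
          gcongr; exact enorm_integral_le_lintegral_enorm _
      _ ≤ ENNReal.ofReal π⁻¹ * ∫⁻ w, (ball z R).indicator (fun w => ENNReal.ofReal (2 * B / R ^ 2 * ‖G w‖)) w := by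
          gcongr with w
          rw [← ofReal_norm]
          by_cases h1 : dist w z < 1 / 2 * R
          · rw [hd1 w h1]; simp
          by_cases h2 : 3 / 4 * R < dist w z
          · rw [hd2 w h2]; simp
          push Not at h1 h2
          have hw : w ∈ ball z R := by rw [mem_ball]; linarith
          rw [Set.indicator_of_mem hw]
          apply ENNReal.ofReal_le_ofReal
          rw [norm_div, ← dist_eq_norm, dist_comm z w]
          have h3 : 0 < dist w z := by linarith
          calc _ ≤ (B / R * ‖G w‖) / (1 / 2 * R) := by
                gcongr
                exact hd3 w h2
            _ = _ := by field_simp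
      _ = _ := by
          rw [lintegral_indicator measurableSet_ball, ← lintegral_const_mul' _ _ (by simp)]
          congr 1
          ext w
          rw [← ENNReal.ofReal_mul (by positivity)]
          congr 1
          field_simp
  have hz1 : ‖f z‖ * Real.exp (-(t * φ z)) ≤ E * ‖G z‖ := by
    rw [nG, hE]
    have e1 := (hF1 z (hsub hzb)).2
    have e2 : C * μ.real (ball z (2 * ρ z)) ≤ C * 4 ^ n := by gcongr
    have e3 : Real.exp (-(t * φ z)) ≤ Real.exp (T * (C * 4 ^ n)) * Real.exp (-(t * (F z).re)) := by
      rw [← Real.exp_add]; apply Real.exp_le_exp.2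
      have e5 : t * (C * 4 ^ n) ≤ T * (C * 4 ^ n) := by gcongr
      nlinarith
    calc _ ≤ ‖f z‖ * (Real.exp (T * (C * 4 ^ n)) * Real.exp (-(t * (F z).re))) := by gcongr
      _ = _ := by ring
  calc _ ≤ ENNReal.ofReal (E * ‖G z‖) := ENNReal.ofReal_le_ofReal hz1
    _ = ENNReal.ofReal E * ENNReal.ofReal ‖G z‖ := ENNReal.ofReal_mul hEpos.le
    _ ≤ ENNReal.ofReal E * ∫⁻ w in ball z R, ENNReal.ofReal (2 * B / (π * R ^ 2) * ‖G w‖) := by gcongr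
    _ ≤ ENNReal.ofReal E * ∫⁻ w in ball z R, ENNReal.ofReal (2 * B / (π * δ ^ 2) * 4) *
        ENNReal.ofReal (‖f w‖ * Real.exp (-(t * φ w)) / ρ w ^ 2) := by
        refine mul_le_mul_right ?_ _
        refine setLIntegral_mono' measurableSet_ball fun w hw => ?_
        rw [← ENNReal.ofReal_mul (by positivity)]
        apply ENNReal.ofReal_le_ofReal
        have hρw := h.rho_pos w
        have e1 : ρ w ≤ 2 * ρ z := by
          have := h.rho_lip w z
          rw [mem_ball] at hw; linarith
        have e2 : ‖G w‖ ≤ ‖f w‖ * Real.exp (-(t * φ w)) := by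
          rw [nG]
          have := (hF1 w (hsub hw)).1
          gcongr
        have e3 : (1:ℝ) / ρ z ^ 2 ≤ 4 / ρ w ^ 2 := by
          rw [div_le_div_iff₀ (by positivity) (by positivity)]
          nlinarith
        calc _ = 2 * B / (π * δ ^ 2) * (1 / ρ z ^ 2) * ‖G w‖ := by rw [hR]; field_simp
          _ ≤ 2 * B / (π * δ ^ 2) * (4 / ρ w ^ 2) * (‖f w‖ * Real.exp (-(t * φ w))) := by gcongr
          _ = _ := by ring
    _ = _ := by
        rw [lintegral_const_mul' _ _ (by simp), ← mul_assoc, ← ENNReal.ofReal_mul hEpos.le]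
        congr 2
        ring

lemma nf_nonneg {t : ℝ} {ω : ℂ → ℝ} (hω : ∀ z, 0 < ω z) (f : ℂ → ℂ) (z : ℂ) : 0 ≤ nf t φ ω f z := by
  have := hω z
  unfold nf; positivity

lemma nf_meas {t : ℝ} {ω : ℂ → ℝ} (hω : Measurable ω) (hφ : Continuous φ) {f : ℂ → ℂ} (hf : Differentiable ℂ f) :
    Measurable (nf t φ ω f) := by
  have := hf.continuous.measurable
  have := hφ.measurable
  unfold nf; fun_prop

lemma lint_ball_rho (h : DGeo μ ρ) : ∃ A : ℝ, 0 < A ∧ ∀ z,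
    ∫⁻ w in ball z (ρ z), ENNReal.ofReal (1 / ρ w ^ 2) ≤ ENNReal.ofReal A := by
  obtain ⟨M, C, hC, hM⟩ := h.lint_Dd
  refine ⟨2 ^ M * C, by positivity, fun z => ?_⟩
  calc _ ≤ ∫⁻ w in ball z (ρ z), ENNReal.ofReal (2 ^ M) * ENNReal.ofReal ((Dd ρ z w ^ M)⁻¹ / ρ w ^ 2) := by
        refine setLIntegral_mono' measurableSet_ball fun w hw => ?_
        rw [← ENNReal.ofReal_mul (by positivity)]
        apply ENNReal.ofReal_le_ofReal
        have h1 := h.Dd_le_two (mem_ball.1 hw).le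
        have h2 := h.Dd_pos z w
        have hρ := h.rho_pos w
        rw [← mul_div_assoc]
        gcongr
        rw [← div_eq_mul_inv, one_le_div (by positivity)]
        gcongr
    _ = ENNReal.ofReal (2 ^ M) * ∫⁻ w in ball z (ρ z), ENNReal.ofReal ((Dd ρ z w ^ M)⁻¹ / ρ w ^ 2) :=
        lintegral_const_mul' _ _ (by simp)
    _ ≤ ENNReal.ofReal (2 ^ M) * ENNReal.ofReal C := by
        gcongr
        exact (setLIntegral_le_lintegral _ _).trans (hM z)
    _ = _ := by rw [← ENNReal.ofReal_mul (by positivity)]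

lemma mvq (h : DGeo μ ρ) (hφ : HasDoublingLaplacian φ μ) {T δ q : ℝ} (hδ : 0 < δ) (hδ1 : δ ≤ 1)
    (hq : 1 ≤ q) {ω : ℂ → ℝ} (hω : IsFlatWeight ρ ω) :
    ∃ C : ℝ, 0 < C ∧ ∀ t, 0 ≤ t → t ≤ T → ∀ f : ℂ → ℂ, Differentiable ℂ f → ∀ z,
      ENNReal.ofReal (nf t φ ω f z ^ q) ≤ ENNReal.ofReal C *
        ∫⁻ w in ball z (δ * ρ z), ENNReal.ofReal (nf t φ ω f w ^ q / ρ w ^ 2) := by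
  obtain ⟨C, hC, hmv⟩ := h.mv1 hφ (T := T) hδ hδ1
  obtain ⟨m, L, hL, hfl⟩ := h.flat hω
  obtain ⟨k2, C2, hC2, hk2⟩ := h.Dd_symm
  obtain ⟨A, hA, hlb⟩ := h.lint_ball_rho
  have hpos := hω.1
  set D := L * (C2 * 2 ^ k2) ^ m with hD
  have hDpos : 0 < D := by positivity
  refine ⟨(C * D) ^ q * A ^ (q - 1), by positivity, ?_⟩
  intro t ht htT f hf z
  have hρ := h.rho_pos z
  have hq0 : 0 ≤ q := by linarith
  have hRle : δ * ρ z ≤ ρ z := by nlinarith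
  have hnm := nf_meas (t := t) hω.2.1 hφ.continuous hf
  have hrm : Measurable fun w => ENNReal.ofReal (1 / ρ w ^ 2) := by
    have := h.rho_cont.measurable
    fun_prop
  have h1 : ENNReal.ofReal (nf t φ ω f z) ≤ ENNReal.ofReal (C * D) *
      ∫⁻ w in ball z (δ * ρ z), ENNReal.ofReal (1 / ρ w ^ 2) * ENNReal.ofReal (nf t φ ω f w) := by
    have e0 : nf t φ ω f z = ω z * (‖f z‖ * Real.exp (-(t * φ z))) := by unfold nf; ring
    rw [e0, ENNReal.ofReal_mul (hpos z).le]
    calc _ ≤ ENNReal.ofReal (ω z) * (ENNReal.ofReal C * ∫⁻ w in ball z (δ * ρ z),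
            ENNReal.ofReal (‖f w‖ * Real.exp (-(t * φ w)) / ρ w ^ 2)) := by gcongr; exact hmv t ht htT f hf z
      _ = ENNReal.ofReal C * ∫⁻ w in ball z (δ * ρ z), ENNReal.ofReal (ω z) *
            ENNReal.ofReal (‖f w‖ * Real.exp (-(t * φ w)) / ρ w ^ 2) := by
          rw [lintegral_const_mul' _ _ (by simp)]; ring
      _ ≤ ENNReal.ofReal C * ∫⁻ w in ball z (δ * ρ z), ENNReal.ofReal D * (ENNReal.ofReal (1 / ρ w ^ 2) *
            ENNReal.ofReal (nf t φ ω f w)) := by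
          refine mul_le_mul_right ?_ _
          refine setLIntegral_mono' measurableSet_ball fun w hw => ?_
          have hρw := h.rho_pos w
          rw [← ENNReal.ofReal_mul (hpos z).le, ← ENNReal.ofReal_mul (by positivity), ← ENNReal.ofReal_mul hDpos.le]
          apply ENNReal.ofReal_le_ofReal
          have d1 := h.Dd_le_two ((mem_ball.1 hw).le.trans hRle)
          have d2 : Dd ρ w z ≤ C2 * 2 ^ k2 := by
            refine (hk2 z w).trans ?_
            have := h.Dd_pos z w
            gcongr
          have d3 : ω z ≤ D * ω w := by
            refine (hfl w z).trans ?_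
            have := h.Dd_pos w z
            have := hpos w
            rw [hD]; gcongr
          calc _ ≤ (D * ω w) * (‖f w‖ * Real.exp (-(t * φ w)) / ρ w ^ 2) := by gcongr
            _ = _ := by unfold nf; ring
      _ = _ := by
          rw [lintegral_const_mul' _ _ (by simp), ← mul_assoc, ← ENNReal.ofReal_mul hC.le]
  have h2 := jensen (volume.restrict (ball z (δ * ρ z))) hq hrm hnm.ennreal_ofReal
  rw [← ENNReal.ofReal_rpow_of_nonneg (nf_nonneg hpos f z) hq0]
  calc _ ≤ (ENNReal.ofReal (C * D) *
      ∫⁻ w in ball z (δ * ρ z), ENNReal.ofReal (1 / ρ w ^ 2) * ENNReal.ofReal (nf t φ ω f w)) ^ q := by gcongr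
    _ ≤ ENNReal.ofReal (C * D) ^ q * (ENNReal.ofReal A ^ (q - 1) *
        ∫⁻ w in ball z (δ * ρ z), ENNReal.ofReal (1 / ρ w ^ 2) * ENNReal.ofReal (nf t φ ω f w) ^ q) := by
        rw [ENNReal.mul_rpow_of_nonneg _ _ hq0]
        refine mul_le_mul_right (h2.trans (mul_le_mul_left ?_ _)) _
        refine ENNReal.rpow_le_rpow ?_ (by linarith)
        exact (lintegral_mono_set (ball_subset_ball hRle)).trans (hlb z)
    _ = _ := by
        rw [ENNReal.ofReal_mul (p := (C * D) ^ q) (by positivity), ← ENNReal.ofReal_rpow_of_pos (by positivity),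
          ← ENNReal.ofReal_rpow_of_pos hA, mul_assoc]
        congr 3
        ext w
        rw [ENNReal.ofReal_rpow_of_nonneg (nf_nonneg hpos f w) hq0, ← ENNReal.ofReal_mul (by positivity)]
        congr 1
        ring

end DGeo
end

noncomputable section

lemma cau_div {f : ℂ → ℂ} (hf : Nice f) {z : ℂ} {r : ℝ} (hr : 0 < r) (h0 : ∀ w, dist w z < r → f w = 0) (ζ : ℂ) :
    (ζ - z) * Cau (fun w => f w / (w - z)) ζ = Cau f ζ - Cau f z := by
  simp only [Cau]
  rw [mul_left_comm, ← mul_sub, ← integral_sub (hf.int ζ) (hf.int z), ← integral_const_mul]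
  congr 1
  apply integral_congr_ae
  have n1 : ∀ᵐ x : ℂ, x ≠ ζ := by rw [ae_iff]; simp
  have n2 : ∀ᵐ x : ℂ, x ≠ z := by rw [ae_iff]; simp
  filter_upwards [n1, n2] with w hw1 hw2
  have i1 : ζ - w ≠ 0 := sub_ne_zero.2 hw1.symm
  have i2 : w - z ≠ 0 := sub_ne_zero.2 hw2
  have i3 : z - w = -(w - z) := by ring
  rw [i3]
  field_simp
  ring

namespace DGeo
variable {μ : Measure ℂ} {ρ : ℂ → ℝ} {φ : ℂ → ℝ}

lemma Dd_pflat (h : DGeo μ ρ) (N : ℕ) : ∃ (m : ℕ) (L : ℝ), 1 ≤ L ∧ ∀ z, PFlat ρ m L (fun ζ => (Dd ρ z ζ ^ N)⁻¹) := by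
  obtain ⟨k2, C2, hC2, hk2⟩ := h.Dd_symm
  refine ⟨k2 * N, C2 ^ N, one_le_pow₀ hC2, fun z ζ w => ?_⟩
  have p1 := h.Dd_pos z w
  have p2 := h.Dd_pos z ζ
  have p3 := h.Dd_pos ζ w
  have e1 : Dd ρ z ζ ≤ Dd ρ z w * (C2 * Dd ρ ζ w ^ k2) :=
    (h.Dd_tri z w ζ).trans (mul_le_mul_of_nonneg_left (hk2 ζ w) p1.le)
  have e2 : Dd ρ z ζ ^ N ≤ Dd ρ z w ^ N * (C2 ^ N * Dd ρ ζ w ^ (k2 * N)) := by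
    rw [pow_mul, ← mul_pow, ← mul_pow]; gcongr
  beta_reduce
  rw [← div_eq_mul_inv, le_div_iff₀ (by positivity), inv_mul_le_iff₀ (by positivity)]
  exact e2

theorem peak (h : DGeo μ ρ) (hφ : HasDoublingLaplacian φ μ) {t : ℝ} (ht : 0 < t) (M : ℕ) :
    ∃ C : ℝ, 0 < C ∧ ∀ z, ∃ P : ℂ → ℂ, Differentiable ℂ P ∧ Real.exp (t * φ z) ≤ ‖P z‖ ∧
      ∀ ζ, ‖P ζ‖ * Real.exp (-(t * φ ζ)) ≤ C * (Dd ρ z ζ ^ M)⁻¹ := by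
  obtain ⟨c, η, C, hc, hη, hη2, hC, hloc⟩ := h.local_holo hφ
  obtain ⟨B, hB0, hbump⟩ := bump_exists (α := 1 / 2) (β := 3 / 4) (by norm_num) (by norm_num)
  obtain ⟨n, hn⟩ := h.growth
  obtain ⟨m, L, hL, hfl⟩ := h.Dd_pflat (M + 1)
  obtain ⟨CD, hCD, hsolve⟩ := h.dbar_solve hφ ht hL m
  set E := Real.exp (t * (C * 4 ^ n)) with hE
  have hEpos : 0 < E := Real.exp_pos _
  set A := 4 * B * E * 2 ^ (M + 1) with hA
  have hApos : 0 < A := by positivity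
  refine ⟨E * 2 ^ M + CD * A, by positivity, ?_⟩
  intro z
  have hρ := h.rho_pos z
  obtain ⟨F, hFd, hF1, -, -⟩ := hloc z (2 * ρ z) (by positivity)
  obtain ⟨χ, hχ, hχ0, hχ1, hχa, hχb, hχB⟩ := hbump z (ρ z) hρ
  have hm : μ.real (ball z (2 * ρ z)) ≤ 4 ^ n := by
    have := hn z (ρ z) 2 hρ (by norm_num)
    rw [h.real_rho, mul_one] at this
    norm_num at this ⊢
    exact this
  have hsub : ball z (ρ z) ⊆ ball z ((1 - η) * (2 * ρ z)) := ball_subset_ball (by nlinarith)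
  have hGd : DifferentiableOn ℂ (fun w => Complex.exp (t * F w)) (ball z (ρ z)) :=
    ((hFd.mono hsub).const_mul _).cexp
  obtain ⟨hKc, hKs, hd1, hd2, hd3⟩ := cutK hρ (show 3 / 4 * ρ z < ρ z by linarith) hχ hχa hχb hχB hGd
  have nexp : ∀ z, ‖Complex.exp (t * F z)‖ = Real.exp (t * (F z).re) := fun z => by
    rw [Complex.norm_exp]; simp
  have nexpb : ∀ w ∈ ball z (ρ z), ‖Complex.exp (t * F w)‖ ≤ E * Real.exp (t * φ w) := by
    intro w hw
    rw [nexp, hE, ← Real.exp_add]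
    apply Real.exp_le_exp.2
    have e1 := (hF1 w (hsub hw)).2
    have e2 : C * μ.real (ball z (2 * ρ z)) ≤ C * 4 ^ n := by gcongr
    nlinarith
  set Kf : ℂ → ℂ := fun z => (χ z : ℂ) * Complex.exp (t * F z) with hKf
  set g : ℂ → ℂ := fun w => dbar Kf w / (w - z) with hg
  have hdN := dbar_nice hKc hKs
  have hgm : Measurable g := by
    have := hdN.meas
    rw [hg]; fun_prop
  have hgs : ∃ r, ∀ ζ, ζ ∉ closedBall (0:ℂ) r → g ζ = 0 := by
    obtain ⟨r, -, hr⟩ := hdN.supp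
    refine ⟨r, fun ζ hζ => ?_⟩
    simp [hg, hr ζ fun h' => hζ (ball_subset_closedBall h')]
  have hDle : ∀ ζ (N : ℕ), dist ζ z ≤ ρ z → 1 ≤ 2 ^ N * (Dd ρ z ζ ^ N)⁻¹ := by
    intro ζ N hζ
    have p := h.Dd_pos z ζ
    rw [← div_eq_mul_inv, one_le_div (by positivity)]
    gcongr
    exact h.Dd_le_two hζ
  obtain ⟨H, hH, -, hHb⟩ := hsolve (fun ζ => A / ρ z * (Dd ρ z ζ ^ (M + 1))⁻¹)
    (fun ζ => by have := h.Dd_pos z ζ; positivity)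
    (fun ζ w => by
      have := mul_le_mul_of_nonneg_left (hfl z ζ w) (show 0 ≤ A / ρ z by positivity)
      beta_reduce at this ⊢
      linarith) g hgm hgs
    (fun ζ => by
      have p := h.Dd_pos z ζ
      have hpos : 0 ≤ A / ρ z * (Dd ρ z ζ ^ (M + 1))⁻¹ * Real.exp (t * φ ζ) := by positivity
      by_cases h1 : dist ζ z < 1 / 2 * ρ z
      · simp only [hg, hd1 ζ h1]; simpa using hpos
      by_cases h2 : 3 / 4 * ρ z < dist ζ z
      · simp only [hg, hd2 ζ h2]; simpa using hpos
      push Not at h1 h2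
      have hζ : ζ ∈ ball z (ρ z) := by rw [mem_ball]; linarith
      have hρζ := h.rho_pos ζ
      have e1 : ρ ζ ≤ 2 * ρ z := by
        have := h.rho_lip ζ z
        linarith
      simp only [hg]
      rw [norm_div, ← dist_eq_norm ζ z]
      have h3 : 0 < dist ζ z := by linarith
      have e2 : ‖dbar Kf ζ‖ ≤ B / ρ z * (E * Real.exp (t * φ ζ)) :=
        (hd3 ζ h2).trans (mul_le_mul_of_nonneg_left (nexpb ζ hζ) (by positivity))
      have e3 := hDle ζ (M + 1) (by linarith)
      calc _ ≤ (B / ρ z * (E * Real.exp (t * φ ζ))) / (1 / 2 * ρ z) * (2 * ρ z) := by gcongr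
        _ = (4 * B * E / ρ z * Real.exp (t * φ ζ)) * 1 := by field_simp; ring
        _ ≤ (4 * B * E / ρ z * Real.exp (t * φ ζ)) * (2 ^ (M + 1) * (Dd ρ z ζ ^ (M + 1))⁻¹) := by
            apply mul_le_mul_of_nonneg_left e3; positivity
        _ = _ := by rw [hA]; ring)
  have hcd : ∀ ζ, (ζ - z) * Cau g ζ = Kf ζ - Kf z := by
    intro ζ
    rw [cau_div hdN (show 0 < 1 / 2 * ρ z by positivity) hd1, pompeiu hKc hKs, pompeiu hKc hKs]
  have hχz : χ z = 1 := hχa z (by simp; positivity)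
  refine ⟨fun ζ => Kf z + (ζ - z) * H ζ, by fun_prop, ?_, ?_⟩
  · simp only [sub_self, zero_mul, add_zero, hKf, hχz, Complex.ofReal_one, one_mul]
    rw [nexp]
    have := (hF1 z (hsub (mem_ball_self hρ))).1
    gcongr
  · intro ζ
    have p := h.Dd_pos z ζ
    have e1 : Kf z + (ζ - z) * H ζ = Kf ζ - (ζ - z) * (Cau g ζ - H ζ) := by
      rw [mul_sub, hcd]; ring
    beta_reduce
    rw [e1]
    have e2 : ‖Kf ζ‖ ≤ E * 2 ^ M * (Dd ρ z ζ ^ M)⁻¹ * Real.exp (t * φ ζ) := by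
      by_cases hζ : 3 / 4 * ρ z ≤ dist ζ z
      · simp only [hKf, hχb ζ hζ, Complex.ofReal_zero, zero_mul, norm_zero]; positivity
      push Not at hζ
      have hb : ζ ∈ ball z (ρ z) := by rw [mem_ball]; linarith
      have e3 := hDle ζ M (by linarith)
      simp only [hKf]
      rw [norm_mul, Complex.norm_real, Real.norm_eq_abs, abs_of_nonneg (hχ0 ζ)]
      calc _ ≤ 1 * (E * Real.exp (t * φ ζ)) := by
            gcongr
            · exact hχ1 ζ
            · exact nexpb ζ hb
        _ = E * Real.exp (t * φ ζ) * 1 := by ring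
        _ ≤ E * Real.exp (t * φ ζ) * (2 ^ M * (Dd ρ z ζ ^ M)⁻¹) :=
            mul_le_mul_of_nonneg_left e3 (by positivity)
        _ = _ := by ring
    have e4 : ‖(ζ - z) * (Cau g ζ - H ζ)‖ ≤ CD * A * (Dd ρ z ζ ^ M)⁻¹ * Real.exp (t * φ ζ) := by
      rw [norm_mul, ← dist_eq_norm, dist_comm]
      have e5 : dist z ζ ≤ ρ z * Dd ρ z ζ := by
        rw [h.rho_mul_Dd]; linarith
      calc _ ≤ (ρ z * Dd ρ z ζ) * (CD * (A / ρ z * (Dd ρ z ζ ^ (M + 1))⁻¹) * Real.exp (t * φ ζ)) := by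
            have := hHb ζ
            gcongr
        _ = _ := by rw [pow_succ]; field_simp
    have ee : Real.exp (t * φ ζ) * Real.exp (-(t * φ ζ)) = 1 := by rw [← Real.exp_add]; simp
    calc _ ≤ (E * 2 ^ M * (Dd ρ z ζ ^ M)⁻¹ * Real.exp (t * φ ζ) +
          CD * A * (Dd ρ z ζ ^ M)⁻¹ * Real.exp (t * φ ζ)) * Real.exp (-(t * φ ζ)) := by
          gcongr
          exact (norm_sub_le _ _).trans (add_le_add e2 e4)
      _ = ((E * 2 ^ M + CD * A) * (Dd ρ z ζ ^ M)⁻¹) * (Real.exp (t * φ ζ) * Real.exp (-(t * φ ζ))) := by ring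
      _ = _ := by rw [ee, mul_one]

end DGeo
end

noncomputable section

namespace DGeo
variable {μ : Measure ℂ} {ρ : ℂ → ℝ} {φ : ℂ → ℝ}

/-- A slowly varying scale `r`, much larger than `ρ`, whose disks have bounded mass. -/
structure Scale (μ : Measure ℂ) (ρ : ℂ → ℝ) (κ N : ℝ) (r : ℂ → ℝ) : Prop where
  rho_le : ∀ z, ρ z ≤ r z
  lip : ∀ z w, r z ≤ r w + dist z w
  mass : ∀ z, μ.real (ball z (r z / 2)) ≤ N
  small : ∀ z ζ, dist ζ z ≤ r z / 4 → ρ ζ ≤ κ * r z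

lemma exists_scale (h : DGeo μ ρ) {κ : ℝ} (hκ : 0 < κ) : ∃ N : ℝ, 1 ≤ N ∧ ∃ r : ℂ → ℝ, Scale μ ρ κ N r := by
  obtain ⟨n, hn⟩ := h.growth
  obtain ⟨q, hq, hrev⟩ := h.rev_growth
  set N : ℝ := max 1 ((5 / κ) ^ n) with hN
  have hN1 : 1 ≤ N := le_max_left _ _
  set S : ℂ → Set ℝ := fun z => {s | 0 < s ∧ μ.real (ball z s) ≤ N} with hS
  have hmem : ∀ z, ρ z ∈ S z := fun z => ⟨h.rho_pos z, by rw [h.real_rho]; exact hN1⟩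
  have hbdd : ∀ z, BddAbove (S z) := by
    intro z
    refine ⟨max (ρ z) (4 * N ^ q * ρ z), fun s hs => ?_⟩
    by_contra hlt
    push Not at hlt
    have h1 := (le_max_left _ _).trans_lt hlt
    have h2 := (le_max_right _ _).trans_lt hlt
    have hρ := h.rho_pos z
    have h3 := hrev z (ρ z) (s / ρ z) hρ ((one_le_div hρ).2 h1.le)
    rw [h.real_rho, div_mul_cancel₀ _ hρ.ne', one_pow, mul_one] at h3
    have h4 : μ.real (ball z s) ^ q ≤ N ^ q := pow_le_pow_left₀ measureReal_nonneg hs.2 q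
    have h5 : s / ρ z ≤ 4 * N ^ q := by linarith
    rw [div_le_iff₀ hρ] at h5
    linarith
  set r : ℂ → ℝ := fun z => sSup (S z) with hr
  have hρr : ∀ z, ρ z ≤ r z := fun z => le_csSup (hbdd z) (hmem z)
  have hlip : ∀ z w, r z ≤ r w + dist z w := by
    intro z w
    apply csSup_le ⟨_, hmem z⟩
    intro s hs
    by_cases hd : s ≤ dist z w
    · have := (h.rho_pos w).le.trans (hρr w)
      linarith
    push Not at hd
    have : s - dist z w ∈ S w := by
      refine ⟨by linarith, le_trans ?_ hs.2⟩
      exact h.real_mono (ball_subset_ball' (by rw [dist_comm]; linarith))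
    have := le_csSup (hbdd w) this
    linarith
  refine ⟨N, hN1, r, hρr, hlip, ?_, ?_⟩
  · intro z
    have hrz : 0 < r z := (h.rho_pos z).trans_le (hρr z)
    obtain ⟨s, hs, hlt⟩ := exists_lt_of_lt_csSup ⟨_, hmem z⟩ (show r z / 2 < sSup (S z) by show r z / 2 < r z; linarith)
    exact (h.real_mono (ball_subset_ball hlt.le)).trans hs.2
  · intro z ζ hd
    by_contra hlt
    push Not at hlt
    have hρ := h.rho_pos ζ
    have hrζ : 0 < r ζ := hρ.trans_le (hρr ζ)
    have hrz : 0 < r z := (h.rho_pos z).trans_le (hρr z)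
    have h1 : N < μ.real (ball ζ (2 * r ζ)) := by
      by_contra hc
      push Not at hc
      have := le_csSup (hbdd ζ) (show 2 * r ζ ∈ S ζ from ⟨by linarith, hc⟩)
      have : 2 * r ζ ≤ r ζ := this
      linarith
    have h2 := hn ζ (ρ ζ) (2 * r ζ / ρ ζ) hρ (by rw [one_le_div hρ]; linarith [hρr ζ])
    rw [h.real_rho, div_mul_cancel₀ _ hρ.ne', mul_one] at h2
    have h3 : 2 * (2 * r ζ / ρ ζ) ≤ 5 / κ := by
      rw [← mul_div_assoc, div_le_div_iff₀ hρ hκ]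
      have := hlip ζ z
      nlinarith
    have h4 : (2 * (2 * r ζ / ρ ζ)) ^ n ≤ (5 / κ) ^ n := by
      apply pow_le_pow_left₀ _ h3
      positivity
    have h5 : (5 / κ) ^ n ≤ N := le_max_right _ _
    linarith

/-- localisation -/
lemma cutoff (h : DGeo μ ρ) (hφ : HasDoublingLaplacian φ μ) {L : ℝ} (hL : 1 ≤ L) (M : ℕ) :
    ∃ C : ℝ, 0 < C ∧ ∀ κ : ℝ, 0 < κ → ∀ N : ℝ, 1 ≤ N → ∀ r : ℂ → ℝ, Scale μ ρ κ N r →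
      ∃ ε : ℝ, 0 < ε ∧ ε ≤ 1 ∧ ∀ f : ℂ → ℂ, Differentiable ℂ f → ∀ z : ℂ, ∀ W : ℂ → ℝ, (∀ ζ, 0 ≤ W ζ) →
        PFlat ρ M L W →
        (∀ ζ, dist ζ z ≤ r z / 8 → ‖f ζ‖ * Real.exp (-((1 + ε) * φ ζ)) ≤ W ζ) →
        ∃ F : ℂ → ℂ, Differentiable ℂ F ∧
          (∀ ζ, dist ζ z < r z / 16 → ‖f ζ‖ * Real.exp (-((1 + ε) * φ ζ)) ≤
            3 * (‖F ζ‖ * Real.exp (-(1 * φ ζ))) + C * κ * W ζ) ∧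
          (∀ ζ, dist ζ z < r z / 8 → ‖F ζ‖ * Real.exp (-(1 * φ ζ)) ≤
            ‖f ζ‖ * Real.exp (-((1 + ε) * φ ζ)) + C * κ * W ζ) ∧
          (∀ ζ, r z / 8 ≤ dist ζ z → ‖F ζ‖ * Real.exp (-(1 * φ ζ)) ≤ C * κ * W ζ) := by
  obtain ⟨c, η, C1, hc, hη, hη2, hC1, hloc⟩ := h.local_holo hφ
  obtain ⟨B, hB0, hbump⟩ := bump_exists (α := 1 / 16) (β := 1 / 8) (by norm_num) (by norm_num)
  obtain ⟨C2, hC2, hsol⟩ := h.dbar_solve hφ (t := 1) one_pos hL M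
  refine ⟨3 * (C2 * B), by positivity, ?_⟩
  intro κ hκ N hN r hr
  have hε0 : 0 < 1 / (C1 * N + 1) := by positivity
  have hεN : 1 / (C1 * N + 1) * (C1 * N) ≤ 1 := by
    rw [one_div_mul_eq_div, div_le_one (by positivity)]; linarith
  refine ⟨1 / (C1 * N + 1), hε0, ?_, ?_⟩
  · rw [div_le_one (by positivity)]
    have : 0 < C1 * N := by positivity
    linarith
  generalize 1 / (C1 * N + 1) = ε at hε0 hεN
  intro f hf z W hW0 hWf hfW
  have hρ := h.rho_pos z
  have hR : 0 < r z := hρ.trans_le (hr.rho_le z)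
  obtain ⟨G, hGd, hG1, -, -⟩ := hloc z (r z / 2) (by positivity)
  obtain ⟨χ, hχ, hχ0, hχ1, hχa, hχb, hχB⟩ := hbump z (r z) hR
  have hsub : ball z (r z / 4) ⊆ ball z ((1 - η) * (r z / 2)) := ball_subset_ball (by nlinarith)
  have hGd : DifferentiableOn ℂ (fun w => f w * Complex.exp (-(ε * G w))) (ball z (r z / 4)) :=
    hf.differentiableOn.mul ((hGd.mono hsub).const_mul _).neg.cexp
  obtain ⟨hKc, hKs, hd1, hd2, hd3⟩ := cutK hR (show 1 / 8 * r z < r z / 4 by linarith) hχ hχa hχb hχB hGd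
  have nG : ∀ w, ‖f w * Complex.exp (-(ε * G w))‖ = ‖f w‖ * Real.exp (-(ε * (G w).re)) := fun w => by
    rw [norm_mul, Complex.norm_exp]; simp
  set Q : ℂ → ℂ := fun w => f w * Complex.exp (-(ε * G w)) with hQ
  set Kf : ℂ → ℂ := fun z => (χ z : ℂ) * Q z with hKf
  have nGle : ∀ w, dist w z ≤ r z / 8 → ‖Q w‖ ≤ ‖f w‖ * Real.exp (-(ε * φ w)) := by
    intro w hw
    rw [nG]
    have := (hG1 w (hsub (by rw [mem_ball]; linarith))).1
    gcongr
  have nGge : ∀ w, dist w z ≤ r z / 8 → ‖f w‖ * Real.exp (-(ε * φ w)) ≤ 3 * ‖Q w‖ := by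
    intro w hw
    rw [nG]
    have e1 := (hG1 w (hsub (by rw [mem_ball]; linarith))).2
    have e2 : C1 * μ.real (ball z (r z / 2)) ≤ C1 * N := by gcongr; exact hr.mass z
    have e3 : Real.exp (-(ε * φ w)) ≤ Real.exp 1 * Real.exp (-(ε * (G w).re)) := by
      rw [← Real.exp_add]; apply Real.exp_le_exp.2
      nlinarith
    have e4 : Real.exp 1 ≤ 3 := by have := Real.exp_one_lt_d9; linarith
    calc _ ≤ ‖f w‖ * (3 * Real.exp (-(ε * (G w).re))) := by
          gcongr
          exact e3.trans (by gcongr)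
      _ = _ := by ring
  have esplit : ∀ w, Real.exp (-(ε * φ w)) = Real.exp (-((1 + ε) * φ w)) * Real.exp (1 * φ w) := by
    intro w; rw [← Real.exp_add]; congr 1; ring
  have einv : ∀ w, Real.exp (1 * φ w) * Real.exp (-(1 * φ w)) = 1 := by
    intro w; rw [← Real.exp_add]; simp
  obtain ⟨H, hHd, -, hH⟩ := hsol (fun ζ => B * κ * W ζ) (fun ζ => by have := hW0 ζ; positivity)
    (fun x y => by
      have := hWf x y
      have hbk : 0 ≤ B * κ := by positivity
      calc B * κ * W y ≤ B * κ * (L * Dd ρ x y ^ M * W x) := by gcongr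
        _ = _ := by ring) (dbar Kf) (dbar_nice hKc hKs).meas (by
      obtain ⟨R0, -, h0⟩ := (dbar_nice hKc hKs).supp
      exact ⟨R0, fun ζ hζ => h0 ζ fun hb => hζ (ball_subset_closedBall hb)⟩) (by
      intro ζ
      have hpos : 0 ≤ B * κ * W ζ * Real.exp (1 * φ ζ) := by have := hW0 ζ; positivity
      by_cases h2 : 1 / 8 * r z < dist ζ z
      · rw [hd2 ζ h2]; simpa using hpos
      push Not at h2
      have hρζ := h.rho_pos ζ
      have e1 := hr.small z ζ (by linarith)
      have e2 := nGle ζ (by linarith)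
      have e3 := hfW ζ (by linarith)
      calc _ ≤ (B / r z * (‖f ζ‖ * Real.exp (-(ε * φ ζ)))) * (κ * r z) := by
            gcongr
            exact (hd3 ζ h2).trans (by gcongr)
        _ = B * κ * (‖f ζ‖ * Real.exp (-((1 + ε) * φ ζ))) * Real.exp (1 * φ ζ) := by
            rw [esplit]; field_simp
        _ ≤ _ := by gcongr)
  have hH' : ∀ ζ, ‖Kf ζ - H ζ‖ * Real.exp (-(1 * φ ζ)) ≤ C2 * B * κ * W ζ := by
    intro ζ
    have := hH ζ
    rw [pompeiu hKc hKs] at this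
    calc _ ≤ (C2 * (B * κ * W ζ) * Real.exp (1 * φ ζ)) * Real.exp (-(1 * φ ζ)) := by gcongr
      _ = C2 * B * κ * W ζ * (Real.exp (1 * φ ζ) * Real.exp (-(1 * φ ζ))) := by ring
      _ = _ := by rw [einv, mul_one]
  have hnn : ∀ ζ, 0 ≤ C2 * B * κ * W ζ := fun ζ => by have := hW0 ζ; positivity
  refine ⟨H, hHd, ?_, ?_, ?_⟩
  · intro ζ hζ
    have e1 : Kf ζ = Q ζ := by simp only [hKf]; rw [hχa ζ (by linarith)]; simp
    have e2 := hH' ζ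
    have e3 := nGge ζ (by linarith)
    have e4 : ‖Q ζ‖ ≤ ‖H ζ‖ + ‖Kf ζ - H ζ‖ := by
      rw [← e1]; exact norm_le_norm_add_norm_sub' _ _
    calc _ = (‖f ζ‖ * Real.exp (-(ε * φ ζ))) * Real.exp (-(1 * φ ζ)) := by
          rw [esplit, mul_assoc, mul_assoc, einv, mul_one]
      _ ≤ (3 * (‖H ζ‖ + ‖Kf ζ - H ζ‖)) * Real.exp (-(1 * φ ζ)) := by
          exact mul_le_mul_of_nonneg_right (by linarith) (Real.exp_pos _).le
      _ = 3 * (‖H ζ‖ * Real.exp (-(1 * φ ζ))) + 3 * (‖Kf ζ - H ζ‖ * Real.exp (-(1 * φ ζ))) := by ring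
      _ ≤ 3 * (‖H ζ‖ * Real.exp (-(1 * φ ζ))) + 3 * (C2 * B * κ * W ζ) := by gcongr
      _ = _ := by ring
  · intro ζ hζ
    have e2 := hH' ζ
    have e3 := nGle ζ (by linarith)
    have e4 : ‖H ζ‖ ≤ ‖Kf ζ‖ + ‖Kf ζ - H ζ‖ := norm_le_norm_add_norm_sub _ _
    have e5 : ‖Kf ζ‖ ≤ ‖Q ζ‖ := by
      simp only [hKf]; rw [norm_mul, Complex.norm_real, Real.norm_eq_abs, abs_of_nonneg (hχ0 ζ)]
      have := hχ1 ζ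
      have := norm_nonneg (Q ζ)
      nlinarith
    calc _ ≤ (‖f ζ‖ * Real.exp (-(ε * φ ζ)) + ‖Kf ζ - H ζ‖) * Real.exp (-(1 * φ ζ)) := by
          gcongr; linarith
      _ = ‖f ζ‖ * Real.exp (-((1 + ε) * φ ζ)) + ‖Kf ζ - H ζ‖ * Real.exp (-(1 * φ ζ)) := by
          rw [add_mul, esplit, mul_assoc, mul_assoc, einv, mul_one]
      _ ≤ _ := by linarith [hnn ζ]
  · intro ζ hζ
    have e2 := hH' ζ
    have e1 : Kf ζ = 0 := by simp only [hKf]; rw [hχb ζ (by linarith)]; simp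
    rw [e1, zero_sub, norm_neg] at e2
    linarith [hnn ζ]

end DGeo
end

noncomputable section

lemma add_rpow_le {x y q : ℝ} (hx : 0 ≤ x) (hy : 0 ≤ y) (hq : 0 ≤ q) :
    (x + y) ^ q ≤ 2 ^ q * (x ^ q + y ^ q) := by
  have hx' := Real.rpow_nonneg hx q
  have hy' := Real.rpow_nonneg hy q
  rcases le_total x y with hxy | hxy
  · calc (x + y) ^ q ≤ (2 * y) ^ q := by
          apply Real.rpow_le_rpow (by linarith) (by linarith) hq
      _ = 2 ^ q * y ^ q := Real.mul_rpow (by norm_num) hy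
      _ ≤ _ := by gcongr; linarith
  · calc (x + y) ^ q ≤ (2 * x) ^ q := by
          apply Real.rpow_le_rpow (by linarith) (by linarith) hq
      _ = 2 ^ q * x ^ q := Real.mul_rpow (by norm_num) hx
      _ ≤ _ := by gcongr; linarith

lemma Fnorm_top (t : ℝ) (φ ω ρ : ℂ → ℝ) (f : ℂ → ℂ) :
    Fnorm ∞ (fun z => t * φ z) ω ρ f = ⨆ z, ENNReal.ofReal (nf t φ ω f z) := by
  simp [Fnorm, nf]

lemma lnorm_top (t : ℝ) (φ ω : ℂ → ℝ) (Λ : Set ℂ) (f : ℂ → ℂ) :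
    lnorm ∞ (fun z => t * φ z) ω Λ f = ⨆ l : Λ, ENNReal.ofReal (nf t φ ω f l.1) := by
  simp [lnorm, nf]

lemma nf_rpow {t q : ℝ} {φ ω : ℂ → ℝ} (hω : ∀ z, 0 < ω z) (f : ℂ → ℂ) (z : ℂ) :
    nf t φ ω f z ^ q = ω z ^ q * ‖f z‖ ^ q * Real.exp (-(q * (t * φ z))) := by
  have := hω z
  unfold nf
  rw [Real.mul_rpow (by positivity) (by positivity), Real.mul_rpow (by positivity) (by positivity),
    ← Real.exp_mul]
  congr 2
  ring

lemma Fnorm_nf {p : ℝ≥0∞} (hp : p ≠ ∞) (t : ℝ) (φ : ℂ → ℝ) {ω : ℂ → ℝ} (hω : ∀ z, 0 < ω z) (ρ : ℂ → ℝ) (f : ℂ → ℂ) :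
    Fnorm p (fun z => t * φ z) ω ρ f =
      (∫⁻ z, ENNReal.ofReal (nf t φ ω f z ^ p.toReal / ρ z ^ 2)) ^ (1 / p.toReal) := by
  unfold Fnorm
  rw [if_neg hp]
  congr 2
  ext z
  rw [nf_rpow hω]
  congr 2
  ring

lemma lnorm_nf {p : ℝ≥0∞} (hp : p ≠ ∞) (t : ℝ) (φ : ℂ → ℝ) {ω : ℂ → ℝ} (hω : ∀ z, 0 < ω z) (Λ : Set ℂ) (f : ℂ → ℂ) :
    lnorm p (fun z => t * φ z) ω Λ f =
      (∑' l : Λ, ENNReal.ofReal (nf t φ ω f l.1 ^ p.toReal)) ^ (1 / p.toReal) := by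
  unfold lnorm
  rw [if_neg hp]
  congr 2
  ext l
  rw [nf_rpow hω]

namespace DGeo
variable {μ : Measure ℂ} {ρ : ℂ → ℝ} {φ : ℂ → ℝ}

/-- smoothed average -/
def Vk (ρ : ℂ → ℝ) (M : ℕ) (S : Set ℂ) (A : ℂ → ℝ≥0∞) (ζ : ℂ) : ℝ≥0∞ :=
  ∫⁻ w in S, A w * ENNReal.ofReal ((Dd ρ ζ w ^ M)⁻¹)

lemma Vk_le (h : DGeo μ ρ) (M : ℕ) (S : Set ℂ) (A : ℂ → ℝ≥0∞) (ζ : ℂ) : Vk ρ M S A ζ ≤ ∫⁻ w in S, A w := by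
  apply lintegral_mono
  intro w
  have h1 : (Dd ρ ζ w ^ M)⁻¹ ≤ 1 := inv_le_one_of_one_le₀ (one_le_pow₀ (h.Dd_ge ζ w))
  calc A w * ENNReal.ofReal ((Dd ρ ζ w ^ M)⁻¹) ≤ A w * ENNReal.ofReal 1 := by gcongr
    _ = A w := by simp

lemma kern_meas (h : DGeo μ ρ) (M : ℕ) : Measurable fun x : ℂ × ℂ => ENNReal.ofReal ((Dd ρ x.1 x.2 ^ M)⁻¹) :=
  ((h.Dd_meas.pow_const M).inv).ennreal_ofReal

lemma Vk_meas (h : DGeo μ ρ) (M : ℕ) (S : Set ℂ) {A : ℂ → ℝ≥0∞} (hA : Measurable A) : Measurable (Vk ρ M S A) := by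
  apply Measurable.lintegral_prod_right' (f := fun x : ℂ × ℂ => A x.2 * ENNReal.ofReal ((Dd ρ x.1 x.2 ^ M)⁻¹))
  exact (hA.comp measurable_snd).mul (h.kern_meas M)

lemma Vk_flat (h : DGeo μ ρ) (M : ℕ) (S : Set ℂ) {A : ℂ → ℝ≥0∞} (hfin : ∫⁻ w in S, A w < ∞) (x y : ℂ) :
    (Vk ρ M S A y).toReal ≤ Dd ρ x y ^ M * (Vk ρ M S A x).toReal := by
  have hf : ∀ ζ, Vk ρ M S A ζ ≠ ∞ := fun ζ => ((h.Vk_le M S A ζ).trans_lt hfin).ne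
  have h0 := h.Dd_pos x y
  have h1 : Vk ρ M S A y ≤ ENNReal.ofReal (Dd ρ x y ^ M) * Vk ρ M S A x := by
    unfold Vk
    rw [← lintegral_const_mul' _ _ (by simp)]
    apply lintegral_mono
    intro w
    have h2 := h.Dd_pos x w
    have h3 := h.Dd_pos y w
    have h4 := h.Dd_tri x y w
    calc A w * ENNReal.ofReal ((Dd ρ y w ^ M)⁻¹)
        ≤ A w * ENNReal.ofReal (Dd ρ x y ^ M * (Dd ρ x w ^ M)⁻¹) := by
          gcongr
          rw [inv_le_iff_one_le_mul₀ (by positivity), mul_right_comm, ← mul_pow, ← div_eq_mul_inv,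
            one_le_div (by positivity)]
          gcongr
      _ = _ := by rw [ENNReal.ofReal_mul (by positivity)]; ring
  calc _ ≤ (ENNReal.ofReal (Dd ρ x y ^ M) * Vk ρ M S A x).toReal :=
        ENNReal.toReal_mono (ENNReal.mul_ne_top (by simp) (hf x)) h1
    _ = _ := by rw [ENNReal.toReal_mul, ENNReal.toReal_ofReal (by positivity)]

lemma Vk_int (h : DGeo μ ρ) : ∃ (M0 : ℕ) (C : ℝ), 0 < C ∧ ∀ M, M0 ≤ M → ∀ S : Set ℂ, ∀ A : ℂ → ℝ≥0∞, Measurable A →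
    ∫⁻ ζ, Vk ρ M S A ζ * ENNReal.ofReal (1 / ρ ζ ^ 2) ≤ ENNReal.ofReal C * ∫⁻ w in S, A w := by
  obtain ⟨M0, C, hC, hinteg⟩ := h.lint_Dd'
  refine ⟨M0, C, hC, fun M hM S A hA => ?_⟩
  have hr : Measurable fun ζ => ENNReal.ofReal (1 / ρ ζ ^ 2) := by
    have := h.rho_cont.measurable
    fun_prop
  calc _ = ∫⁻ ζ, ∫⁻ w in S, A w * ENNReal.ofReal ((Dd ρ ζ w ^ M)⁻¹) * ENNReal.ofReal (1 / ρ ζ ^ 2) := by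
        congr 1; ext ζ
        unfold Vk
        rw [lintegral_mul_const' _ _ (by simp)]
    _ = ∫⁻ w in S, ∫⁻ ζ, A w * ENNReal.ofReal ((Dd ρ ζ w ^ M)⁻¹) * ENNReal.ofReal (1 / ρ ζ ^ 2) := by
        apply lintegral_lintegral_swap
        apply Measurable.aemeasurable
        exact ((hA.comp measurable_snd).mul (h.kern_meas M)).mul (hr.comp measurable_fst)
    _ ≤ ∫⁻ w in S, A w * ENNReal.ofReal C := by
        apply lintegral_mono
        intro w
        have hk : Measurable fun ζ => ENNReal.ofReal ((Dd ρ ζ w ^ M)⁻¹) * ENNReal.ofReal (1 / ρ ζ ^ 2) :=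
          ((h.kern_meas M).comp (measurable_id.prodMk measurable_const)).mul hr
        calc _ = A w * ∫⁻ ζ, ENNReal.ofReal ((Dd ρ ζ w ^ M)⁻¹) * ENNReal.ofReal (1 / ρ ζ ^ 2) := by
              rw [← lintegral_const_mul _ hk]
              refine lintegral_congr fun ζ => ?_
              ring
          _ ≤ A w * ENNReal.ofReal C := by
              refine mul_le_mul_right ?_ _
              refine le_trans (lintegral_mono fun ζ => ?_) (hinteg w)
              have := h.Dd_pos ζ w
              have := h.rho_pos ζ
              rw [← ENNReal.ofReal_mul (by positivity)]
              apply ENNReal.ofReal_le_ofReal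
              have := h.inv_pow_mono ζ w hM
              rw [mul_one_div]
              gcongr
    _ = _ := by rw [lintegral_mul_const' _ _ (by simp), mul_comm]

lemma Vk_sum (h : DGeo μ ρ) {Λ : Set ℂ} (hsep : RhoSeparated ρ Λ) :
    ∃ (M0 : ℕ) (C : ℝ), 0 < C ∧ ∀ M, M0 ≤ M → ∀ S : Set ℂ, ∀ A : ℂ → ℝ≥0∞, Measurable A →
    ∑' l : Λ, Vk ρ M S A l.1 ≤ ENNReal.ofReal C * ∫⁻ w in S, A w := by
  obtain ⟨M0, C, hC, hinteg⟩ := h.sep_Dd' hsep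
  refine ⟨M0, C, hC, fun M hM S A hA => ?_⟩
  have : Countable Λ := (h.sep_countable hsep).to_subtype
  unfold Vk
  have hm : ∀ l : Λ, AEMeasurable (fun w => A w * ENNReal.ofReal ((Dd ρ l.1 w ^ M)⁻¹)) (volume.restrict S) :=
    fun l => (hA.mul ((h.kern_meas M).comp (measurable_const.prodMk measurable_id))).aemeasurable
  rw [← lintegral_tsum hm]
  calc _ ≤ ∫⁻ w in S, A w * ENNReal.ofReal C := by
        apply lintegral_mono
        intro w
        beta_reduce
        rw [ENNReal.tsum_mul_left]
        refine mul_le_mul_right ?_ _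
        refine le_trans (ENNReal.tsum_le_tsum fun l => ?_) (hinteg w)
        exact ENNReal.ofReal_le_ofReal (h.inv_pow_mono l.1 w hM)
    _ = _ := by rw [lintegral_mul_const' _ _ (by simp), mul_comm]

lemma flat_inv {ω : ℂ → ℝ} (hω : IsFlatWeight ρ ω) : IsFlatWeight ρ (fun z => (ω z)⁻¹) := by
  obtain ⟨h1, h2, C, hC, h3⟩ := hω
  refine ⟨fun z => inv_pos.2 (h1 z), h2.inv, C, hC, fun z ζ => ?_⟩
  rw [Real.log_inv, Real.log_inv, neg_sub_neg, abs_sub_comm]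
  exact h3 z ζ

end DGeo
end

noncomputable section

lemma ofReal_aux3 {a b c : ℝ} (ha : 0 ≤ a) (hb : 0 ≤ b) : ENNReal.ofReal (a * b * c) =
    ENNReal.ofReal a * ENNReal.ofReal b * ENNReal.ofReal c := by
  rw [ENNReal.ofReal_mul (by positivity), ENNReal.ofReal_mul ha]

lemma ofReal_aux {a b c d e : ℝ} (ha : 0 ≤ a) (hb : 0 ≤ b) (hc : 0 ≤ c) (hd : 0 ≤ d) (he : 0 ≤ e) :
    ENNReal.ofReal (a * b * c * d + c * e) = ENNReal.ofReal a * ENNReal.ofReal b * ENNReal.ofReal c * ENNReal.ofReal d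
      + ENNReal.ofReal c * ENNReal.ofReal e := by
  rw [ENNReal.ofReal_add (by positivity) (by positivity), ENNReal.ofReal_mul (by positivity),
    ofReal_aux3 ha hb, ENNReal.ofReal_mul hc]

namespace DGeo
variable {μ : Measure ℂ} {ρ : ℂ → ℝ} {φ : ℂ → ℝ}

set_option maxHeartbeats 1000000 in
lemma samp_local (h : DGeo μ ρ) (hφ : HasDoublingLaplacian φ μ) {q : ℝ} (hq : 1 ≤ q) {ω : ℂ → ℝ}
    (hω : IsFlatWeight ρ ω) {Λ : Set ℂ} (hsep : RhoSeparated ρ Λ) {Cs : ℝ} (hCs : 0 ≤ Cs)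
    (hs : ∀ F : ℂ → ℂ, Differentiable ℂ F → ∫⁻ z, ENNReal.ofReal (nf 1 φ ω F z ^ q / ρ z ^ 2) < ∞ →
      ∫⁻ z, ENNReal.ofReal (nf 1 φ ω F z ^ q / ρ z ^ 2) ≤
        ENNReal.ofReal Cs * ∑' l : Λ, ENNReal.ofReal (nf 1 φ ω F l.1 ^ q)) :
    ∃ K : ℝ, 0 < K ∧ ∀ κ : ℝ, 0 < κ → κ ≤ 1 / 8 → ∀ N : ℝ, 1 ≤ N → ∀ r : ℂ → ℝ, Scale μ ρ κ N r →
      ∃ ε : ℝ, 0 < ε ∧ ε ≤ 1 ∧ ∀ f : ℂ → ℂ, Differentiable ℂ f →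
        ∫⁻ z, ENNReal.ofReal (nf (1 + ε) φ ω f z ^ q / ρ z ^ 2) < ∞ → ∀ z : ℂ,
        ∫⁻ w in ball z (r z / 16), ENNReal.ofReal (nf (1 + ε) φ ω f w ^ q / ρ w ^ 2) ≤
          ENNReal.ofReal K * ∑' l : Λ, (ball z (r z / 8)).indicator
            (fun w => ENNReal.ofReal (nf (1 + ε) φ ω f w ^ q)) l.1 +
          ENNReal.ofReal (K * κ ^ q) *
            ∫⁻ w in ball z (r z / 4), ENNReal.ofReal (nf (1 + ε) φ ω f w ^ q / ρ w ^ 2) := by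
  obtain ⟨m, L, hL, hfl⟩ := h.flat (flat_inv hω)
  obtain ⟨M1, C1, hC1, hinteg⟩ := h.Vk_int
  obtain ⟨M2, C2, hC2, hsum⟩ := h.Vk_sum hsep
  set M := max M1 M2 with hM
  replace hinteg := hinteg M (le_max_left _ _)
  replace hsum := hsum M (le_max_right _ _)
  obtain ⟨C3, hC3, hmv⟩ := h.mvq hφ (T := 2) (δ := 1) one_pos le_rfl hq hω
  obtain ⟨C4, hC4, hcut⟩ := h.cutoff hφ hL (M + m)
  have hq0 : 0 < q := by linarith
  set A0 := C3 * 2 ^ M with hA0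
  have hA0pos : 0 < A0 := by positivity
  set k0 := 2 ^ q * C4 ^ q * A0 with hk0
  have hk0pos : 0 < k0 := by positivity
  set c6 : ℝ := 2 ^ q * 3 ^ q with hc6
  have hc6pos : 0 < c6 := by positivity
  have h2q : (0 : ℝ) < 2 ^ q := by positivity
  refine ⟨c6 * Cs * 2 ^ q + (c6 * Cs * k0 * C2 + k0 * C1), by positivity, ?_⟩
  intro κ hκ hκ8 N hN r hr
  obtain ⟨ε, hε, hε1, hcut⟩ := hcut κ hκ N hN r hr
  refine ⟨ε, hε, hε1, ?_⟩
  intro f hf hfin z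
  have hωp := hω.1
  have hrz : 0 < r z := (h.rho_pos z).trans_le (hr.rho_le z)
  set a : ℂ → ℝ := nf (1 + ε) φ ω f with ha
  have ha0 : ∀ ζ, 0 ≤ a ζ := nf_nonneg hωp f
  have ham : Measurable a := nf_meas hω.2.1 hφ.continuous hf
  set A : ℂ → ℝ≥0∞ := fun w => ENNReal.ofReal (a w ^ q / ρ w ^ 2) with hA
  have hAm : Measurable A := by
    have := h.rho_cont.measurable
    fun_prop
  set S := ball z (r z / 4) with hS
  have hSfin : ∫⁻ w in S, A w < ∞ := (setLIntegral_le_lintegral _ _).trans_lt hfin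
  set V : ℂ → ℝ≥0∞ := Vk ρ M S A with hV
  have hVfin : ∀ ζ, V ζ ≠ ∞ := fun ζ => ((h.Vk_le M S A ζ).trans_lt hSfin).ne
  have hv0 : ∀ ζ, 0 ≤ (V ζ).toReal := fun ζ => ENNReal.toReal_nonneg
  set s : ℂ → ℝ := fun ζ => (A0 * (V ζ).toReal) ^ (1 / q) with hsdef
  have hs0 : ∀ ζ, 0 ≤ s ζ := fun ζ => Real.rpow_nonneg (by have := hv0 ζ; positivity) _
  have hsq : ∀ ζ, s ζ ^ q = A0 * (V ζ).toReal := by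
    intro ζ
    simp only [hsdef]
    rw [← Real.rpow_mul (by have := hv0 ζ; positivity), one_div_mul_cancel hq0.ne', Real.rpow_one]
  -- pointwise bound of a by s
  have has : ∀ ζ, dist ζ z ≤ r z / 8 → a ζ ≤ s ζ := by
    intro ζ hζ
    rw [← Real.rpow_le_rpow_iff (ha0 ζ) (hs0 ζ) hq0, hsq]
    have h1 := hmv (1 + ε) (by linarith) (by linarith) f hf ζ
    rw [one_mul] at h1
    have hρs : ρ ζ ≤ r z / 8 := (hr.small z ζ (by linarith)).trans (by nlinarith)
    have hsub : ball ζ (ρ ζ) ⊆ S := ball_subset_ball' (by linarith)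
    have h2 : ∫⁻ w in ball ζ (ρ ζ), A w ≤ ENNReal.ofReal (2 ^ M) * V ζ := by
      rw [hV]; unfold Vk
      rw [← lintegral_const_mul' _ _ (by simp)]
      refine le_trans (setLIntegral_mono' measurableSet_ball fun w hw => ?_) (lintegral_mono_set hsub)
      have d1 := h.Dd_le_two (mem_ball.1 hw).le
      have d0 := h.Dd_pos ζ w
      calc A w = A w * ENNReal.ofReal 1 := by simp
        _ ≤ A w * ENNReal.ofReal (2 ^ M * (Dd ρ ζ w ^ M)⁻¹) := by
            refine mul_le_mul_right ?_ _
            apply ENNReal.ofReal_le_ofReal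
            rw [← div_eq_mul_inv, one_le_div (by positivity)]
            gcongr
        _ = _ := by rw [ENNReal.ofReal_mul (by positivity)]; ring
    have h3 : ENNReal.ofReal (a ζ ^ q) ≤ ENNReal.ofReal (A0 * (V ζ).toReal) := by
      calc _ ≤ ENNReal.ofReal C3 * (ENNReal.ofReal (2 ^ M) * V ζ) := h1.trans (mul_le_mul_right h2 _)
        _ = _ := by
          rw [hA0, ENNReal.ofReal_mul (by positivity), ENNReal.ofReal_mul hC3.le, ENNReal.ofReal_toReal (hVfin ζ),
            mul_assoc]
    exact (ENNReal.ofReal_le_ofReal_iff (by have := hv0 ζ; positivity)).1 h3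
  set W : ℂ → ℝ := fun ζ => s ζ * (ω ζ)⁻¹ with hW
  have hWω : ∀ ζ, ω ζ * W ζ = s ζ := fun ζ => by
    have := (hωp ζ).ne'
    simp only [hW]; field_simp
  have haω : ∀ ζ, a ζ = ω ζ * (‖f ζ‖ * Real.exp (-((1 + ε) * φ ζ))) := fun ζ => by simp only [ha, nf]; ring
  obtain ⟨F, hFd, hF1, hF2, hF3⟩ := hcut f hf z W
    (fun ζ => mul_nonneg (hs0 ζ) (inv_nonneg.2 (hωp ζ).le))
    (fun x y => by
      have h1 := h.Vk_flat M S hSfin x y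
      have h2 : (1:ℝ) ≤ Dd ρ x y ^ M := one_le_pow₀ (h.Dd_ge x y)
      have h3 : s y ≤ Dd ρ x y ^ M * s x := by
        simp only [hsdef]
        calc _ ≤ (Dd ρ x y ^ M * (A0 * (V x).toReal)) ^ (1 / q) := by
              apply Real.rpow_le_rpow (by have := hv0 y; positivity) _ (by positivity)
              calc _ ≤ A0 * (Dd ρ x y ^ M * (V x).toReal) := by gcongr
                _ = _ := by ring
          _ = (Dd ρ x y ^ M) ^ (1 / q) * (A0 * (V x).toReal) ^ (1 / q) :=
              Real.mul_rpow (by linarith) (by have := hv0 x; positivity)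
          _ ≤ _ := by
              gcongr
              calc (Dd ρ x y ^ M) ^ (1 / q) ≤ (Dd ρ x y ^ M) ^ (1:ℝ) := by
                    apply Real.rpow_le_rpow_of_exponent_le h2
                    rw [div_le_one hq0]; exact hq
                _ = _ := Real.rpow_one _
      have h4 := hfl x y
      have h5 := hs0 x
      have h6 := hωp y
      have h7 := hωp x
      have h8 := h.Dd_pos x y
      simp only [hW]
      calc _ ≤ (Dd ρ x y ^ M * s x) * (L * Dd ρ x y ^ m * (ω x)⁻¹) := by gcongr
        _ = _ := by rw [pow_add]; ring)
    (fun ζ hζ => by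
      have h1 := has ζ hζ
      rw [haω, ← hWω] at h1
      exact le_of_mul_le_mul_left h1 (hωp ζ))
  set b : ℂ → ℝ := nf 1 φ ω F with hb
  have hb0 : ∀ ζ, 0 ≤ b ζ := nf_nonneg hωp F
  have hbm : Measurable b := nf_meas hω.2.1 hφ.continuous hFd
  have hbω : ∀ ζ, b ζ = ω ζ * (‖F ζ‖ * Real.exp (-(1 * φ ζ))) := fun ζ => by simp only [hb, nf]; ring
  have hcks : ∀ ζ, 0 ≤ C4 * κ * s ζ := fun ζ => by have := hs0 ζ; positivity
  have hksq : ∀ ζ, 2 ^ q * (C4 * κ * s ζ) ^ q = k0 * κ ^ q * (V ζ).toReal := by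
    intro ζ
    rw [Real.mul_rpow (by positivity) (hs0 ζ), Real.mul_rpow hC4.le hκ.le, hsq, hk0]; ring
  have P1 : ∀ ζ, dist ζ z < r z / 16 → a ζ ^ q ≤ c6 * b ζ ^ q + k0 * κ ^ q * (V ζ).toReal := by
    intro ζ hζ
    have h1 : a ζ ≤ 3 * b ζ + C4 * κ * s ζ := by
      rw [haω, hbω, ← hWω]
      have := mul_le_mul_of_nonneg_left (hF1 ζ hζ) (hωp ζ).le
      linarith
    calc a ζ ^ q ≤ (3 * b ζ + C4 * κ * s ζ) ^ q := Real.rpow_le_rpow (ha0 ζ) h1 hq0.le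
      _ ≤ 2 ^ q * ((3 * b ζ) ^ q + (C4 * κ * s ζ) ^ q) :=
          add_rpow_le (by have := hb0 ζ; positivity) (hcks ζ) hq0.le
      _ = _ := by rw [mul_add, hksq, Real.mul_rpow (by norm_num) (hb0 ζ), hc6]; ring
  have P2 : ∀ ζ, dist ζ z < r z / 8 → b ζ ^ q ≤ 2 ^ q * a ζ ^ q + k0 * κ ^ q * (V ζ).toReal := by
    intro ζ hζ
    have h1 : b ζ ≤ a ζ + C4 * κ * s ζ := by
      rw [haω, hbω, ← hWω]
      have := mul_le_mul_of_nonneg_left (hF2 ζ hζ) (hωp ζ).le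
      linarith
    calc b ζ ^ q ≤ (a ζ + C4 * κ * s ζ) ^ q := Real.rpow_le_rpow (hb0 ζ) h1 hq0.le
      _ ≤ 2 ^ q * (a ζ ^ q + (C4 * κ * s ζ) ^ q) := add_rpow_le (ha0 ζ) (hcks ζ) hq0.le
      _ = _ := by rw [mul_add, hksq]
  have P3 : ∀ ζ, r z / 8 ≤ dist ζ z → b ζ ^ q ≤ k0 * κ ^ q * (V ζ).toReal := by
    intro ζ hζ
    have h1 : b ζ ≤ 0 + C4 * κ * s ζ := by
      rw [hbω, ← hWω]
      have := mul_le_mul_of_nonneg_left (hF3 ζ hζ) (hωp ζ).le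
      linarith
    calc b ζ ^ q ≤ (0 + C4 * κ * s ζ) ^ q := Real.rpow_le_rpow (hb0 ζ) h1 hq0.le
      _ ≤ 2 ^ q * (0 ^ q + (C4 * κ * s ζ) ^ q) := add_rpow_le le_rfl (hcks ζ) hq0.le
      _ = _ := by rw [mul_add, hksq, Real.zero_rpow hq0.ne']; ring
  set k := k0 * κ ^ q with hk
  have hk0 : 0 ≤ k := by positivity
  have haq : ∀ ζ, 0 ≤ a ζ ^ q := fun ζ => Real.rpow_nonneg (ha0 ζ) _
  have hbq : ∀ ζ, 0 ≤ b ζ ^ q := fun ζ => Real.rpow_nonneg (hb0 ζ) _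
  have hVr : ∀ ζ, ENNReal.ofReal (k * (V ζ).toReal) = ENNReal.ofReal k * V ζ := fun ζ => by
    rw [ENNReal.ofReal_mul hk0, ENNReal.ofReal_toReal (hVfin ζ)]
  have hdiv : ∀ x ζ, 0 ≤ x → ENNReal.ofReal (x / ρ ζ ^ 2) = ENNReal.ofReal x * ENNReal.ofReal (1 / ρ ζ ^ 2) :=
    fun x ζ hx => by rw [← ENNReal.ofReal_mul hx, mul_one_div]
  have E2 : ∀ ζ, ENNReal.ofReal (b ζ ^ q) ≤ ENNReal.ofReal (2 ^ q) *
      (ball z (r z / 8)).indicator (fun w => ENNReal.ofReal (a w ^ q)) ζ + ENNReal.ofReal k * V ζ := by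
    intro ζ
    by_cases hζ : dist ζ z < r z / 8
    · rw [Set.indicator_of_mem (mem_ball.2 hζ), ← hVr, ← ENNReal.ofReal_mul h2q.le,
        ← ENNReal.ofReal_add (mul_nonneg h2q.le (haq ζ)) (mul_nonneg hk0 (hv0 ζ))]
      exact ENNReal.ofReal_le_ofReal (P2 ζ hζ)
    · push Not at hζ
      rw [← hVr]
      exact le_add_left (ENNReal.ofReal_le_ofReal (P3 ζ hζ))
  have hVint := hinteg S A hAm
  have hVsum := hsum S A hAm
  have hrm : Measurable fun ζ => ENNReal.ofReal (1 / ρ ζ ^ 2) := by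
    have := h.rho_cont.measurable
    fun_prop
  have hVm : Measurable V := h.Vk_meas M S hAm
  have hVrm : Measurable fun w => ENNReal.ofReal k * (V w * ENNReal.ofReal (1 / ρ w ^ 2)) :=
    (hVm.mul hrm).const_mul _
  have hFfin : ∫⁻ ζ, ENNReal.ofReal (b ζ ^ q / ρ ζ ^ 2) < ∞ := by
    calc _ ≤ ∫⁻ ζ, (ENNReal.ofReal (2 ^ q) * A ζ + ENNReal.ofReal k * (V ζ * ENNReal.ofReal (1 / ρ ζ ^ 2))) := by
          refine lintegral_mono fun ζ => ?_
          beta_reduce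
          rw [hdiv _ ζ (hbq ζ)]
          refine (mul_le_mul_left (E2 ζ) _).trans ?_
          simp only [hA]
          rw [hdiv _ ζ (haq ζ), add_mul]
          refine add_le_add ?_ (by rw [mul_assoc])
          rw [mul_assoc]
          refine mul_le_mul_right (mul_le_mul_left ?_ _) _
          exact Set.indicator_le_self _ _ _
      _ = ENNReal.ofReal (2 ^ q) * (∫⁻ ζ, A ζ) + ENNReal.ofReal k * ∫⁻ ζ, V ζ * ENNReal.ofReal (1 / ρ ζ ^ 2) := by
          rw [lintegral_add_left (hAm.const_mul _), lintegral_const_mul' _ _ (by simp), lintegral_const_mul' _ _ (by simp)]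
      _ < ∞ := by
          refine ENNReal.add_lt_top.2 ⟨ENNReal.mul_lt_top (by simp) hfin, ENNReal.mul_lt_top (by simp) ?_⟩
          exact hVint.trans_lt (ENNReal.mul_lt_top (by simp) hSfin)
  have hsF := hs F hFd hFfin
  set I := ∫⁻ w in S, A w with hI
  set Sg := ∑' l : Λ, (ball z (r z / 8)).indicator (fun w => ENNReal.ofReal (a w ^ q)) l.1 with hSg
  have hsumF : ∑' l : Λ, ENNReal.ofReal (b l.1 ^ q) ≤ ENNReal.ofReal (2 ^ q) * Sg +
      ENNReal.ofReal k * (ENNReal.ofReal C2 * I) := by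
    calc _ ≤ _ := ENNReal.tsum_le_tsum fun l : Λ => E2 l.1
      _ = ENNReal.ofReal (2 ^ q) * Sg + ENNReal.ofReal k * ∑' l : Λ, V l.1 := by
          rw [ENNReal.tsum_add, ENNReal.tsum_mul_left, ENNReal.tsum_mul_left]
      _ ≤ _ := by gcongr
  calc ∫⁻ w in ball z (r z / 16), A w
      ≤ ∫⁻ w in ball z (r z / 16), (ENNReal.ofReal c6 * ENNReal.ofReal (b w ^ q / ρ w ^ 2) +
          ENNReal.ofReal k * (V w * ENNReal.ofReal (1 / ρ w ^ 2))) := by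
        refine setLIntegral_mono' measurableSet_ball fun ζ hζ => ?_
        simp only [hA]
        rw [hdiv _ ζ (haq ζ), hdiv _ ζ (hbq ζ), ← mul_assoc, ← mul_assoc, ← add_mul, ← hVr, ← ENNReal.ofReal_mul hc6pos.le,
          ← ENNReal.ofReal_add (mul_nonneg hc6pos.le (hbq ζ)) (mul_nonneg hk0 (hv0 ζ))]
        exact mul_le_mul_left (ENNReal.ofReal_le_ofReal (P1 ζ hζ)) _
    _ ≤ ∫⁻ w, (ENNReal.ofReal c6 * ENNReal.ofReal (b w ^ q / ρ w ^ 2) +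
          ENNReal.ofReal k * (V w * ENNReal.ofReal (1 / ρ w ^ 2))) := setLIntegral_le_lintegral _ _
    _ = ENNReal.ofReal c6 * (∫⁻ w, ENNReal.ofReal (b w ^ q / ρ w ^ 2)) +
          ENNReal.ofReal k * ∫⁻ w, V w * ENNReal.ofReal (1 / ρ w ^ 2) := by
        rw [lintegral_add_right _ hVrm, lintegral_const_mul' _ _ (by simp),
          lintegral_const_mul' _ _ (by simp)]
    _ ≤ ENNReal.ofReal c6 * (ENNReal.ofReal Cs * (ENNReal.ofReal (2 ^ q) * Sg +
          ENNReal.ofReal k * (ENNReal.ofReal C2 * I))) + ENNReal.ofReal k * (ENNReal.ofReal C1 * I) := by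
        refine add_le_add (mul_le_mul_right ?_ _) (mul_le_mul_right hVint _)
        exact hsF.trans (mul_le_mul_right hsumF _)
    _ = ENNReal.ofReal (c6 * Cs * 2 ^ q) * Sg + ENNReal.ofReal ((c6 * Cs * k0 * C2 + k0 * C1) * κ ^ q) * I := by
        rw [show (c6 * Cs * k0 * C2 + k0 * C1) * κ ^ q = c6 * Cs * k * C2 + k * C1 by rw [hk]; ring,
          ofReal_aux hc6pos.le hCs hk0 hC2.le hC1.le, ofReal_aux3 hc6pos.le hCs]
        ring
    _ ≤ _ := by
        have h1 : 0 ≤ κ ^ q := by positivity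
        have h2 : 0 ≤ c6 * Cs * k0 * C2 + k0 * C1 := by positivity
        have h3 : 0 ≤ c6 * Cs * 2 ^ q := by positivity
        refine add_le_add (mul_le_mul_left (ENNReal.ofReal_le_ofReal (by linarith)) _)
          (mul_le_mul_left (ENNReal.ofReal_le_ofReal (mul_le_mul_of_nonneg_right (by linarith) h1)) _)

end DGeo
end

noncomputable section

namespace DGeo
variable {μ : Measure ℂ} {ρ : ℂ → ℝ} {φ : ℂ → ℝ}

/-- mass of centres seeing `w` -/
def Jr (r : ℂ → ℝ) (d : ℝ) (w : ℂ) : ℝ≥0∞ :=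
  ∫⁻ z, {z | dist w z < r z / d}.indicator (fun z => ENNReal.ofReal (1 / r z ^ 2)) z

lemma Scale.pos (h : DGeo μ ρ) {κ N : ℝ} {r : ℂ → ℝ} (hr : Scale μ ρ κ N r) (z : ℂ) : 0 < r z :=
  (h.rho_pos z).trans_le (hr.rho_le z)

lemma Scale.cont {κ N : ℝ} {r : ℂ → ℝ} (hr : Scale μ ρ κ N r) : Continuous r := by
  have : LipschitzWith 1 r := by
    apply LipschitzWith.of_le_add
    exact hr.lip
  exact this.continuous

lemma Jr_swap {r : ℂ → ℝ} (hr : Continuous r) (d : ℝ) {A : ℂ → ℝ≥0∞} (hA : Measurable A) :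
    ∫⁻ z, ENNReal.ofReal (1 / r z ^ 2) * ∫⁻ w in ball z (r z / d), A w = ∫⁻ w, A w * Jr r d w := by
  have hrm := hr.measurable
  have hm : Measurable fun z => ENNReal.ofReal (1 / r z ^ 2) := by fun_prop
  set U : Set (ℂ × ℂ) := {x | dist x.2 x.1 < r x.1 / d} with hU
  have hUm : MeasurableSet U := by
    apply measurableSet_lt <;> fun_prop
  calc _ = ∫⁻ z, ∫⁻ w, U.indicator (fun x => ENNReal.ofReal (1 / r x.1 ^ 2) * A x.2) (z, w) := by
        refine lintegral_congr fun z => ?_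
        rw [← lintegral_const_mul' _ _ (by simp), ← lintegral_indicator measurableSet_ball]
        refine lintegral_congr fun w => ?_
        by_cases hw : w ∈ ball z (r z / d)
        · rw [Set.indicator_of_mem hw, Set.indicator_of_mem (show (z, w) ∈ U from hw)]
        · rw [Set.indicator_of_notMem hw, Set.indicator_of_notMem (show (z, w) ∉ U from hw)]
    _ = ∫⁻ w, ∫⁻ z, U.indicator (fun x => ENNReal.ofReal (1 / r x.1 ^ 2) * A x.2) (z, w) := by
        apply lintegral_lintegral_swap
        apply Measurable.aemeasurable
        exact ((hm.comp measurable_fst).mul (hA.comp measurable_snd)).indicator hUm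
    _ = _ := by
        refine lintegral_congr fun w => ?_
        unfold Jr
        have hVm : MeasurableSet {z | dist w z < r z / d} := by
          apply measurableSet_lt <;> fun_prop
        rw [← lintegral_const_mul _ (hm.indicator hVm)]
        refine lintegral_congr fun z => ?_
        by_cases hw : dist w z < r z / d
        · rw [Set.indicator_of_mem (show (z, w) ∈ U from hw), Set.indicator_of_mem (show z ∈ {z | dist w z < r z / d} from hw), mul_comm]
        · rw [Set.indicator_of_notMem (show (z, w) ∉ U from hw), Set.indicator_of_notMem (show z ∉ {z | dist w z < r z / d} from hw), mul_zero]

lemma Jr_swap_sum {r : ℂ → ℝ} (hr : Continuous r) (d : ℝ) {Λ : Set ℂ} (hΛ : Λ.Countable) (B : ℂ → ℝ≥0∞) :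
    ∫⁻ z, ENNReal.ofReal (1 / r z ^ 2) * ∑' l : Λ, (ball z (r z / d)).indicator B l.1 = ∑' l : Λ, B l.1 * Jr r d l.1 := by
  have hrm := hr.measurable
  have hm : Measurable fun z => ENNReal.ofReal (1 / r z ^ 2) := by fun_prop
  have : Countable Λ := hΛ.to_subtype
  have hVm : ∀ w, MeasurableSet {z | dist w z < r z / d} := fun w => by
    apply measurableSet_lt <;> fun_prop
  have hm2 : ∀ l : Λ, AEMeasurable (fun z => B l.1 * {z | dist l.1 z < r z / d}.indicator (fun z => ENNReal.ofReal (1 / r z ^ 2)) z) volume :=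
    fun l => ((hm.indicator (hVm l.1)).const_mul _).aemeasurable
  calc _ = ∫⁻ z, ∑' l : Λ, B l.1 * {z | dist l.1 z < r z / d}.indicator (fun z => ENNReal.ofReal (1 / r z ^ 2)) z := by
        refine lintegral_congr fun z => ?_
        rw [← ENNReal.tsum_mul_left]
        congr 1; ext l
        by_cases hw : dist l.1 z < r z / d
        · rw [Set.indicator_of_mem (show l.1 ∈ ball z (r z / d) from hw), Set.indicator_of_mem (show z ∈ {z | dist l.1 z < r z / d} from hw), mul_comm]
        · rw [Set.indicator_of_notMem (show l.1 ∉ ball z (r z / d) from hw), Set.indicator_of_notMem (show z ∉ {z | dist l.1 z < r z / d} from hw), mul_zero, mul_zero]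
    _ = _ := by
        rw [lintegral_tsum hm2]
        congr 1; ext l
        unfold Jr
        rw [← lintegral_const_mul _ (hm.indicator (hVm l.1))]

lemma Jr_le {r : ℂ → ℝ} (h0 : ∀ z, 0 < r z) (hl : ∀ z w, r z ≤ r w + dist z w) {d : ℝ} (hd : 4 ≤ d) (w : ℂ) :
    Jr r d w ≤ ENNReal.ofReal 4 := by
  have hw := h0 w
  calc Jr r d w ≤ ∫⁻ z, (ball w (r w / 2)).indicator (fun _ => ENNReal.ofReal (25 / 16 / r w ^ 2)) z := by
        refine lintegral_mono fun z => ?_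
        by_cases hz : dist w z < r z / d
        · have h1 := hl z w
          have h2 := hl w z
          have hzp := h0 z
          have h3 : r z / d ≤ r z / 4 := by gcongr
          rw [dist_comm] at h1
          have hzb : z ∈ ball w (r w / 2) := by rw [mem_ball, dist_comm]; linarith
          rw [Set.indicator_of_mem (show z ∈ {z | dist w z < r z / d} from hz), Set.indicator_of_mem hzb]
          apply ENNReal.ofReal_le_ofReal
          rw [div_le_div_iff₀ (by positivity) (by positivity)]
          nlinarith
        · rw [Set.indicator_of_notMem (show z ∉ {z | dist w z < r z / d} from hz)]
          exact zero_le
    _ = ENNReal.ofReal (25 / 16 / r w ^ 2) * volume (ball w (r w / 2)) := by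
        rw [lintegral_indicator measurableSet_ball, setLIntegral_const]
    _ ≤ _ := by
        rw [volume_ball_real w (by positivity), ← ENNReal.ofReal_mul (by positivity)]
        apply ENNReal.ofReal_le_ofReal
        have := Real.pi_lt_d2
        have := Real.pi_pos
        field_simp
        nlinarith

lemma Jr_ge {r : ℂ → ℝ} (h0 : ∀ z, 0 < r z) (hl : ∀ z w, r z ≤ r w + dist z w) (w : ℂ) :
    ENNReal.ofReal (1 / 200) ≤ Jr r 16 w := by
  have hw := h0 w
  calc _ ≤ ENNReal.ofReal (1 / (6 / 5 * r w ^ 2)) * volume (ball w (r w / 20)) := by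
        rw [volume_ball_real w (by positivity), ← ENNReal.ofReal_mul (by positivity)]
        apply ENNReal.ofReal_le_ofReal
        have := Real.pi_gt_d2
        field_simp
        nlinarith
    _ = ∫⁻ z, (ball w (r w / 20)).indicator (fun _ => ENNReal.ofReal (1 / (6 / 5 * r w ^ 2))) z := by
        rw [lintegral_indicator measurableSet_ball, setLIntegral_const]
    _ ≤ _ := by
        refine lintegral_mono fun z => ?_
        by_cases hz : z ∈ ball w (r w / 20)
        · have h1 := hl z w
          have h2 := hl w z
          have hzp := h0 z
          rw [Set.indicator_of_mem hz]
          rw [mem_ball] at hz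
          rw [dist_comm] at h2
          have hz2 : dist w z < r z / 16 := by rw [dist_comm]; linarith
          rw [Set.indicator_of_mem (show z ∈ {z | dist w z < r z / 16} from hz2)]
          apply ENNReal.ofReal_le_ofReal
          apply one_div_le_one_div_of_le (by positivity)
          nlinarith
        · rw [Set.indicator_of_notMem hz]
          exact zero_le

set_option maxHeartbeats 1000000 in
lemma samp_step (h : DGeo μ ρ) (hφ : HasDoublingLaplacian φ μ) {q : ℝ} (hq : 1 ≤ q) {ω : ℂ → ℝ}
    (hω : IsFlatWeight ρ ω) {Λ : Set ℂ} (hsep : RhoSeparated ρ Λ) {Cs : ℝ} (hCs : 0 ≤ Cs)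
    (hs : ∀ F : ℂ → ℂ, Differentiable ℂ F → ∫⁻ z, ENNReal.ofReal (nf 1 φ ω F z ^ q / ρ z ^ 2) < ∞ →
      ∫⁻ z, ENNReal.ofReal (nf 1 φ ω F z ^ q / ρ z ^ 2) ≤
        ENNReal.ofReal Cs * ∑' l : Λ, ENNReal.ofReal (nf 1 φ ω F l.1 ^ q)) :
    ∃ ε : ℝ, 0 < ε ∧ ε ≤ 1 ∧ ∃ C : ℝ, 0 < C ∧ ∀ f : ℂ → ℂ, Differentiable ℂ f →
        ∫⁻ z, ENNReal.ofReal (nf (1 + ε) φ ω f z ^ q / ρ z ^ 2) < ∞ →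
        ∫⁻ z, ENNReal.ofReal (nf (1 + ε) φ ω f z ^ q / ρ z ^ 2) ≤
          ENNReal.ofReal C * ∑' l : Λ, ENNReal.ofReal (nf (1 + ε) φ ω f l.1 ^ q) := by
  obtain ⟨K, hK, hloc⟩ := h.samp_local hφ hq hω hsep hCs hs
  set κ := min (1 / 8) (1 / (1600 * K)) with hκ
  have hκ0 : 0 < κ := lt_min (by norm_num) (by positivity)
  have hκ8 : κ ≤ 1 / 8 := min_le_left _ _
  have hκK : K * κ ^ q ≤ 1 / 1600 := by
    have h1 : κ ^ q ≤ κ := by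
      calc κ ^ q ≤ κ ^ (1:ℝ) := Real.rpow_le_rpow_of_exponent_ge hκ0 (by linarith) hq
        _ = κ := Real.rpow_one _
    calc K * κ ^ q ≤ K * (1 / (1600 * K)) := by gcongr; exact h1.trans (min_le_right _ _)
      _ = _ := by field_simp
  obtain ⟨N, hN, r, hr⟩ := h.exists_scale hκ0
  obtain ⟨ε, hε, hε1, hloc⟩ := hloc κ hκ0 hκ8 N hN r hr
  refine ⟨ε, hε, hε1, 1600 * K, by positivity, ?_⟩
  intro f hf hfin
  replace hloc := hloc f hf hfin
  have hrc := hr.cont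
  have hr0 := hr.pos h
  have ham : Measurable (nf (1 + ε) φ ω f) := nf_meas hω.2.1 hφ.continuous hf
  set a : ℂ → ℝ := nf (1 + ε) φ ω f with ha
  set A : ℂ → ℝ≥0∞ := fun w => ENNReal.ofReal (a w ^ q / ρ w ^ 2) with hA
  have hAm : Measurable A := by
    have := h.rho_cont.measurable
    fun_prop
  set I := ∫⁻ z, A z with hI
  set Sg := ∑' l : Λ, ENNReal.ofReal (a l.1 ^ q) with hSg
  have hrm : Measurable fun z => ENNReal.ofReal (1 / r z ^ 2) := by
    have := hrc.measurable
    fun_prop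
  have key : ENNReal.ofReal (1 / 200) * I ≤ ENNReal.ofReal K * (Sg * ENNReal.ofReal 4) +
      ENNReal.ofReal (1 / 1600) * (I * ENNReal.ofReal 4) := by
    calc _ = ∫⁻ w, A w * ENNReal.ofReal (1 / 200) := by
          rw [lintegral_mul_const' _ _ (by simp), mul_comm]
      _ ≤ ∫⁻ w, A w * Jr r 16 w := lintegral_mono fun w => mul_le_mul_right (Jr_ge hr0 hr.lip w) _
      _ = ∫⁻ z, ENNReal.ofReal (1 / r z ^ 2) * ∫⁻ w in ball z (r z / 16), A w := (Jr_swap hrc 16 hAm).symm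
      _ ≤ ∫⁻ z, (ENNReal.ofReal K * (ENNReal.ofReal (1 / r z ^ 2) * ∑' l : Λ, (ball z (r z / 8)).indicator
            (fun w => ENNReal.ofReal (a w ^ q)) l.1) +
          ENNReal.ofReal (K * κ ^ q) * (ENNReal.ofReal (1 / r z ^ 2) * ∫⁻ w in ball z (r z / 4), A w)) := by
          refine lintegral_mono fun z => ?_
          refine (mul_le_mul_right (hloc z) _).trans (le_of_eq ?_)
          ring
      _ = (∫⁻ z, (ENNReal.ofReal K * (ENNReal.ofReal (1 / r z ^ 2) * ∑' l : Λ, (ball z (r z / 8)).indicator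
            (fun w => ENNReal.ofReal (a w ^ q)) l.1))) +
          ∫⁻ z, ENNReal.ofReal (K * κ ^ q) * (ENNReal.ofReal (1 / r z ^ 2) * ∫⁻ w in ball z (r z / 4), A w) := by
          refine lintegral_add_left ((hrm.mul ?_).const_mul _) _
          have : Countable Λ := (h.sep_countable hsep).to_subtype
          refine Measurable.tsum fun l => ?_
          have hVm : MeasurableSet {z | dist l.1 z < r z / 8} := by
            have := hrc.measurable
            apply measurableSet_lt <;> fun_prop
          have e : (fun z => (ball z (r z / 8)).indicator (fun w => ENNReal.ofReal (a w ^ q)) l.1) =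
              {z | dist l.1 z < r z / 8}.indicator (fun _ => ENNReal.ofReal (a l.1 ^ q)) := by
            ext z
            by_cases hw : dist l.1 z < r z / 8
            · rw [Set.indicator_of_mem (show l.1 ∈ ball z (r z / 8) from hw),
                Set.indicator_of_mem (show z ∈ {z | dist l.1 z < r z / 8} from hw)]
            · rw [Set.indicator_of_notMem (show l.1 ∉ ball z (r z / 8) from hw),
                Set.indicator_of_notMem (show z ∉ {z | dist l.1 z < r z / 8} from hw)]
          rw [e]
          exact measurable_const.indicator hVm
      _ = ENNReal.ofReal K * (∑' l : Λ, ENNReal.ofReal (a l.1 ^ q) * Jr r 8 l.1) +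
          ENNReal.ofReal (K * κ ^ q) * ∫⁻ w, A w * Jr r 4 w := by
          rw [lintegral_const_mul' _ _ (by simp), lintegral_const_mul' _ _ (by simp), Jr_swap hrc 4 hAm,
            Jr_swap_sum hrc 8 (h.sep_countable hsep) (fun w => ENNReal.ofReal (a w ^ q))]
      _ ≤ _ := by
          refine add_le_add (mul_le_mul_right ?_ _) (mul_le_mul' (ENNReal.ofReal_le_ofReal hκK) ?_)
          · rw [hSg, ← ENNReal.tsum_mul_right]
            exact ENNReal.tsum_le_tsum fun l => mul_le_mul_right (Jr_le hr0 hr.lip (by norm_num) _) _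
          · rw [hI, ← lintegral_mul_const' _ _ (by simp)]
            exact lintegral_mono fun w => mul_le_mul_right (Jr_le hr0 hr.lip (by norm_num) _) _
  by_cases hS : Sg = ∞
  · rw [hS, ENNReal.mul_top (by simp; positivity)]; exact le_top
  lift I to ℝ≥0 using hfin.ne with I'
  lift Sg to ℝ≥0 using hS with S'
  rw [← ENNReal.ofReal_coe_nnreal, ← ENNReal.ofReal_coe_nnreal] at key ⊢
  rw [← ENNReal.ofReal_mul (by positivity), ← ENNReal.ofReal_mul (by positivity), ← ENNReal.ofReal_mul (by positivity),
    ← ENNReal.ofReal_mul (by positivity), ← ENNReal.ofReal_mul (by positivity),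
    ← ENNReal.ofReal_add (by positivity) (by positivity), ENNReal.ofReal_le_ofReal_iff (by positivity)] at key
  rw [← ENNReal.ofReal_mul (by positivity)]
  apply ENNReal.ofReal_le_ofReal
  linarith

end DGeo
end

noncomputable section

namespace DGeo
variable {μ : Measure ℂ} {ρ : ℂ → ℝ} {φ : ℂ → ℝ}

lemma samp_step_top (h : DGeo μ ρ) (hφ : HasDoublingLaplacian φ μ) {ω : ℂ → ℝ}
    (hω : IsFlatWeight ρ ω) {Λ : Set ℂ} {Cs : ℝ} (hCs : 0 ≤ Cs)
    (hs : ∀ F : ℂ → ℂ, Differentiable ℂ F → ⨆ z, ENNReal.ofReal (nf 1 φ ω F z) < ∞ →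
      ⨆ z, ENNReal.ofReal (nf 1 φ ω F z) ≤
        ENNReal.ofReal Cs * ⨆ l : Λ, ENNReal.ofReal (nf 1 φ ω F l.1)) :
    ∃ ε : ℝ, 0 < ε ∧ ε ≤ 1 ∧ ∃ C : ℝ, 0 < C ∧ ∀ f : ℂ → ℂ, Differentiable ℂ f →
        ⨆ z, ENNReal.ofReal (nf (1 + ε) φ ω f z) < ∞ →
        ⨆ z, ENNReal.ofReal (nf (1 + ε) φ ω f z) ≤
          ENNReal.ofReal C * ⨆ l : Λ, ENNReal.ofReal (nf (1 + ε) φ ω f l.1) := by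
  obtain ⟨m, L, hL, hfl⟩ := h.flat (flat_inv hω)
  obtain ⟨C4, hC4, hcut⟩ := h.cutoff hφ hL m
  set κ := 1 / (2 * (3 * Cs + 1) * C4) with hκ
  have hκ0 : 0 < κ := by positivity
  have hκC : (3 * Cs + 1) * (C4 * κ) = 1 / 2 := by rw [hκ]; field_simp
  obtain ⟨N, hN, r, hr⟩ := h.exists_scale hκ0
  obtain ⟨ε, hε, hε1, hcut⟩ := hcut κ hκ0 N hN r hr
  refine ⟨ε, hε, hε1, 6 * Cs + 1, by positivity, ?_⟩
  intro f hf hfin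
  have hωp := hω.1
  have hr0 := hr.pos h
  set a : ℂ → ℝ := nf (1 + ε) φ ω f with ha
  have ha0 : ∀ ζ, 0 ≤ a ζ := nf_nonneg hωp f
  have haω : ∀ ζ, a ζ = ω ζ * (‖f ζ‖ * Real.exp (-((1 + ε) * φ ζ))) := fun ζ => by simp only [ha, nf]; ring
  set X := ⨆ z, ENNReal.ofReal (a z) with hX
  set Y := ⨆ l : Λ, ENNReal.ofReal (a l.1) with hY
  have hYX : Y ≤ X := iSup_le fun l => le_iSup (fun z => ENNReal.ofReal (a z)) l.1
  have hYf : Y ≠ ∞ := (hYX.trans_lt hfin).ne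
  set B := X.toReal with hB
  set S := Y.toReal with hS
  have hB0 : 0 ≤ B := ENNReal.toReal_nonneg
  have hS0 : 0 ≤ S := ENNReal.toReal_nonneg
  have hXB : X = ENNReal.ofReal B := (ENNReal.ofReal_toReal hfin.ne).symm
  have hYS : Y = ENNReal.ofReal S := (ENNReal.ofReal_toReal hYf).symm
  have haB : ∀ ζ, a ζ ≤ B := fun ζ => by
    rw [← ENNReal.ofReal_le_ofReal_iff hB0, ← hXB]
    exact le_iSup (fun z => ENNReal.ofReal (a z)) ζ
  have haS : ∀ l : Λ, a l.1 ≤ S := fun l => by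
    rw [← ENNReal.ofReal_le_ofReal_iff hS0, ← hYS]
    exact le_iSup (fun l : Λ => ENNReal.ofReal (a l.1)) l
  set k := C4 * κ * B with hk
  have hk0 : 0 ≤ k := by positivity
  have main : ∀ z, a z ≤ 3 * (Cs * (S + k)) + k := by
    intro z
    set W : ℂ → ℝ := fun ζ => B * (ω ζ)⁻¹ with hW
    have hWω : ∀ ζ, ω ζ * W ζ = B := fun ζ => by
      have := (hωp ζ).ne'
      simp only [hW]; field_simp
    obtain ⟨F, hFd, hF1, hF2, hF3⟩ := hcut f hf z W
      (fun ζ => mul_nonneg hB0 (inv_nonneg.2 (hωp ζ).le))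
      (fun x y => by
        have h4 := hfl x y
        simp only [hW]
        calc _ ≤ B * (L * Dd ρ x y ^ m * (ω x)⁻¹) := by gcongr
          _ = _ := by ring)
      (fun ζ hζ => by
        have h1 := haB ζ
        rw [haω, ← hWω ζ] at h1
        exact le_of_mul_le_mul_left h1 (hωp ζ))
    set b : ℂ → ℝ := nf 1 φ ω F with hb
    have hb0 : ∀ ζ, 0 ≤ b ζ := nf_nonneg hωp F
    have hbω : ∀ ζ, b ζ = ω ζ * (‖F ζ‖ * Real.exp (-(1 * φ ζ))) := fun ζ => by simp only [hb, nf]; ring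
    have hkω : ∀ ζ, ω ζ * (C4 * κ * W ζ) = k := fun ζ => by
      rw [hk, ← hWω ζ]; ring
    have Q1 : a z ≤ 3 * b z + k := by
      rw [haω, hbω, ← hkω z]
      have := mul_le_mul_of_nonneg_left (hF1 z (by simp; exact hr0 z)) (hωp z).le
      linarith
    have Q2 : ∀ ζ, b ζ ≤ a ζ + k := by
      intro ζ
      by_cases hζ : dist ζ z < r z / 8
      · rw [haω, hbω, ← hkω ζ]
        have := mul_le_mul_of_nonneg_left (hF2 ζ hζ) (hωp ζ).le
        linarith
      · push Not at hζ
        have h1 := mul_le_mul_of_nonneg_left (hF3 ζ hζ) (hωp ζ).le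
        rw [hkω, ← hbω] at h1
        linarith [ha0 ζ]
    have hFfin : ⨆ z, ENNReal.ofReal (b z) < ∞ := by
      refine lt_of_le_of_lt (iSup_le fun ζ => ?_) (ENNReal.ofReal_lt_top (r := B + k))
      exact ENNReal.ofReal_le_ofReal ((Q2 ζ).trans (by linarith [haB ζ]))
    have h1 := hs F hFd hFfin
    have h2 : ENNReal.ofReal (b z) ≤ ENNReal.ofReal (Cs * (S + k)) := by
      rw [ENNReal.ofReal_mul hCs]
      refine (le_iSup (fun z => ENNReal.ofReal (b z)) z).trans (h1.trans (mul_le_mul_right ?_ _))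
      exact iSup_le fun l => ENNReal.ofReal_le_ofReal ((Q2 l.1).trans (by linarith [haS l]))
    have h3 := (ENNReal.ofReal_le_ofReal_iff (by positivity)).1 h2
    linarith
  have hBle : B ≤ 3 * (Cs * (S + k)) + k := by
    rw [← ENNReal.ofReal_le_ofReal_iff (by positivity), ← hXB]
    exact iSup_le fun z => ENNReal.ofReal_le_ofReal (main z)
  have hkk : (3 * Cs + 1) * k = B / 2 := by
    rw [hk, ← mul_assoc, hκC]; ring
  rw [hXB, hYS, ← ENNReal.ofReal_mul (by positivity)]
  apply ENNReal.ofReal_le_ofReal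
  linarith

lemma lint_decay (h : DGeo μ ρ) : ∃ M0 : ℕ, ∀ {q : ℝ}, 1 ≤ q → ∀ a : ℂ → ℝ, (∀ ζ, 0 ≤ a ζ) → ∀ z B,
    (∀ ζ, a ζ ≤ B * (Dd ρ z ζ ^ M0)⁻¹) → ∫⁻ ζ, ENNReal.ofReal (a ζ ^ q / ρ ζ ^ 2) < ∞ := by
  obtain ⟨M0, C, hC, hinteg⟩ := h.lint_Dd
  refine ⟨M0, fun {q} hq a ha z B hB => ?_⟩
  have hB0 : 0 ≤ B := by
    have h1 := (ha z).trans (hB z)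
    have h2 := h.Dd_pos z z
    exact nonneg_of_mul_nonneg_left h1 (by positivity)
  calc _ ≤ ∫⁻ ζ, ENNReal.ofReal (B ^ q) * ENNReal.ofReal ((Dd ρ z ζ ^ M0)⁻¹ / ρ ζ ^ 2) := by
        refine lintegral_mono fun ζ => ?_
        have hD := h.Dd_pos z ζ
        have hρ := h.rho_pos ζ
        beta_reduce
        rw [← ENNReal.ofReal_mul (by positivity)]
        apply ENNReal.ofReal_le_ofReal
        rw [← mul_div_assoc]
        gcongr
        have h1 : (Dd ρ z ζ ^ M0)⁻¹ ≤ 1 := inv_le_one_of_one_le₀ (one_le_pow₀ (h.Dd_ge z ζ))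
        calc a ζ ^ q ≤ (B * (Dd ρ z ζ ^ M0)⁻¹) ^ q := Real.rpow_le_rpow (ha ζ) (hB ζ) (by linarith)
          _ = B ^ q * ((Dd ρ z ζ ^ M0)⁻¹) ^ q := Real.mul_rpow hB0 (by positivity)
          _ ≤ B ^ q * ((Dd ρ z ζ ^ M0)⁻¹) ^ (1:ℝ) := by
              gcongr ?_ * ?_
              exact Real.rpow_le_rpow_of_exponent_ge (by positivity) h1 hq
          _ = _ := by rw [Real.rpow_one]
    _ = ENNReal.ofReal (B ^ q) * ∫⁻ ζ, ENNReal.ofReal ((Dd ρ z ζ ^ M0)⁻¹ / ρ ζ ^ 2) :=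
        lintegral_const_mul' _ _ (by simp)
    _ < ∞ := ENNReal.mul_lt_top (by simp) ((hinteg z).trans_lt (by simp))

/-- ℓ^q ≤ ℓ^1 -/
lemma tsum_rpow_le {ι : Type*} (x : ι → ℝ≥0∞) {q : ℝ} (hq : 1 ≤ q) : ∑' i, x i ^ q ≤ (∑' i, x i) ^ q := by
  set T := ∑' i, x i with hT
  have h1 : ∀ i, x i ^ q ≤ x i * T ^ (q - 1) := fun i => by
    have : x i ≤ T := ENNReal.le_tsum i
    calc x i ^ q = x i ^ (1 + (q - 1)) := by congr 1; ring
      _ = x i ^ (1:ℝ) * x i ^ (q - 1) := ENNReal.rpow_add_of_nonneg _ _ (by norm_num) (by linarith)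
      _ ≤ _ := by
        rw [ENNReal.rpow_one]
        exact mul_le_mul_right (ENNReal.rpow_le_rpow this (by linarith)) _
  calc _ ≤ ∑' i, x i * T ^ (q - 1) := ENNReal.tsum_le_tsum h1
    _ = T ^ (1:ℝ) * T ^ (q - 1) := by rw [ENNReal.tsum_mul_right, ENNReal.rpow_one]
    _ = T ^ (1 + (q - 1)) := (ENNReal.rpow_add_of_nonneg _ _ (by norm_num) (by linarith)).symm
    _ = _ := by congr 1; ring

lemma seed (h : DGeo μ ρ) (hφ : HasDoublingLaplacian φ μ) {ω : ℂ → ℝ} (hω : IsFlatWeight ρ ω)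
    {p : ℝ≥0∞} (hp : 1 ≤ p) {Λ : Set ℂ} (hsep : RhoSeparated ρ Λ) (hsamp : IsSampling p φ ω ρ Λ) :
    ∃ ε : ℝ, 0 < ε ∧ ε ≤ 1 ∧ ∃ (M0 : ℕ) (C : ℝ), 0 < C ∧ ∀ g : ℂ → ℂ, Differentiable ℂ g →
      (∃ z B, ∀ ζ, nf (1 + ε) φ ω g ζ ≤ B * (Dd ρ z ζ ^ M0)⁻¹) → ∀ z,
        ENNReal.ofReal (nf (1 + ε) φ ω g z) ≤ ENNReal.ofReal C * ∑' l : Λ, ENNReal.ofReal (nf (1 + ε) φ ω g l.1) := by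
  have hωp := hω.1
  have hone : φ = fun z => 1 * φ z := by ext; simp
  by_cases hpt : p = ∞
  · subst hpt
    unfold IsSampling at hsamp
    rw [if_pos rfl] at hsamp
    obtain ⟨C, hC, hs⟩ := hsamp
    obtain ⟨ε, hε, hε1, C', hC', hst⟩ := h.samp_step_top hφ hω (Λ := Λ) (Cs := C) C.2 (by
      intro F hF hfin
      have := hs F ⟨hF, by rw [hone, Fnorm_top]; exact hfin⟩
      rw [hone, Fnorm_top, lnorm_top] at this
      rwa [ENNReal.ofReal_coe_nnreal])
    refine ⟨ε, hε, hε1, 0, C', hC', ?_⟩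
    rintro g hg ⟨z0, B, hB⟩ z
    have := hst g hg (by
      refine lt_of_le_of_lt (iSup_le fun ζ => ?_) (ENNReal.ofReal_lt_top (r := B))
      apply ENNReal.ofReal_le_ofReal
      simpa using hB ζ)
    refine (le_iSup (fun z => ENNReal.ofReal (nf (1 + ε) φ ω g z)) z).trans (this.trans (mul_le_mul_right ?_ _))
    exact iSup_le fun l => ENNReal.le_tsum (f := fun l : Λ => ENNReal.ofReal (nf (1 + ε) φ ω g l.1)) l
  · unfold IsSampling at hsamp
    rw [if_neg hpt] at hsamp
    obtain ⟨C, hC, hs⟩ := hsamp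
    set q := p.toReal with hqd
    have hq : 1 ≤ q := by
      rw [hqd, ← ENNReal.toReal_one]; exact ENNReal.toReal_mono hpt hp
    have hq0 : 0 < q := by linarith
    have hinv : ∀ x : ℝ≥0∞, (x ^ (1 / q)) ^ q = x := fun x => by
      rw [← ENNReal.rpow_mul, one_div_mul_cancel hq0.ne', ENNReal.rpow_one]
    obtain ⟨ε, hε, hε1, C', hC', hst⟩ := h.samp_step hφ hq hω hsep (Cs := (C:ℝ) ^ q) (by positivity) (by
      intro F hF hfin
      have h1 := (hs F ⟨hF, by
        rw [hone, Fnorm_nf hpt 1 φ hωp]; exact ENNReal.rpow_lt_top_of_nonneg (by positivity) hfin.ne⟩).2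
      rw [hone, Fnorm_nf hpt 1 φ hωp, lnorm_nf hpt 1 φ hωp] at h1
      have h2 := ENNReal.rpow_le_rpow h1 hq0.le
      rw [ENNReal.mul_rpow_of_nonneg _ _ hq0.le, hinv, hinv] at h2
      rwa [← ENNReal.ofReal_rpow_of_nonneg (NNReal.coe_nonneg C) hq0.le, ENNReal.ofReal_coe_nnreal])
    obtain ⟨M0, hdec⟩ := h.lint_decay
    obtain ⟨C3, hC3, hmv⟩ := h.mvq hφ (T := 2) (δ := 1) one_pos le_rfl hq hω
    refine ⟨ε, hε, hε1, M0, (C3 * C') ^ (1 / q), by positivity, ?_⟩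
    rintro g hg ⟨z0, B, hB⟩ z
    have hn0 := fun ζ => nf_nonneg (t := 1 + ε) (φ := φ) hωp g ζ
    have hfin := hdec hq _ hn0 z0 B hB
    have h1 := hst g hg hfin
    have h2 := hmv (1 + ε) (by linarith) (by linarith) g hg z
    have h3 : ENNReal.ofReal (nf (1 + ε) φ ω g z) ^ q ≤ (ENNReal.ofReal ((C3 * C') ^ (1 / q)) *
        ∑' l : Λ, ENNReal.ofReal (nf (1 + ε) φ ω g l.1)) ^ q := by
      rw [ENNReal.ofReal_rpow_of_nonneg (hn0 z) hq0.le, ENNReal.mul_rpow_of_nonneg _ _ hq0.le,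
        ← ENNReal.ofReal_rpow_of_pos (show 0 < C3 * C' by positivity), hinv, ENNReal.ofReal_mul hC3.le, mul_assoc]
      refine h2.trans (mul_le_mul_right ?_ _)
      refine (setLIntegral_le_lintegral _ _).trans (h1.trans (mul_le_mul_right ?_ _))
      refine le_trans (le_of_eq ?_) (tsum_rpow_le _ hq)
      congr 1; ext l
      rw [ENNReal.ofReal_rpow_of_nonneg (hn0 _) hq0.le]
    exact (ENNReal.rpow_le_rpow_iff hq0).1 h3

end DGeo
end

noncomputable section
namespace DGeo
variable {μ : Measure ℂ} {ρ : ℂ → ℝ} {φ : ℂ → ℝ}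

/-- From the seed inequality to a localized pointwise sampling inequality. -/
lemma step2 (h : DGeo μ ρ) (hφ : HasDoublingLaplacian φ μ) {ω ω' : ℂ → ℝ} (hω : IsFlatWeight ρ ω)
    (hω' : IsFlatWeight ρ ω') {Λ : Set ℂ} {ε : ℝ} (hε : 0 < ε) {M0 : ℕ} {C : ℝ} (hC : 0 < C)
    (hseed : ∀ g : ℂ → ℂ, Differentiable ℂ g →
      (∃ z B, ∀ ζ, nf (1 + ε) φ ω g ζ ≤ B * (Dd ρ z ζ ^ M0)⁻¹) → ∀ z,
        ENNReal.ofReal (nf (1 + ε) φ ω g z) ≤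
          ENNReal.ofReal C * ∑' l : Λ, ENNReal.ofReal (nf (1 + ε) φ ω g l.1))
    {M' : ℕ} (hM : M0 ≤ M') :
    ∃ C' : ℝ, 0 < C' ∧ ∀ f : ℂ → ℂ, Differentiable ℂ f →
      (∃ B, ∀ ζ, nf (1 + ε / 2) φ ω' f ζ ≤ B) → ∀ z,
        ENNReal.ofReal (nf (1 + ε / 2) φ ω' f z) ≤ ENNReal.ofReal C' *
          ∑' l : Λ, ENNReal.ofReal ((Dd ρ z l.1 ^ M')⁻¹) * ENNReal.ofReal (nf (1 + ε / 2) φ ω' f l.1) := by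
  obtain ⟨m1, L1, hL1, hf1⟩ := h.flat hω
  obtain ⟨m2, L2, hL2, hf2⟩ := h.flat (flat_inv hω')
  obtain ⟨Cp, hCp, hpk⟩ := h.peak hφ (t := ε / 2) (by positivity) (m1 + m2 + M')
  have hL10 : 0 < L1 := by linarith
  have hL20 : 0 < L2 := by linarith
  refine ⟨C * (L1 * L2 * Cp), by positivity, ?_⟩
  rintro f hf ⟨B, hB⟩ z
  obtain ⟨P, hP, hPz, hPd⟩ := hpk z
  have hωp := hω.1
  have hωp' := hω'.1
  set θ : ℝ := ω z * (ω' z)⁻¹ with hθ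
  have hθ0 : 0 < θ := mul_pos (hωp z) (inv_pos.2 (hωp' z))
  have ha0 := fun ζ => nf_nonneg (t := 1 + ε / 2) (φ := φ) hωp' f ζ
  have hid : ∀ ζ, nf (1 + ε) φ ω (fun x => f x * P x) ζ =
      ω ζ * (ω' ζ)⁻¹ * nf (1 + ε / 2) φ ω' f ζ * (‖P ζ‖ * Real.exp (-(ε / 2 * φ ζ))) := by
    intro ζ
    unfold nf
    have : Real.exp (-((1 + ε) * φ ζ)) = Real.exp (-((1 + ε / 2) * φ ζ)) * Real.exp (-(ε / 2 * φ ζ)) := by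
      rw [← Real.exp_add]; congr 1; ring
    rw [this, norm_mul]
    have := (hωp' ζ).ne'
    field_simp
  have hup : ∀ ζ, nf (1 + ε) φ ω (fun x => f x * P x) ζ ≤
      (L1 * L2 * Cp) * θ * ((Dd ρ z ζ ^ M')⁻¹ * nf (1 + ε / 2) φ ω' f ζ) := by
    intro ζ
    rw [hid]
    have hD := h.Dd_pos z ζ
    have e1 := hf1 z ζ
    have e2 := hf2 z ζ
    have e3 := hPd ζ
    have i1 := hωp ζ
    have i2 := inv_pos.2 (hωp' ζ)
    have i3 := hωp z
    have i4 := inv_pos.2 (hωp' z)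
    have i5 := ha0 ζ
    calc _ ≤ (L1 * Dd ρ z ζ ^ m1 * ω z) * (L2 * Dd ρ z ζ ^ m2 * (ω' z)⁻¹) * nf (1 + ε / 2) φ ω' f ζ *
          (Cp * (Dd ρ z ζ ^ (m1 + m2 + M'))⁻¹) := by gcongr
      _ = _ := by
        rw [hθ, pow_add, pow_add]
        field_simp
  have hlow : θ * nf (1 + ε / 2) φ ω' f z ≤ nf (1 + ε) φ ω (fun x => f x * P x) z := by
    rw [hid]
    have : 1 ≤ ‖P z‖ * Real.exp (-(ε / 2 * φ z)) := by
      calc (1:ℝ) = Real.exp (ε / 2 * φ z) * Real.exp (-(ε / 2 * φ z)) := by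
            rw [← Real.exp_add, add_neg_cancel, Real.exp_zero]
        _ ≤ _ := by gcongr
    exact le_mul_of_one_le_right (mul_nonneg hθ0.le (ha0 z)) this
  have hs := hseed (fun x => f x * P x) (hf.mul hP) ⟨z, (L1 * L2 * Cp) * θ * B, fun ζ => by
    refine (hup ζ).trans ?_
    have hB0 : 0 ≤ B := (ha0 z).trans (hB z)
    calc _ ≤ (L1 * L2 * Cp) * θ * ((Dd ρ z ζ ^ M0)⁻¹ * B) := by
          have := h.inv_pow_mono z ζ hM
          have := h.Dd_pos z ζ
          have h3 := ha0 ζ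
          gcongr
          exact hB ζ
      _ = _ := by ring⟩ z
  have key : ENNReal.ofReal θ * ENNReal.ofReal (nf (1 + ε / 2) φ ω' f z) ≤ ENNReal.ofReal θ *
      (ENNReal.ofReal (C * (L1 * L2 * Cp)) *
          ∑' l : Λ, ENNReal.ofReal ((Dd ρ z l.1 ^ M')⁻¹) * ENNReal.ofReal (nf (1 + ε / 2) φ ω' f l.1)) := by
    rw [← ENNReal.ofReal_mul hθ0.le]
    refine (ENNReal.ofReal_le_ofReal hlow).trans (hs.trans ?_)
    calc _ ≤ ENNReal.ofReal C * ∑' l : Λ, ENNReal.ofReal ((L1 * L2 * Cp) * θ) *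
          (ENNReal.ofReal ((Dd ρ z l.1 ^ M')⁻¹) * ENNReal.ofReal (nf (1 + ε / 2) φ ω' f l.1)) := by
          refine mul_le_mul_right (ENNReal.tsum_le_tsum fun l => ?_) _
          have hD := h.Dd_pos z l.1
          rw [← ENNReal.ofReal_mul (by positivity), ← ENNReal.ofReal_mul (by positivity)]
          exact ENNReal.ofReal_le_ofReal (hup l.1)
      _ = _ := by
          rw [ENNReal.tsum_mul_left, ENNReal.ofReal_mul (by positivity), ENNReal.ofReal_mul hC.le]
          ring
  exact (ENNReal.mul_le_mul_iff_right (by simpa using hθ0) (by simp)).1 key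

end DGeo
end

namespace DGeo
variable {μ : Measure ℂ} {ρ : ℂ → ℝ} {φ : ℂ → ℝ}

lemma rho_transfer (h : DGeo μ ρ) {s : ℝ} (hs : 1 < s) {ρ' : ℂ → ℝ}
    (hρ' : IsRadius (ENNReal.ofReal s • μ) ρ') :
    ∃ K : ℝ, 0 < K ∧ ∀ z, 0 < ρ' z ∧ ρ' z ≤ ρ z ∧ ρ z ≤ K * ρ' z := by
  obtain ⟨q, hq, hg⟩ := h.rev_growth
  have hs0 : 0 < s := by linarith
  refine ⟨4 * s ^ q, by positivity, fun z => ?_⟩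
  obtain ⟨hp, hm⟩ := hρ' z
  have hr : s * μ.real (ball z (ρ' z)) = 1 := by
    have := congrArg ENNReal.toReal hm
    rw [Measure.smul_apply, smul_eq_mul, ENNReal.toReal_mul, ENNReal.toReal_ofReal hs0.le, ENNReal.toReal_one] at this
    exact this
  have hr' : μ.real (ball z (ρ' z)) = 1 / s := by field_simp; linarith
  have hle : ρ' z ≤ ρ z := by
    by_contra hc
    push Not at hc
    have := h.real_mono (ball_subset_ball hc.le : ball z (ρ z) ⊆ ball z (ρ' z))
    rw [h.real_rho, hr', le_div_iff₀ hs0] at this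
    linarith
  refine ⟨hp, hle, ?_⟩
  have h1 := hg z (ρ' z) (ρ z / ρ' z) hp ((one_le_div hp).2 hle)
  rw [div_mul_cancel₀ _ hp.ne', h.real_rho, hr', one_pow, mul_one, div_pow, one_pow, mul_one_div,
    div_le_iff₀ (by positivity), div_le_iff₀ hp] at h1
  exact h1

lemma jensen_tsum {ι : Type*} [Countable ι] {q : ℝ} (hq : 1 ≤ q) (k a : ι → ℝ≥0∞) :
    (∑' i, k i * a i) ^ q ≤ (∑' i, k i) ^ (q - 1) * ∑' i, k i * a i ^ q := by
  let _ : MeasurableSpace ι := ⊤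
  have := jensen (Measure.count (α := ι)) hq (k := k) (a := a) (measurable_of_countable _) (measurable_of_countable _)
  simpa only [lintegral_count] using this

set_option maxHeartbeats 400000 in
/-- upper inequality, finite exponent, with respect to `ρ` -/
lemma final_upper (h : DGeo μ ρ) {Λ : Set ℂ} (hc : Λ.Countable) {q : ℝ} (hq : 1 ≤ q)
    {M : ℕ} {C1 C2 C3 : ℝ} (hC1 : 0 < C1) (hC2 : 0 < C2) (hC3 : 0 < C3)
    (h2 : ∀ z, ∑' l : Λ, ENNReal.ofReal ((Dd ρ z l.1 ^ M)⁻¹) ≤ ENNReal.ofReal C2)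
    (h3 : ∀ w, ∫⁻ z, ENNReal.ofReal ((Dd ρ z w ^ M)⁻¹ / ρ z ^ 2) ≤ ENNReal.ofReal C3)
    {a : ℂ → ℝ} (ha : ∀ z, 0 ≤ a z)
    (h1 : ∀ z, ENNReal.ofReal (a z) ≤ ENNReal.ofReal C1 *
      ∑' l : Λ, ENNReal.ofReal ((Dd ρ z l.1 ^ M)⁻¹) * ENNReal.ofReal (a l.1)) :
    ∫⁻ z, ENNReal.ofReal (a z ^ q / ρ z ^ 2) ≤ ENNReal.ofReal (C1 ^ q * C2 ^ (q - 1) * C3) *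
      ∑' l : Λ, ENNReal.ofReal (a l.1 ^ q) := by
  have hq0 : 0 ≤ q := by linarith
  have hcs : Countable Λ := hc.to_subtype
  have hpt : ∀ z, ENNReal.ofReal (a z ^ q / ρ z ^ 2) ≤ ENNReal.ofReal (C1 ^ q * C2 ^ (q - 1)) *
      ∑' l : Λ, ENNReal.ofReal ((Dd ρ z l.1 ^ M)⁻¹ / ρ z ^ 2) * ENNReal.ofReal (a l.1 ^ q) := by
    intro z
    have e1 := ENNReal.rpow_le_rpow (h1 z) hq0
    rw [ENNReal.mul_rpow_of_nonneg _ _ hq0, ENNReal.ofReal_rpow_of_nonneg (ha z) hq0,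
      ENNReal.ofReal_rpow_of_nonneg hC1.le hq0] at e1
    have e2 := jensen_tsum hq (fun l : Λ => ENNReal.ofReal ((Dd ρ z l.1 ^ M)⁻¹)) (fun l : Λ => ENNReal.ofReal (a l.1))
    have e3 := ENNReal.rpow_le_rpow (h2 z) (by linarith : 0 ≤ q - 1)
    rw [ENNReal.ofReal_rpow_of_nonneg hC2.le (by linarith)] at e3
    have hρ := h.rho_pos z
    calc ENNReal.ofReal (a z ^ q / ρ z ^ 2) = ENNReal.ofReal (a z ^ q) * ENNReal.ofReal (1 / ρ z ^ 2) := by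
          rw [← ENNReal.ofReal_mul (Real.rpow_nonneg (ha z) _), mul_one_div]
      _ ≤ (ENNReal.ofReal (C1 ^ q) * (ENNReal.ofReal (C2 ^ (q - 1)) *
          ∑' l : Λ, ENNReal.ofReal ((Dd ρ z l.1 ^ M)⁻¹) * ENNReal.ofReal (a l.1) ^ q)) * ENNReal.ofReal (1 / ρ z ^ 2) := by
          refine mul_le_mul_left (e1.trans (mul_le_mul_right (e2.trans (mul_le_mul_left e3 _)) _)) _
      _ = ENNReal.ofReal (C1 ^ q * C2 ^ (q - 1)) *
          ∑' l : Λ, ENNReal.ofReal (1 / ρ z ^ 2) * (ENNReal.ofReal ((Dd ρ z l.1 ^ M)⁻¹) * ENNReal.ofReal (a l.1) ^ q) := by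
          rw [ENNReal.tsum_mul_left, ENNReal.ofReal_mul (by positivity)]; ring
      _ = _ := by
          congr 2; ext l
          have := h.Dd_pos z l.1
          rw [← mul_assoc, ← ENNReal.ofReal_mul (by positivity), one_div_mul_eq_div,
            ENNReal.ofReal_rpow_of_nonneg (ha _) hq0]
  have hm : ∀ l : Λ, Measurable fun z => ENNReal.ofReal ((Dd ρ z l.1 ^ M)⁻¹ / ρ z ^ 2) := by
    intro l
    have e := h.rho_cont.measurable
    unfold Dd
    fun_prop
  calc _ ≤ ∫⁻ z, ENNReal.ofReal (C1 ^ q * C2 ^ (q - 1)) *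
      ∑' l : Λ, ENNReal.ofReal ((Dd ρ z l.1 ^ M)⁻¹ / ρ z ^ 2) * ENNReal.ofReal (a l.1 ^ q) := lintegral_mono hpt
    _ = ENNReal.ofReal (C1 ^ q * C2 ^ (q - 1)) *
      ∑' l : Λ, (∫⁻ z, ENNReal.ofReal ((Dd ρ z l.1 ^ M)⁻¹ / ρ z ^ 2)) * ENNReal.ofReal (a l.1 ^ q) := by
        rw [lintegral_const_mul' _ _ (by simp), lintegral_tsum (fun l => ((hm l).mul_const _).aemeasurable)]
        congr 2; ext l
        rw [lintegral_mul_const _ (hm l)]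
    _ ≤ ENNReal.ofReal (C1 ^ q * C2 ^ (q - 1)) *
      ∑' l : Λ, ENNReal.ofReal C3 * ENNReal.ofReal (a l.1 ^ q) := by
        refine mul_le_mul_right (ENNReal.tsum_le_tsum fun l => ?_) _
        gcongr
        exact h3 l.1
    _ = _ := by
        rw [ENNReal.tsum_mul_left, ENNReal.ofReal_mul (by positivity : 0 ≤ C1 ^ q * C2 ^ (q - 1)), mul_assoc]

end DGeo

/-- Inclusions between spaces of sampling sequences: a `ρ`-separated sampling sequence
for `F^p_{φ,ω}` is sampling for `F^{p'}_{(1+ε)φ,ω̃}` for some `ε > 0`, uniformly in the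
exponent `p'` and the flat weight `ω̃`. -/
theorem sampling_inclusions
    (φ : ℂ → ℝ) (μ : Measure ℂ) (hφ : HasDoublingLaplacian φ μ)
    (ρ : ℂ → ℝ) (hρ : IsRadius μ ρ)
    (ω : ℂ → ℝ) (hω : IsFlatWeight ρ ω)
    (p : ℝ≥0∞) (hp : 1 ≤ p)
    (Λ : Set ℂ) (hsep : RhoSeparated ρ Λ) (hsamp : IsSampling p φ ω ρ Λ) :
    ∃ ε : ℝ, 0 < ε ∧ ∀ p' : ℝ≥0∞, 1 ≤ p' →
      ∀ ω' : ℂ → ℝ, IsFlatWeight ρ ω' →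
        ∀ ρ' : ℂ → ℝ, IsRadius (ENNReal.ofReal (1 + ε) • μ) ρ' →
          IsSampling p' (fun z => (1 + ε) * φ z) ω' ρ' Λ := by
  have h : DGeo μ ρ := ⟨hφ.doubling, hρ⟩
  obtain ⟨ε, hε, hε1, M0, C0, hC0, hseed⟩ := h.seed hφ hω hp hsep hsamp
  obtain ⟨M2, C2, hC2, hM2⟩ := h.sep_Dd hsep
  obtain ⟨M3, C3, hC3, hM3⟩ := h.lint_Dd'
  refine ⟨ε / 2, by positivity, ?_⟩
  intro p' hp' ω' hω' ρ' hρ'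
  have hωp' := hω'.1
  obtain ⟨K, hK, hKρ⟩ := h.rho_transfer (by linarith) hρ'
  obtain ⟨M, hMM0, hMM2, hMM3⟩ : ∃ M, M0 ≤ M ∧ M2 ≤ M ∧ M3 ≤ M :=
    ⟨max M0 (max M2 M3), le_max_left _ _, (le_max_left _ _).trans (le_max_right _ _),
      (le_max_right _ _).trans (le_max_right _ _)⟩
  obtain ⟨C1, hC1, hst⟩ := h.step2 hφ hω hω' hε hC0 hseed hMM0
  have h2 : ∀ z, ∑' l : Λ, ENNReal.ofReal ((Dd ρ z l.1 ^ M)⁻¹) ≤ ENNReal.ofReal C2 := by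
    intro z
    refine le_trans ?_ (hM2 z)
    refine ENNReal.tsum_le_tsum fun l => ?_
    apply ENNReal.ofReal_le_ofReal
    exact h.inv_pow_mono z l.1 hMM2
  have h3 : ∀ w, ∫⁻ z, ENNReal.ofReal ((Dd ρ z w ^ M)⁻¹ / ρ z ^ 2) ≤ ENNReal.ofReal C3 := fun w => by
    refine (lintegral_mono fun z => ENNReal.ofReal_le_ofReal ?_).trans (hM3 w)
    have := h.rho_pos z
    have := h.inv_pow_mono z w hMM3
    gcongr
  have hn0 := fun (f : ℂ → ℂ) ζ => DGeo.nf_nonneg (t := 1 + ε / 2) (φ := φ) hωp' f ζ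
  by_cases hpt : p' = ∞
  · subst hpt
    unfold IsSampling
    rw [if_pos rfl]
    refine ⟨(C1 * C2).toNNReal, Real.toNNReal_pos.2 (by positivity), ?_⟩
    rintro f ⟨hf, hfin⟩
    rw [Fnorm_top] at hfin
    rw [Fnorm_top, lnorm_top]
    set S := ⨆ l : Λ, ENNReal.ofReal (nf (1 + ε / 2) φ ω' f l.1) with hS
    refine iSup_le fun z => ?_
    refine (hst f hf ⟨_, fun ζ => (ENNReal.ofReal_le_iff_le_toReal hfin.ne).1
      (le_iSup (fun z => ENNReal.ofReal (nf (1 + ε / 2) φ ω' f z)) ζ)⟩ z).trans ?_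
    calc _ ≤ ENNReal.ofReal C1 * ∑' l : Λ, ENNReal.ofReal ((Dd ρ z l.1 ^ M)⁻¹) * S := by
          refine mul_le_mul_right (ENNReal.tsum_le_tsum fun l => mul_le_mul_right ?_ _) _
          exact le_iSup (fun l : Λ => ENNReal.ofReal (nf (1 + ε / 2) φ ω' f l.1)) l
      _ = ENNReal.ofReal C1 * ((∑' l : Λ, ENNReal.ofReal ((Dd ρ z l.1 ^ M)⁻¹)) * S) := by
          rw [ENNReal.tsum_mul_right]
      _ ≤ ENNReal.ofReal C1 * (ENNReal.ofReal C2 * S) := by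
          gcongr
          exact h2 z
      _ = _ := by
          change _ = ENNReal.ofReal (C1 * C2) * S
          rw [ENNReal.ofReal_mul hC1.le, mul_assoc]
  · unfold IsSampling
    rw [if_neg hpt]
    set q := p'.toReal with hqd
    have hq : 1 ≤ q := by
      rw [hqd, ← ENNReal.toReal_one]; exact ENNReal.toReal_mono hpt hp'
    have hq0 : 0 < q := by linarith
    obtain ⟨δ, hδ, hδ2, hss⟩ := h.sep_sum hsep
    obtain ⟨C4, hC4, hmv⟩ := h.mvq hφ (T := 2) (δ := δ) hδ (by linarith) hq hω'
    set A : ℝ := C1 ^ q * C2 ^ (q - 1) * C3 with hA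
    have hA0 : 0 < A := by positivity
    set E : ℝ := max C4 (K ^ 2 * A) with hE
    have hE0 : 0 < E := lt_max_of_lt_left hC4
    have hEq : 0 < E ^ (1 / q) := by positivity
    refine ⟨(E ^ (1 / q)).toNNReal, Real.toNNReal_pos.2 hEq, ?_⟩
    rintro f ⟨hf, hfin⟩
    rw [Fnorm_nf hpt _ φ hωp'] at hfin
    rw [Fnorm_nf hpt _ φ hωp', lnorm_nf hpt _ φ hωp', ← hqd]
    rw [← hqd] at hfin
    set I' := ∫⁻ z, ENNReal.ofReal (nf (1 + ε / 2) φ ω' f z ^ q / ρ' z ^ 2) with hI'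
    set I := ∫⁻ z, ENNReal.ofReal (nf (1 + ε / 2) φ ω' f z ^ q / ρ z ^ 2) with hI
    set S := ∑' l : Λ, ENNReal.ofReal (nf (1 + ε / 2) φ ω' f l.1 ^ q) with hS
    have hI'fin : I' < ∞ := (ENNReal.rpow_lt_top_iff_of_pos (by positivity)).1 hfin
    have hII' : I ≤ I' := by
      refine lintegral_mono fun z => ENNReal.ofReal_le_ofReal ?_
      have := Real.rpow_nonneg (hn0 f z) q
      obtain ⟨k1, k2, k3⟩ := hKρ z
      gcongr
    have hI'I : I' ≤ ENNReal.ofReal (K ^ 2) * I := by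
      rw [hI, ← lintegral_const_mul' _ _ (by simp)]
      refine lintegral_mono fun z => ?_
      beta_reduce
      rw [← ENNReal.ofReal_mul (by positivity)]
      apply ENNReal.ofReal_le_ofReal
      have := Real.rpow_nonneg (hn0 f z) q
      obtain ⟨k1, k2, k3⟩ := hKρ z
      have k4 := h.rho_pos z
      rw [← mul_div_assoc, div_le_div_iff₀ (by positivity) (by positivity)]
      calc _ ≤ nf (1 + ε / 2) φ ω' f z ^ q * (K * ρ' z) ^ 2 := by gcongr
        _ = _ := by ring
    have hpw : ∀ z, ENNReal.ofReal (nf (1 + ε / 2) φ ω' f z ^ q) ≤ ENNReal.ofReal C4 * I := fun z =>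
      (hmv _ (by linarith) (by linarith) f hf z).trans (mul_le_mul_right (setLIntegral_le_lintegral _ _) _)
    have hfinB : ENNReal.ofReal C4 * I < ∞ := ENNReal.mul_lt_top (by simp) (hII'.trans_lt hI'fin)
    have hbd : ∃ B, ∀ ζ, nf (1 + ε / 2) φ ω' f ζ ≤ B := by
      refine ⟨(ENNReal.ofReal C4 * I).toReal ^ (1 / q), fun ζ => ?_⟩
      have e := (ENNReal.ofReal_le_iff_le_toReal hfinB.ne).1 (hpw ζ)
      have e2 := Real.rpow_le_rpow (Real.rpow_nonneg (hn0 f ζ) q) e (by positivity : 0 ≤ 1 / q)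
      rwa [← Real.rpow_mul (hn0 f ζ), mul_one_div_cancel hq0.ne', Real.rpow_one] at e2
    have hup : I ≤ ENNReal.ofReal A * S :=
      h.final_upper (h.sep_countable hsep) hq hC1 hC2 hC3 h2 h3 (hn0 f) (hst f hf hbd)
    have hlow : S ≤ ENNReal.ofReal E * I' := by
      calc S ≤ ∑' l : Λ, ENNReal.ofReal C4 * ∫⁻ w in ball l.1 (δ * ρ l.1),
            ENNReal.ofReal (nf (1 + ε / 2) φ ω' f w ^ q / ρ w ^ 2) :=
            ENNReal.tsum_le_tsum fun l => hmv _ (by linarith) (by linarith) f hf l.1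
        _ ≤ ENNReal.ofReal C4 * I := by
            rw [ENNReal.tsum_mul_left]
            exact mul_le_mul_right (hss _) _
        _ ≤ _ := mul_le_mul' (ENNReal.ofReal_le_ofReal (le_max_left _ _)) hII'
    have hup' : I' ≤ ENNReal.ofReal E * S := by
      calc I' ≤ ENNReal.ofReal (K ^ 2) * (ENNReal.ofReal A * S) := hI'I.trans (mul_le_mul_right hup _)
        _ = ENNReal.ofReal (K ^ 2 * A) * S := by rw [← mul_assoc, ← ENNReal.ofReal_mul (sq_nonneg K)]
        _ ≤ _ := mul_le_mul_left (ENNReal.ofReal_le_ofReal (le_max_right _ _)) _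
    have hcoe : (((E ^ (1 / q)).toNNReal : ℝ≥0) : ℝ≥0∞) = ENNReal.ofReal E ^ (1 / q) := by
      rw [ENNReal.ofReal_rpow_of_pos hE0]; rfl
    have hq1 : 0 ≤ 1 / q := by positivity
    constructor
    · rw [ENNReal.inv_mul_le_iff (by simpa using hEq) (by simp), hcoe, ← ENNReal.mul_rpow_of_nonneg _ _ hq1]
      exact ENNReal.rpow_le_rpow hlow hq1
    · rw [hcoe, ← ENNReal.mul_rpow_of_nonneg _ _ hq1]
      exact ENNReal.rpow_le_rpow hup' hq1

end
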